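/- arXiv:1809.07919 — 3 statements merged into one kernel-verified Lean document; each statement's English description precedes it below -/
import Mathlib

section
/- Let $B_r(0)$ be a ball in $\mathbb{C}^n$, $\alpha\in(0,1]$, and let $g=(g_{i\bar j})$ be a map from $\overline{B_r(0)}$ to $n\times n$ positive definite Hermitian matrices whose entries belong to $C^{1,\alpha}(\overline{B_r(0)})$ (so $\omega=\mathrm{i}\sum g_{i\bar j}dz_i\wedge d\bar z_j$ is a Hermitian form). Suppose $u\in C^2(B_r(0))\cap C(\overline{B_r(0)})$ satisfies: the matrix $(g_{i\bar j}(z)+u_{i\bar j}(z))$ is positive semidefinite for all $z\in B_r(0)$, $\det(g_{i\bar j}+u_{i\bar j})=f$ in $B_r(0)$ with $f\geq 0$ and $f^{1/n}\in C^{1,\alpha}(\overline{B_r(0)})$, and $u=\varphi$ on $\partial B_r(0)$ with $\varphi\in C^{1,\alpha}(\partial B_r(0))$. Then for every $t\in(0,1)$ there is a constant $C=C(n,t)$ depending only on $n$ and $t$ such that $[u]_{1,\alpha;B_{(1-t)r}(0)}\leq C\,([\varphi]_{1,\alpha;\partial B_r(0)}+r^{1-\alpha}|f^{1/n}|'_{1,\alpha;B_r(0)}+r^{1-\alpha}|g|'_{1,\alpha;B_r(0)})$.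 -/
open Metric Set
open scoped ComplexOrder

/-- The complex Hessian matrix `(u_{i j̄})` of a function `u : ℂⁿ → ℝ`, where
`u_{i j̄} = ∂²u/∂z_i∂z̄_j = (1/4)(u_{xᵢxⱼ} + u_{yᵢyⱼ} + i (u_{xᵢyⱼ} - u_{yᵢxⱼ}))`,
computed via real Fréchet derivatives. -/
noncomputable def cxHessian (n : ℕ) (u : EuclideanSpace ℂ (Fin n) → ℝ)
    (z : EuclideanSpace ℂ (Fin n)) : Matrix (Fin n) (Fin n) ℂ :=
  Matrix.of fun i j =>
    (1 / 4 : ℂ) *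
      (Complex.ofReal
          ((fderiv ℝ (fun w => fderiv ℝ u w (EuclideanSpace.single j (1 : ℂ))) z)
              (EuclideanSpace.single i (1 : ℂ))
            + (fderiv ℝ (fun w => fderiv ℝ u w (EuclideanSpace.single j Complex.I)) z)
              (EuclideanSpace.single i Complex.I))
        + Complex.I *
          Complex.ofReal
            ((fderiv ℝ (fun w => fderiv ℝ u w (EuclideanSpace.single j Complex.I)) z)
                (EuclideanSpace.single i (1 : ℂ))
              - (fderiv ℝ (fun w => fderiv ℝ u w (EuclideanSpace.single j (1 : ℂ))) z)
                (EuclideanSpace.single i Complex.I)))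

open Filter Topology Matrix

/-! ### Quadratic forms and the arithmetic-geometric mean inequality for matrices -/

section MatrixInequalities

/-- The Hermitian quadratic form `∑ ξᵢ Aᵢⱼ ξ̄ⱼ` attached to a complex matrix (real part). -/
noncomputable def levi {n : ℕ} (A : Matrix (Fin n) (Fin n) ℂ) (ξ : EuclideanSpace ℂ (Fin n)) : ℝ :=
  (∑ i, ∑ j, ξ i * A i j * star (ξ j)).re

lemma levi_add {n : ℕ} (A B : Matrix (Fin n) (Fin n) ℂ) (ξ : EuclideanSpace ℂ (Fin n)) :
    levi (A + B) ξ = levi A ξ + levi B ξ := by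
  simp only [levi, Matrix.add_apply, mul_add, add_mul, Finset.sum_add_distrib, Complex.add_re]

lemma levi_eq_dotProduct {n : ℕ} (A : Matrix (Fin n) (Fin n) ℂ) (ξ : EuclideanSpace ℂ (Fin n)) :
    levi A ξ = (star (star (ξ : Fin n → ℂ)) ⬝ᵥ (A *ᵥ star (ξ : Fin n → ℂ))).re := by
  simp only [levi, star_star, dotProduct, mulVec, Finset.mul_sum, Pi.star_apply, mul_assoc]

lemma levi_nonneg {n : ℕ} {A : Matrix (Fin n) (Fin n) ℂ} (hA : A.PosSemidef)
    (ξ : EuclideanSpace ℂ (Fin n)) : 0 ≤ levi A ξ := by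
  rw [levi_eq_dotProduct]
  exact hA.re_dotProduct_nonneg _

lemma posDef_of_levi_pos {n : ℕ} {A : Matrix (Fin n) (Fin n) ℂ} (hA : A.PosSemidef)
    (h : ∀ ξ : EuclideanSpace ℂ (Fin n), ξ ≠ 0 → 0 < levi A ξ) : A.PosDef := by
  refine PosDef.of_dotProduct_mulVec_pos hA.1 fun x hx => ?_
  have h1 := h (WithLp.toLp 2 (star x)) (by
    intro h0
    apply hx
    have : star x = 0 := by simpa using congrArg (WithLp.ofLp) h0
    simpa using this)
  rw [levi_eq_dotProduct] at h1
  simp only [star_star] at h1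
  have h2 := hA.dotProduct_mulVec_nonneg x
  rw [Complex.nonneg_iff] at h2
  rw [Complex.pos_iff]
  exact ⟨h1, h2.2⟩

lemma sum_levi_rows {n : ℕ} (A N : Matrix (Fin n) (Fin n) ℂ) :
    ∑ k, levi A (WithLp.toLp 2 (N k)) = (N * A * Nᴴ).trace.re := by
  simp only [levi, trace, diag, mul_apply, conjTranspose_apply, Finset.sum_mul, Complex.re_sum]
  refine Finset.sum_congr rfl fun k _ => ?_
  rw [Finset.sum_comm]

lemma le_sum_levi_rows {n : ℕ} (hn : 0 < n) {A : Matrix (Fin n) (Fin n) ℂ} (hA : A.PosSemidef)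
    {a : ℝ} (ha : 0 ≤ a) (hdet : A.det = ((a ^ n : ℝ) : ℂ)) (N : Matrix (Fin n) (Fin n) ℂ) :
    n * (a * ‖N.det‖ ^ (2 / n : ℝ)) ≤ ∑ k, levi A (WithLp.toLp 2 (N k)) := by
  have hn' : (0 : ℝ) < n := by exact_mod_cast hn
  rw [sum_levi_rows]
  have hB := hA.mul_mul_conjTranspose_same N
  set B := N * A * Nᴴ with hBdef
  have htr : B.trace.re = ∑ i, hB.1.eigenvalues i := by
    rw [hB.1.trace_eq_sum_eigenvalues]
    simp
  have hd : ∏ i, hB.1.eigenvalues i = a ^ n * ‖N.det‖ ^ 2 := by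
    have h1 := hB.1.det_eq_prod_eigenvalues
    have h2 : B.det = ((a ^ n * ‖N.det‖ ^ 2 : ℝ) : ℂ) := by
      rw [hBdef, det_mul, det_mul, det_conjTranspose, hdet]
      have := Complex.mul_conj' N.det
      push_cast
      rw [← this, Complex.star_def]
      ring
    rw [h2] at h1
    have h3 : ((∏ i, hB.1.eigenvalues i : ℝ) : ℂ) = ((a ^ n * ‖N.det‖ ^ 2 : ℝ) : ℂ) := by
      rw [h1]; simp
    exact_mod_cast h3
  have hgm := Real.geom_mean_le_arith_mean_weighted Finset.univ (fun _ : Fin n => (1 / n : ℝ))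
    hB.1.eigenvalues (fun i _ => by positivity) (by simp [hn'.ne'])
    (fun i _ => hB.eigenvalues_nonneg i)
  rw [Real.finsetProd_rpow _ _ (fun i _ => hB.eigenvalues_nonneg i), hd, ← Finset.mul_sum, ← htr,
    Real.mul_rpow (by positivity) (by positivity)] at hgm
  have e1 : (a ^ n : ℝ) ^ (1 / n : ℝ) = a := by
    rw [one_div, Real.pow_rpow_inv_natCast ha hn.ne']
  have e2 : (‖N.det‖ ^ 2 : ℝ) ^ (1 / n : ℝ) = ‖N.det‖ ^ (2 / n : ℝ) := by
    rw [← Real.rpow_natCast, ← Real.rpow_mul (norm_nonneg _)]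
    congr 1
    push_cast
    ring
  rw [e1, e2] at hgm
  have := mul_le_mul_of_nonneg_left hgm hn'.le
  calc _ ≤ _ := this
    _ = _ := by field_simp

lemma exists_mul_mul_conjTranspose_eq_one {n : ℕ} {A : Matrix (Fin n) (Fin n) ℂ} (hA : A.PosDef) :
    ∃ N : Matrix (Fin n) (Fin n) ℂ, N * A * Nᴴ = 1 := by
  open scoped MatrixOrder in
  have h := hA.isStrictlyPositive
  obtain ⟨B, hB⟩ := CStarAlgebra.nonneg_iff_eq_star_mul_self.mp h.nonneg
  have hBu : IsUnit B.det := by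
    have h1 := hA.det_pos
    rw [hB, det_mul] at h1
    exact isUnit_iff_ne_zero.mpr fun h0 => by simp [h0] at h1
  refine ⟨(B⁻¹)ᴴ, ?_⟩
  rw [hB, conjTranspose_conjTranspose, star_eq_conjTranspose, ← Matrix.mul_assoc,
    ← conjTranspose_mul, mul_nonsing_inv _ hBu]
  simp [mul_nonsing_inv _ hBu]

/-- A matrix version of the concavity of `det ^ (1 / n)`. -/
lemma det_root_ge_of_levi_ge {n : ℕ} (hn : 0 < n) {A₀ A₁ A₂ L₁ L₂ : Matrix (Fin n) (Fin n) ℂ}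
    (h₀ : A₀.PosSemidef) (h₁ : A₁.PosSemidef) (h₂ : A₂.PosSemidef) {a₀ a₁ a₂ μ₁ μ₂ κ : ℝ}
    (ha₀ : 0 ≤ a₀) (ha₁ : 0 ≤ a₁) (ha₂ : 0 ≤ a₂) (hμ₁ : 0 ≤ μ₁) (hμ₂ : 0 ≤ μ₂) (hκ : 0 < κ)
    (hd₀ : A₀.det = ((a₀ ^ n : ℝ) : ℂ)) (hd₁ : A₁.det = ((a₁ ^ n : ℝ) : ℂ))
    (hd₂ : A₂.det = ((a₂ ^ n : ℝ) : ℂ))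
    (h : ∀ ξ : EuclideanSpace ℂ (Fin n), μ₁ * levi A₁ (WithLp.toLp 2 (L₁ *ᵥ ξ)) +
      μ₂ * levi A₂ (WithLp.toLp 2 (L₂ *ᵥ ξ)) + κ * ‖ξ‖ ^ 2 ≤ levi A₀ ξ) :
    μ₁ * (‖L₁.det‖ ^ (2 / n : ℝ) * a₁) + μ₂ * (‖L₂.det‖ ^ (2 / n : ℝ) * a₂) + κ ≤ a₀ := by
  have hn' : (0 : ℝ) < n := by exact_mod_cast hn
  have hpd : A₀.PosDef := by
    refine posDef_of_levi_pos h₀ fun ξ hξ => lt_of_lt_of_le ?_ (h ξ)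
    have := mul_nonneg hμ₁ (levi_nonneg h₁ (WithLp.toLp 2 (L₁ *ᵥ ξ)))
    have := mul_nonneg hμ₂ (levi_nonneg h₂ (WithLp.toLp 2 (L₂ *ᵥ ξ)))
    have : 0 < κ * ‖ξ‖ ^ 2 := by positivity
    linarith
  obtain ⟨N, hN⟩ := exists_mul_mul_conjTranspose_eq_one hpd
  have hdet : a₀ * ‖N.det‖ ^ (2 / n : ℝ) = 1 := by
    have h1 := congrArg (fun M => ‖M.det‖) hN
    simp only [det_mul, det_conjTranspose, hd₀, norm_mul, norm_star, det_one, norm_one,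
      Complex.norm_real, Real.norm_eq_abs, abs_of_nonneg (pow_nonneg ha₀ n)] at h1
    have h2 : a₀ ^ n * ‖N.det‖ ^ 2 = 1 := by rw [← h1]; ring
    have h3 := congrArg (fun x : ℝ => x ^ (1 / n : ℝ)) h2
    simp only [Real.one_rpow] at h3
    rw [Real.mul_rpow (by positivity) (by positivity), one_div,
      Real.pow_rpow_inv_natCast ha₀ hn.ne', ← Real.rpow_natCast,
      ← Real.rpow_mul (norm_nonneg _)] at h3
    rw [← h3]
    congr 2
  have hrow : ∀ (A L : Matrix (Fin n) (Fin n) ℂ) (k : Fin n),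
      levi A (WithLp.toLp 2 (L *ᵥ (WithLp.toLp 2 (N k) : EuclideanSpace ℂ (Fin n)))) =
        levi A (WithLp.toLp 2 ((N * Lᵀ) k)) := by
    intro A L k
    congr 2
    ext i
    simp [mulVec, dotProduct, mul_apply, mul_comm]
  have hmul : ∀ L : Matrix (Fin n) (Fin n) ℂ, ‖(N * Lᵀ).det‖ ^ (2 / n : ℝ) =
      ‖N.det‖ ^ (2 / n : ℝ) * ‖L.det‖ ^ (2 / n : ℝ) := by
    intro L
    rw [det_mul, det_transpose, norm_mul, Real.mul_rpow (norm_nonneg _) (norm_nonneg _)]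
  have hsum := Finset.sum_le_sum fun k (_ : k ∈ Finset.univ) => h (WithLp.toLp 2 (N k))
  have s0 : ∑ k, levi A₀ (WithLp.toLp 2 (N k)) = n := by
    rw [sum_levi_rows, hN]; simp
  have s1 := le_sum_levi_rows hn h₁ ha₁ hd₁ (N * L₁ᵀ)
  have s2 := le_sum_levi_rows hn h₂ ha₂ hd₂ (N * L₂ᵀ)
  have s3 := le_sum_levi_rows hn PosSemidef.one zero_le_one (by simp) N
  have s4 : ∀ k, levi 1 (WithLp.toLp 2 (N k)) =
      ‖(WithLp.toLp 2 (N k) : EuclideanSpace ℂ (Fin n))‖ ^ 2 := by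
    intro k
    rw [EuclideanSpace.norm_sq_eq]
    simp only [levi, one_apply, Complex.re_sum]
    refine Finset.sum_congr rfl fun i _ => ?_
    rw [← Complex.re_sum]
    simp [Complex.mul_conj, Complex.normSq_eq_norm_sq]
    norm_cast
  simp only [s4] at s3
  simp only [hrow, Finset.sum_add_distrib, ← Finset.mul_sum] at hsum
  rw [s0] at hsum
  rw [hmul] at s1 s2
  set ν := ‖N.det‖ ^ (2 / n : ℝ)
  have hν : 0 < ν := by
    rcases (Real.rpow_nonneg (norm_nonneg N.det) (2 / n : ℝ)).lt_or_eq with h' | h'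
    · exact h'
    · exfalso
      have : ν = 0 := h'.symm
      rw [this] at hdet
      simp at hdet
  have t1 := mul_le_mul_of_nonneg_left s1 hμ₁
  have t2 := mul_le_mul_of_nonneg_left s2 hμ₂
  have t3 := mul_le_mul_of_nonneg_left s3 hκ.le
  have key : (n * ν) * (μ₁ * (‖L₁.det‖ ^ (2 / n : ℝ) * a₁) +
      μ₂ * (‖L₂.det‖ ^ (2 / n : ℝ) * a₂) + κ) ≤ (n * ν) * a₀ := by
    have : (n * ν) * a₀ = n := by rw [mul_assoc, mul_comm ν, hdet, mul_one]
    rw [this]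
    refine le_trans (le_of_eq ?_) ((add_le_add (add_le_add t1 t2) t3).trans hsum)
    ring
  exact le_of_mul_le_mul_left key (by positivity)

end MatrixInequalities

/-! ### Second derivatives along lines and the Laplacian of a function of a complex variable -/

section Laplacian

/-- The function `p` of a real variable has second derivative `m` at `0`. -/
def HasSecondDeriv (p : ℝ → ℝ) (m : ℝ) : Prop :=
  ∃ ρ : ℝ → ℝ, (∀ᶠ s in 𝓝 0, HasDerivAt p (ρ s) s) ∧ HasDerivAt ρ m 0

lemma HasSecondDeriv.add {p q : ℝ → ℝ} {m k : ℝ} (hp : HasSecondDeriv p m)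
    (hq : HasSecondDeriv q k) : HasSecondDeriv (fun s => p s + q s) (m + k) := by
  obtain ⟨ρ, h1, h2⟩ := hp
  obtain ⟨θ, h3, h4⟩ := hq
  refine ⟨fun s => ρ s + θ s, ?_, h2.add h4⟩
  filter_upwards [h1, h3] with s a b using a.add b

lemma HasSecondDeriv.const_mul {p : ℝ → ℝ} {m : ℝ} (c : ℝ) (hp : HasSecondDeriv p m) :
    HasSecondDeriv (fun s => c * p s) (c * m) := by
  obtain ⟨ρ, h1, h2⟩ := hp
  refine ⟨fun s => c * ρ s, ?_, h2.const_mul c⟩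
  filter_upwards [h1] with s a using a.const_mul c

lemma HasSecondDeriv.nonpos_of_isLocalMax {p : ℝ → ℝ} {m : ℝ} (hp : HasSecondDeriv p m)
    (hmax : IsLocalMax p 0) : m ≤ 0 := by
  obtain ⟨ρ, h1, h2⟩ := hp
  by_contra! hm
  have e1 : deriv p =ᶠ[𝓝 0] ρ := by
    filter_upwards [h1] with s hs using hs.deriv
  have e2 : deriv (deriv p) 0 = m := by rw [e1.deriv_eq, h2.deriv]
  have hmin : IsLocalMin p 0 := isLocalMin_of_deriv_deriv_pos (by rw [e2]; exact hm)
    hmax.deriv_eq_zero h1.self_of_nhds.continuousAt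
  have e3 : p =ᶠ[𝓝 0] fun _ => p 0 := by
    filter_upwards [hmin, hmax] with s a b using le_antisymm b a
  have e4 : deriv p =ᶠ[𝓝 0] fun _ => (0 : ℝ) := by simpa using e3.deriv
  have e5 : deriv (deriv p) 0 = 0 := by simpa using e4.deriv_eq
  linarith

/-- The function `p` of a complex variable has Laplacian `L` at `0`. -/
def HasLaplacian (p : ℂ → ℝ) (L : ℝ) : Prop :=
  ∃ m₁ m₂ : ℝ, HasSecondDeriv (fun s : ℝ => p (s * 1)) m₁ ∧
    HasSecondDeriv (fun s : ℝ => p (s * Complex.I)) m₂ ∧ m₁ + m₂ = L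

lemma HasLaplacian.add {p q : ℂ → ℝ} {L M : ℝ} (hp : HasLaplacian p L) (hq : HasLaplacian q M) :
    HasLaplacian (fun ζ => p ζ + q ζ) (L + M) := by
  obtain ⟨a, b, h1, h2, rfl⟩ := hp
  obtain ⟨c, d, h3, h4, rfl⟩ := hq
  exact ⟨a + c, b + d, h1.add h3, h2.add h4, by ring⟩

lemma HasLaplacian.const_mul {p : ℂ → ℝ} {L : ℝ} (c : ℝ) (hp : HasLaplacian p L) :
    HasLaplacian (fun ζ => c * p ζ) (c * L) := by
  obtain ⟨a, b, h1, h2, rfl⟩ := hp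
  exact ⟨c * a, c * b, h1.const_mul c, h2.const_mul c, by ring⟩

lemma HasLaplacian.nonpos_of_isLocalMax {p : ℂ → ℝ} {L : ℝ} (hp : HasLaplacian p L)
    (hmax : IsLocalMax p 0) : L ≤ 0 := by
  obtain ⟨a, b, h1, h2, rfl⟩ := hp
  have key : ∀ v : ℂ, IsLocalMax (fun s : ℝ => p (s * v)) 0 := by
    intro v
    have hc : ContinuousAt (fun s : ℝ => (s : ℂ) * v) 0 := by fun_prop
    have : Tendsto (fun s : ℝ => (s : ℂ) * v) (𝓝 0) (𝓝 0) := by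
      have := hc.tendsto
      simpa using this
    have h := this.eventually hmax
    simpa [IsLocalMax, IsMaxFilter] using h
  have := h1.nonpos_of_isLocalMax (key _)
  have := h2.nonpos_of_isLocalMax (key _)
  linarith

/-- Four times the Levi form of `u` at `z` in the direction `ξ`. -/
noncomputable def lineLaplacian {n : ℕ} (u : EuclideanSpace ℂ (Fin n) → ℝ)
    (z ξ : EuclideanSpace ℂ (Fin n)) : ℝ :=
  fderiv ℝ (fderiv ℝ u) z ξ ξ + fderiv ℝ (fderiv ℝ u) z (Complex.I • ξ) (Complex.I • ξ)

lemma ContDiffAt.eventually_hasFDerivAt_two {F : Type*} [NormedAddCommGroup F] [NormedSpace ℝ F]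
    {u : F → ℝ} {z : F} (hu : ContDiffAt ℝ 2 u z) :
    (∀ᶠ w in 𝓝 z, HasFDerivAt u (fderiv ℝ u w) w) ∧
      HasFDerivAt (fderiv ℝ u) (fderiv ℝ (fderiv ℝ u) z) z := by
  constructor
  · filter_upwards [hu.eventually (by simp)] with w hw
    exact (hw.differentiableAt (by simp)).hasFDerivAt
  · exact ((hu.fderiv_right (m := 1) (by norm_num)).differentiableAt (by simp)).hasFDerivAt

/-- The Laplacian of the composition of a `C²` function with a holomorphic curve. -/
lemma hasLaplacian_comp {n : ℕ} {u : EuclideanSpace ℂ (Fin n) → ℝ}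
    {γ γ' : ℂ → EuclideanSpace ℂ (Fin n)} {b : EuclideanSpace ℂ (Fin n)}
    (hu : ContDiffAt ℝ 2 u (γ 0)) (hγ : ∀ᶠ ζ in 𝓝 0, HasDerivAt γ (γ' ζ) ζ)
    (hγ' : HasDerivAt γ' b 0) :
    HasLaplacian (fun ζ => u (γ ζ)) (lineLaplacian u (γ 0) (γ' 0)) := by
  obtain ⟨hu1, hu2⟩ := hu.eventually_hasFDerivAt_two
  have key : ∀ v : ℂ, HasSecondDeriv (fun s : ℝ => u (γ (s * v)))
      (fderiv ℝ (fderiv ℝ u) (γ 0) (v • γ' 0) (v • γ' 0) + fderiv ℝ u (γ 0) (v • v • b)) := by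
    intro v
    have hl : ∀ s : ℝ, HasDerivAt (fun s : ℝ => (s : ℂ) * v) v s := fun s => by
      simpa using (Complex.ofRealCLM.hasDerivAt (x := s)).mul_const v
    have hl0 : Tendsto (fun s : ℝ => (s : ℂ) * v) (𝓝 0) (𝓝 0) := by
      simpa using (hl 0).continuousAt.tendsto
    have h0 : ((0 : ℝ) : ℂ) * v = 0 := by simp
    have hγv : ∀ᶠ s : ℝ in 𝓝 0, HasDerivAt (fun s : ℝ => γ (s * v)) (v • γ' (s * v)) s := by
      filter_upwards [hl0.eventually hγ] with s hs
      exact HasDerivAt.scomp s hs (hl s)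
    have hγc : Tendsto (fun s : ℝ => γ (s * v)) (𝓝 0) (𝓝 (γ 0)) := by
      have := hγv.self_of_nhds.continuousAt.tendsto
      simpa using this
    have hγ'v : HasDerivAt (fun s : ℝ => v • γ' (s * v)) (v • v • b) 0 := by
      refine HasDerivAt.const_smul v ?_
      exact HasDerivAt.scomp (0 : ℝ) (by rw [h0]; exact hγ') (hl 0)
    refine ⟨fun s => fderiv ℝ u (γ (s * v)) (v • γ' (s * v)), ?_, ?_⟩
    · filter_upwards [hγv, hγc.eventually hu1] with s h1 h2
      exact h2.comp_hasDerivAt s h1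
    · have h1 : HasDerivAt (fun s : ℝ => fderiv ℝ u (γ (s * v)))
          (fderiv ℝ (fderiv ℝ u) (γ 0) (v • γ' 0)) 0 := by
        have := HasFDerivAt.comp_hasDerivAt (0 : ℝ) (f := fun s : ℝ => γ (s * v))
          (l := fderiv ℝ u) (by rw [h0]; exact hu2) hγv.self_of_nhds
        rw [h0] at this
        exact this
      have h2 := h1.clm_apply hγ'v
      simpa [h0] using h2
  refine ⟨_, _, key 1, key Complex.I, ?_⟩
  have : Complex.I • Complex.I • b = -b := by
    rw [smul_smul, Complex.I_mul_I, neg_one_smul]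
  rw [this]
  simp only [lineLaplacian, one_smul, map_neg]
  ring

end Laplacian

/-! ### The Levi form and the complex Hessian -/

section LeviForm

lemma levi_cxHessian {n : ℕ} {u : EuclideanSpace ℂ (Fin n) → ℝ} {z : EuclideanSpace ℂ (Fin n)}
    (hu : ContDiffAt ℝ 2 u z) (ξ : EuclideanSpace ℂ (Fin n)) :
    levi (cxHessian n u z) ξ = 1 / 4 * lineLaplacian u z ξ := by
  obtain ⟨-, hu2⟩ := hu.eventually_hasFDerivAt_two
  have hD : ∀ v x, fderiv ℝ (fun w => fderiv ℝ u w v) z x = fderiv ℝ (fderiv ℝ u) z x v := by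
    intro v x
    rw [(hu2.clm_apply (hasFDerivAt_const v z)).fderiv]
    simp
  set B := fderiv ℝ (fderiv ℝ u) z with hB
  have hξ : ξ = ∑ i, ((ξ i).re • EuclideanSpace.single i (1 : ℂ) +
      (ξ i).im • EuclideanSpace.single i Complex.I) := by
    ext j
    simp [Finset.sum_add_distrib, Pi.single_apply, Complex.re_add_im]
  have hIξ : Complex.I • ξ = ∑ i, ((ξ i).re • EuclideanSpace.single i Complex.I -
      (ξ i).im • EuclideanSpace.single i (1 : ℂ)) := by
    ext j
    simp [Finset.sum_apply, Pi.single_apply]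
    apply Complex.ext <;> simp
  have h1 := congrArg₂ (fun x y => B x y) hξ hξ
  rw [lineLaplacian, ← hB, hIξ, h1]
  simp only [map_sum, _root_.sum_apply]
  rw [← Finset.sum_add_distrib, Finset.mul_sum]
  simp only [levi, Complex.re_sum]
  rw [Finset.sum_comm]
  refine Finset.sum_congr rfl fun i _ => ?_
  rw [← Finset.sum_add_distrib, Finset.mul_sum]
  refine Finset.sum_congr rfl fun j _ => ?_
  simp only [cxHessian, of_apply, hD, map_add, map_sub, map_smul, _root_.add_apply,
    _root_.sub_apply, _root_.smul_apply, smul_eq_mul]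
  simp only [one_div, Complex.star_def, Complex.mul_re, Complex.mul_im, Complex.add_re,
    Complex.add_im, Complex.ofReal_re, Complex.ofReal_im, Complex.I_re, Complex.I_im,
    Complex.conj_re, Complex.conj_im, Complex.inv_re, Complex.inv_im, Complex.re_ofNat,
    Complex.im_ofNat, Complex.normSq_ofNat]
  ring

end LeviForm

/-! ### A one-parameter family of automorphisms of the unit ball -/

section BallAutomorphisms

/-- The space `ℂⁿ` with its Hermitian structure. -/
abbrev Cn (n : ℕ) := EuclideanSpace ℂ (Fin n)

variable {n : ℕ}

/-- The denominator of the transvection `ballAut e τ`. -/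
noncomputable def autDen (e : Cn n) (τ : ℝ) (z : Cn n) : ℂ :=
  (Real.cosh τ : ℂ) + (Real.sinh τ : ℂ) * inner ℂ e z

/-- The transvection of the unit ball along the unit vector `e`, with parameter `τ`. -/
noncomputable def ballAut (e : Cn n) (τ : ℝ) (z : Cn n) : Cn n :=
  (autDen e τ z)⁻¹ • (z + (((Real.cosh τ : ℂ) - 1) * inner ℂ e z + (Real.sinh τ : ℂ)) • e)

/-- The complex derivative of `ballAut e τ` at `z` in the direction `ξ`. -/
noncomputable def ballAutDeriv (e : Cn n) (τ : ℝ) (z ξ : Cn n) : Cn n :=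
  (autDen e τ z)⁻¹ • (ξ + (((Real.cosh τ : ℂ) - 1) * inner ℂ e ξ) • e -
    ((Real.sinh τ : ℂ) * inner ℂ e ξ) • ballAut e τ z)

/-- The vector field generating the flow `τ ↦ ballAut e τ`. -/
noncomputable def ballField (e z : Cn n) : Cn n := e - inner ℂ e z • z

lemma ballAut_zero (e z : Cn n) : ballAut e 0 z = z := by simp [ballAut, autDen]

lemma ballAutDeriv_zero (e z ξ : Cn n) : ballAutDeriv e 0 z ξ = ξ := by
  simp [ballAutDeriv, autDen]

lemma norm_inner_le_of_unit {e : Cn n} (he : ‖e‖ = 1) (z : Cn n) : ‖inner ℂ e z‖ ≤ ‖z‖ := by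
  simpa [he] using norm_inner_le_norm (𝕜 := ℂ) e z

lemma third_le_norm_autDen {e z : Cn n} {τ : ℝ} (he : ‖e‖ = 1) (hz : ‖z‖ ≤ 1) (hτ : |τ| ≤ 1) :
    1 / 3 ≤ ‖autDen e τ z‖ := by
  have h1 : ‖(Real.sinh τ : ℂ) * inner ℂ e z‖ ≤ |Real.sinh τ| := by
    rw [norm_mul, Complex.norm_real, Real.norm_eq_abs]
    exact mul_le_of_le_one_right (abs_nonneg _) ((norm_inner_le_of_unit he z).trans hz)
  have h2 : ‖(Real.cosh τ : ℂ)‖ = Real.cosh τ := by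
    rw [Complex.norm_real, Real.norm_eq_abs, abs_of_pos (Real.cosh_pos τ)]
  have h3 : Real.cosh τ - |Real.sinh τ| = Real.exp (-|τ|) := by
    rw [← Real.cosh_sub_sinh, Real.cosh_abs, Real.abs_sinh]
  have h4 : Real.exp (-1) ≤ Real.exp (-|τ|) := Real.exp_le_exp.mpr (by linarith)
  have h5 : 1 / 3 ≤ Real.exp (-1) := by
    rw [Real.exp_neg, one_div]
    exact inv_anti₀ (Real.exp_pos 1) Real.exp_one_lt_three.le
  have h6 := norm_sub_norm_le (Real.cosh τ : ℂ) (-((Real.sinh τ : ℂ) * inner ℂ e z))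
  rw [norm_neg, sub_neg_eq_add] at h6
  unfold autDen
  linarith

lemma autDen_ne_zero {e z : Cn n} {τ : ℝ} (he : ‖e‖ = 1) (hz : ‖z‖ ≤ 1) (hτ : |τ| ≤ 1) :
    autDen e τ z ≠ 0 := by
  rw [← norm_pos_iff]
  linarith [third_le_norm_autDen he hz hτ]

lemma norm_inv_autDen_le {e z : Cn n} {τ : ℝ} (he : ‖e‖ = 1) (hz : ‖z‖ ≤ 1) (hτ : |τ| ≤ 1) :
    ‖(autDen e τ z)⁻¹‖ ≤ 3 := by
  rw [norm_inv]
  exact inv_le_of_inv_le₀ (by norm_num) (by simpa using third_le_norm_autDen he hz hτ)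

lemma ofReal_cosh_sq_sub_sinh_sq (τ : ℝ) :
    (Real.cosh τ : ℂ) ^ 2 - (Real.sinh τ : ℂ) ^ 2 = 1 := by
  exact_mod_cast Real.cosh_sq_sub_sinh_sq τ

lemma inner_self_of_unit {e : Cn n} (he : ‖e‖ = 1) : inner ℂ e e = (1 : ℂ) := by
  rw [inner_self_eq_norm_sq_to_K, he]; simp

lemma one_sub_norm_ballAut_sq {e z : Cn n} {τ : ℝ} (he : ‖e‖ = 1) (hd : autDen e τ z ≠ 0) :
    ‖autDen e τ z‖ ^ 2 * (1 - ‖ballAut e τ z‖ ^ 2) = 1 - ‖z‖ ^ 2 := by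
  set β : ℂ := ((Real.cosh τ : ℂ) - 1) * inner ℂ e z + (Real.sinh τ : ℂ) with hβ
  have h1 : ‖autDen e τ z‖ * ‖ballAut e τ z‖ = ‖z + β • e‖ := by
    rw [ballAut, norm_smul, norm_inv, mul_inv_cancel_left₀ (norm_ne_zero_iff.mpr hd)]
  have h2 : ‖z + β • e‖ ^ 2 = ‖z‖ ^ 2 + 2 * (β * star (inner ℂ e z)).re + ‖β‖ ^ 2 := by
    rw [norm_add_sq (𝕜 := ℂ), inner_smul_right, norm_smul, he, mul_one, Complex.star_def,
      inner_conj_symm]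
    rfl
  have h3 : ‖autDen e τ z‖ ^ 2 * (1 - ‖ballAut e τ z‖ ^ 2) =
      ‖autDen e τ z‖ ^ 2 - ‖z + β • e‖ ^ 2 := by rw [← h1]; ring
  rw [h3, h2]
  have h4 := Real.cosh_sq_sub_sinh_sq τ
  rw [autDen, hβ]
  generalize inner ℂ e z = c
  simp only [← Complex.normSq_eq_norm_sq, Complex.normSq_apply, Complex.star_def, Complex.mul_re,
    Complex.add_re, Complex.add_im, Complex.mul_im, Complex.ofReal_re, Complex.ofReal_im,
    Complex.sub_re, Complex.sub_im, Complex.one_re, Complex.one_im, Complex.conj_re,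
    Complex.conj_im]
  linear_combination (1 - c.re ^ 2 - c.im ^ 2) * h4

lemma norm_ballAut_lt {e z : Cn n} {τ : ℝ} (he : ‖e‖ = 1) (hz : ‖z‖ < 1) (hτ : |τ| ≤ 1) :
    ‖ballAut e τ z‖ < 1 := by
  have hd := autDen_ne_zero he hz.le hτ
  have h := one_sub_norm_ballAut_sq he hd
  have h1 : 0 < ‖autDen e τ z‖ ^ 2 := by positivity
  have h2 : 0 < ‖autDen e τ z‖ ^ 2 * (1 - ‖ballAut e τ z‖ ^ 2) := by
    rw [h]; nlinarith [norm_nonneg z]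
  have h3 := pos_of_mul_pos_right h2 h1.le
  nlinarith [norm_nonneg (ballAut e τ z)]

lemma norm_ballAut_eq_one {e z : Cn n} {τ : ℝ} (he : ‖e‖ = 1) (hz : ‖z‖ = 1) (hτ : |τ| ≤ 1) :
    ‖ballAut e τ z‖ = 1 := by
  have hd := autDen_ne_zero he hz.le hτ
  have h := one_sub_norm_ballAut_sq he hd
  rw [hz] at h
  have h1 : ‖autDen e τ z‖ ^ 2 ≠ 0 := by positivity
  have h2 : 1 - ‖ballAut e τ z‖ ^ 2 = 0 := by
    rcases mul_eq_zero.mp (h.trans (by norm_num)) with h' | h'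
    · exact absurd h' h1
    · exact h'
  nlinarith [norm_nonneg (ballAut e τ z)]

lemma norm_ballAut_le {e z : Cn n} {τ : ℝ} (he : ‖e‖ = 1) (hz : ‖z‖ ≤ 1) (hτ : |τ| ≤ 1) :
    ‖ballAut e τ z‖ ≤ 1 := by
  rcases hz.lt_or_eq with h | h
  · exact (norm_ballAut_lt he h hτ).le
  · exact (norm_ballAut_eq_one he h hτ).le

lemma continuousOn_ballAut {e : Cn n} {τ : ℝ} (he : ‖e‖ = 1) (hτ : |τ| ≤ 1) :
    ContinuousOn (ballAut e τ) (closedBall 0 1) := by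
  have h : Continuous (autDen e τ) := by unfold autDen; fun_prop
  unfold ballAut
  refine ContinuousOn.smul (h.continuousOn.inv₀ fun z hz => ?_) (by fun_prop)
  exact autDen_ne_zero he (by simpa using hz) hτ

lemma inner_ballAut {e z : Cn n} {τ : ℝ} (he : ‖e‖ = 1) :
    inner ℂ e (ballAut e τ z) = (autDen e τ z)⁻¹ *
      ((Real.cosh τ : ℂ) * inner ℂ e z + (Real.sinh τ : ℂ)) := by
  rw [ballAut, inner_smul_right, inner_add_right, inner_smul_right, inner_self_of_unit he]
  ring

lemma hasDerivAt_autDen {e z : Cn n} {τ : ℝ} (he : ‖e‖ = 1) (hd : autDen e τ z ≠ 0) :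
    HasDerivAt (fun s => autDen e s z) (autDen e τ z * inner ℂ e (ballAut e τ z)) τ := by
  rw [inner_ballAut he, mul_inv_cancel_left₀ hd, add_comm]
  exact (Real.hasDerivAt_cosh τ).ofReal_comp.add
    ((Real.hasDerivAt_sinh τ).ofReal_comp.mul_const (inner ℂ e z))

lemma hasDerivAt_ballAut {e z : Cn n} {τ : ℝ} (he : ‖e‖ = 1) (hd : autDen e τ z ≠ 0) :
    HasDerivAt (fun s => ballAut e s z) (ballField e (ballAut e τ z)) τ := by
  have h1 := (hasDerivAt_autDen he hd).inv hd
  have h2 : HasDerivAt (fun s : ℝ => z + (((Real.cosh s : ℂ) - 1) * inner ℂ e z +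
      (Real.sinh s : ℂ)) • e) (((Real.sinh τ : ℂ) * inner ℂ e z + (Real.cosh τ : ℂ)) • e) τ :=
    (((((Real.hasDerivAt_cosh τ).ofReal_comp.sub_const 1).mul_const (inner ℂ e z)).add
      (Real.hasDerivAt_sinh τ).ofReal_comp).smul_const e).const_add z
  have h3 := HasDerivAt.smul h1 h2
  refine h3.congr_deriv ?_
  have e1 : (Real.sinh τ : ℂ) * inner ℂ e z + (Real.cosh τ : ℂ) = autDen e τ z := by
    rw [autDen]; ring
  rw [e1, Pi.inv_apply, smul_smul, inv_mul_cancel₀ hd, one_smul, ballField]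
  conv_rhs => rw [sub_eq_add_neg, ← neg_smul]
  congr 1
  conv_rhs => enter [2]; rw [ballAut]
  rw [smul_smul]
  congr 1
  field_simp

lemma inner_ballAutDeriv {e z ξ : Cn n} {τ : ℝ} (he : ‖e‖ = 1) :
    inner ℂ e (ballAutDeriv e τ z ξ) = (autDen e τ z)⁻¹ * (inner ℂ e ξ *
      ((Real.cosh τ : ℂ) - (Real.sinh τ : ℂ) * inner ℂ e (ballAut e τ z))) := by
  rw [ballAutDeriv, inner_smul_right, inner_sub_right, inner_add_right, inner_smul_right,
    inner_smul_right, inner_self_of_unit he]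
  ring

lemma hasDerivAt_ballAutDeriv {e z ξ : Cn n} {τ : ℝ} (he : ‖e‖ = 1) (hd : autDen e τ z ≠ 0) :
    HasDerivAt (fun s => ballAutDeriv e s z ξ)
      (-(inner ℂ e (ballAutDeriv e τ z ξ) • ballAut e τ z +
        inner ℂ e (ballAut e τ z) • ballAutDeriv e τ z ξ)) τ := by
  have h1 := (hasDerivAt_autDen he hd).inv hd
  have h2 := ((((((Real.hasDerivAt_cosh τ).ofReal_comp.sub_const 1).mul_const
    (inner ℂ e ξ)).smul_const e).const_add ξ)).sub
      (HasDerivAt.smul ((Real.hasDerivAt_sinh τ).ofReal_comp.mul_const (inner ℂ e ξ))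
        (hasDerivAt_ballAut he hd))
  have h3 := HasDerivAt.smul h1 h2
  refine h3.congr_deriv ?_
  simp only [Pi.inv_apply, Pi.sub_apply, Pi.smul_apply']
  rw [inner_ballAutDeriv he, ballField]
  conv_rhs => rw [ballAutDeriv]
  generalize inner ℂ e (ballAut e τ z) = k
  generalize inner ℂ e ξ = c
  generalize ballAut e τ z = w
  match_scalars <;> field_simp <;> ring

lemma hasDerivAt_ballAut_line {e z ξ : Cn n} {τ : ℝ} {ζ : ℂ} (hd : autDen e τ (z + ζ • ξ) ≠ 0) :
    HasDerivAt (fun ζ : ℂ => ballAut e τ (z + ζ • ξ)) (ballAutDeriv e τ (z + ζ • ξ) ξ) ζ := by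
  have hl : HasDerivAt (fun ζ : ℂ => z + ζ • ξ) ξ ζ := by
    simpa using ((hasDerivAt_id ζ).smul_const ξ).const_add z
  have hi : HasDerivAt (fun ζ : ℂ => inner ℂ e (z + ζ • ξ)) (inner ℂ e ξ) ζ := by
    simp only [inner_add_right, inner_smul_right]
    simpa using ((hasDerivAt_id ζ).mul_const (inner ℂ e ξ)).const_add (inner ℂ e z)
  have h1 : HasDerivAt (fun ζ : ℂ => autDen e τ (z + ζ • ξ))
      ((Real.sinh τ : ℂ) * inner ℂ e ξ) ζ := (hi.const_mul _).const_add _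
  have h2 := hl.add (((hi.const_mul ((Real.cosh τ : ℂ) - 1)).add_const
    (Real.sinh τ : ℂ)).smul_const e)
  have h3 := (h1.inv hd).smul h2
  refine h3.congr_deriv ?_
  simp only [Pi.inv_apply, Pi.add_apply]
  rw [ballAutDeriv, ballAut]
  generalize z + ζ • ξ = p at *
  generalize inner ℂ e p = k
  generalize inner ℂ e ξ = c
  generalize autDen e τ p = d at *
  match_scalars <;> field_simp <;> ring

lemma exists_hasDerivAt_ballAutDeriv_line {e z ξ : Cn n} {τ : ℝ} (hd : autDen e τ z ≠ 0) :
    ∃ b, HasDerivAt (fun ζ : ℂ => ballAutDeriv e τ (z + ζ • ξ) ξ) b 0 := by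
  have h0 : autDen e τ (z + (0 : ℂ) • ξ) ≠ 0 := by simpa using hd
  have hi : HasDerivAt (fun ζ : ℂ => inner ℂ e (z + ζ • ξ)) (inner ℂ e ξ) 0 := by
    simp only [inner_add_right, inner_smul_right]
    simpa using ((hasDerivAt_id (0 : ℂ)).mul_const (inner ℂ e ξ)).const_add (inner ℂ e z)
  have h1 : HasDerivAt (fun ζ : ℂ => autDen e τ (z + ζ • ξ))
      ((Real.sinh τ : ℂ) * inner ℂ e ξ) 0 := (hi.const_mul _).const_add _
  have h2 : HasDerivAt (fun ζ : ℂ => ξ + (((Real.cosh τ : ℂ) - 1) * inner ℂ e ξ) • e -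
      ((Real.sinh τ : ℂ) * inner ℂ e ξ) • ballAut e τ (z + ζ • ξ))
      (-(((Real.sinh τ : ℂ) * inner ℂ e ξ) • ballAutDeriv e τ (z + (0 : ℂ) • ξ) ξ)) 0 :=
    ((hasDerivAt_ballAut_line h0).const_smul ((Real.sinh τ : ℂ) * inner ℂ e ξ)).const_sub _
  have h3 : HasDerivAt (fun ζ : ℂ => (autDen e τ (z + ζ • ξ))⁻¹) _ 0 := h1.inv h0
  exact ⟨_, h3.smul h2⟩

/-- The matrix of the complex derivative of `ballAut e τ`. -/
noncomputable def ballAutMatrix (e : Cn n) (τ : ℝ) (z : Cn n) : Matrix (Fin n) (Fin n) ℂ :=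
  (autDen e τ z)⁻¹ • (1 + replicateCol Unit (WithLp.ofLp (((Real.cosh τ : ℂ) - 1) • e -
    (Real.sinh τ : ℂ) • ballAut e τ z)) * replicateRow Unit (star (WithLp.ofLp e)))

lemma toLp_ballAutMatrix_mulVec (e : Cn n) (τ : ℝ) (z ξ : Cn n) :
    WithLp.toLp 2 (ballAutMatrix e τ z *ᵥ ξ) = ballAutDeriv e τ z ξ := by
  have hc : star (WithLp.ofLp e) ⬝ᵥ WithLp.ofLp ξ = inner ℂ e ξ := by
    rw [EuclideanSpace.inner_eq_star_dotProduct, dotProduct_comm]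
  have hcol : replicateCol Unit (WithLp.ofLp (((Real.cosh τ : ℂ) - 1) • e -
    (Real.sinh τ : ℂ) • ballAut e τ z)) *ᵥ (replicateRow Unit (star (WithLp.ofLp e)) *ᵥ ξ) =
      WithLp.ofLp (inner ℂ e ξ • (((Real.cosh τ : ℂ) - 1) • e -
        (Real.sinh τ : ℂ) • ballAut e τ z)) := by
    ext i
    rw [← hc]
    simp [mulVec, dotProduct, mul_comm]
  rw [ballAutMatrix, smul_mulVec, add_mulVec, one_mulVec, ← mulVec_mulVec, hcol, ballAutDeriv,
    WithLp.toLp_smul, WithLp.toLp_add]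
  congr 1
  simp only [WithLp.toLp_ofLp]
  module

lemma norm_det_ballAutMatrix {e z : Cn n} {τ : ℝ} (hn : 0 < n) (he : ‖e‖ = 1)
    (hd : autDen e τ z ≠ 0) : ‖(ballAutMatrix e τ z).det‖ ^ (2 / n : ℝ) =
      (‖autDen e τ z‖ ^ 2) ^ (-((n + 1) / n : ℝ)) := by
  have h1 : star (WithLp.ofLp e) ⬝ᵥ (WithLp.ofLp (((Real.cosh τ : ℂ) - 1) • e -
      (Real.sinh τ : ℂ) • ballAut e τ z)) = inner ℂ e (((Real.cosh τ : ℂ) - 1) • e -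
      (Real.sinh τ : ℂ) • ballAut e τ z) := by
    rw [EuclideanSpace.inner_eq_star_dotProduct, dotProduct_comm]
  have hn' : (n : ℝ) ≠ 0 := by exact_mod_cast hn.ne'
  have h2 : 1 + inner ℂ e (((Real.cosh τ : ℂ) - 1) • e - (Real.sinh τ : ℂ) • ballAut e τ z) =
      (autDen e τ z)⁻¹ := by
    rw [inner_sub_right, inner_smul_right, inner_smul_right, inner_self_of_unit he,
      inner_ballAut he]
    have h3 := ofReal_cosh_sq_sub_sinh_sq τ
    have h4 : autDen e τ z = (Real.cosh τ : ℂ) + (Real.sinh τ : ℂ) * inner ℂ e z := rfl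
    field_simp
    rw [h4]
    linear_combination h3
  rw [ballAutMatrix, det_smul, det_one_add_replicateCol_mul_replicateRow, h1, h2, Fintype.card_fin,
    ← pow_succ, norm_pow, norm_inv, inv_pow, ← Real.rpow_natCast, ← Real.rpow_natCast,
    ← Real.rpow_neg (norm_nonneg _), ← Real.rpow_mul (norm_nonneg _),
    ← Real.rpow_mul (norm_nonneg _)]
  congr 1
  push_cast
  field_simp

end BallAutomorphisms

/-! ### Curves of class `C^{1,α}` at the origin -/

section CurveBounds

/-- The curve `w` has derivative `w'` on `[-1, 1]`, with `w`, `w'` and the `α`-Hölder quotient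
of `w'` at `0` all bounded by `K`. -/
structure IsC1Alpha {F : Type*} [NormedAddCommGroup F] [NormedSpace ℝ F] (α K : ℝ)
    (w w' : ℝ → F) : Prop where
  hasDerivAt : ∀ s, |s| ≤ 1 → HasDerivAt w (w' s) s
  norm_le : ∀ s, |s| ≤ 1 → ‖w s‖ ≤ K
  norm_deriv_le : ∀ s, |s| ≤ 1 → ‖w' s‖ ≤ K
  holder : ∀ s, |s| ≤ 1 → ‖w' s - w' 0‖ ≤ K * |s| ^ α

namespace IsC1Alpha

variable {F : Type*} [NormedAddCommGroup F] [NormedSpace ℝ F] {α K L : ℝ} {w w' : ℝ → F}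

lemma nonneg (h : IsC1Alpha α K w w') : 0 ≤ K :=
  (norm_nonneg _).trans (h.norm_le 0 (by simp))

lemma mono (h : IsC1Alpha α K w w') (hKL : K ≤ L) : IsC1Alpha α L w w' where
  hasDerivAt := h.hasDerivAt
  norm_le s hs := (h.norm_le s hs).trans hKL
  norm_deriv_le s hs := (h.norm_deriv_le s hs).trans hKL
  holder s hs := (h.holder s hs).trans
    (mul_le_mul_of_nonneg_right hKL (Real.rpow_nonneg (abs_nonneg s) α))

lemma norm_image_sub_le (h : IsC1Alpha α K w w') {s : ℝ} (hs : |s| ≤ 1) :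
    ‖w s - w 0‖ ≤ K * |s| := by
  have hc : Convex ℝ (Icc (-1 : ℝ) 1) := convex_Icc _ _
  simpa using hc.norm_image_sub_le_of_norm_hasDerivWithin_le (f := w) (f' := w')
    (fun x hx => (h.hasDerivAt x (abs_le.mpr hx)).hasDerivWithinAt)
    (fun x hx => h.norm_deriv_le x (abs_le.mpr hx)) (x := 0) (y := s) ⟨by norm_num, by norm_num⟩
    (abs_le.mp hs)

lemma norm_taylor_le (h : IsC1Alpha α K w w') (hα : 0 < α) {s : ℝ} (hs : |s| ≤ 1) :
    ‖w s - w 0 - s • w' 0‖ ≤ K * |s| ^ (1 + α) := by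
  have hc : Convex ℝ (Icc (-|s|) |s|) := convex_Icc _ _
  have h1 : ∀ x ∈ Icc (-|s|) |s|, |x| ≤ 1 := fun x hx => (abs_le.mpr hx).trans hs
  have h2 := hc.norm_image_sub_le_of_norm_hasDerivWithin_le (f := fun x => w x - x • w' 0)
    (f' := fun x => w' x - (1 : ℝ) • w' 0) (C := K * |s| ^ α)
    (fun x hx => ((h.hasDerivAt x (h1 x hx)).sub
      ((hasDerivAt_id x).smul_const (w' 0))).hasDerivWithinAt)
    (fun x hx => by
      rw [one_smul]
      exact (h.holder x (h1 x hx)).trans (mul_le_mul_of_nonneg_left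
        (Real.rpow_le_rpow (abs_nonneg x) (abs_le.mpr hx) hα.le) h.nonneg))
    (x := 0) (y := s) (by simp) ⟨neg_abs_le s, le_abs_self s⟩
  rcases eq_or_ne s 0 with rfl | h0
  · simp [Real.zero_rpow (by linarith : (1 + α) ≠ 0)]
  · rw [Real.rpow_add (abs_pos.mpr h0), Real.rpow_one]
    simp only [zero_smul, sub_zero, Real.norm_eq_abs] at h2
    calc ‖w s - w 0 - s • w' 0‖ = ‖w s - s • w' 0 - w 0‖ := by congr 1; abel
      _ ≤ _ := h2
      _ = _ := by ring

lemma clm_comp {E : Type*} [NormedAddCommGroup E] [NormedSpace ℝ E] (h : IsC1Alpha α K w w')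
    (A : F →L[ℝ] E) (hA : ∀ x, ‖A x‖ ≤ ‖x‖) :
    IsC1Alpha α K (fun s => A (w s)) (fun s => A (w' s)) where
  hasDerivAt s hs := A.hasFDerivAt.comp_hasDerivAt s (h.hasDerivAt s hs)
  norm_le s hs := (hA _).trans (h.norm_le s hs)
  norm_deriv_le s hs := (hA _).trans (h.norm_deriv_le s hs)
  holder s hs := by
    rw [← map_sub]
    exact (hA _).trans (h.holder s hs)

lemma sum {ι : Type*} {s : Finset ι} {w w' : ι → ℝ → F}
    (h : ∀ i, IsC1Alpha α K (w i) (w' i)) :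
    IsC1Alpha α (s.card * K) (fun x => ∑ i ∈ s, w i x) (fun x => ∑ i ∈ s, w' i x) where
  hasDerivAt x hx := HasDerivAt.fun_sum fun i _ => (h i).hasDerivAt x hx
  norm_le x hx := by
    simpa using norm_sum_le_of_le s fun i _ => (h i).norm_le x hx
  norm_deriv_le x hx := by
    simpa using norm_sum_le_of_le s fun i _ => (h i).norm_deriv_le x hx
  holder x hx := by
    rw [← Finset.sum_sub_distrib, mul_assoc]
    simpa using norm_sum_le_of_le s fun i _ => (h i).holder x hx

lemma abs_le_rpow {s : ℝ} (hα1 : α ≤ 1) (hs : |s| ≤ 1) : |s| ≤ |s| ^ α := by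
  simpa using Real.rpow_le_rpow_of_exponent_ge_of_imp (abs_nonneg s) hs hα1
    (fun _ h => absurd h one_ne_zero)

lemma mul {A : Type*} [NormedRing A] [NormedAlgebra ℝ A] {v v' w w' : ℝ → A}
    (hα1 : α ≤ 1) (hv : IsC1Alpha α K v v') (hw : IsC1Alpha α L w w') :
    IsC1Alpha α (4 * (K * L)) (fun s => v s * w s) (fun s => v' s * w s + v s * w' s) := by
  have hK := hv.nonneg
  have hL := hw.nonneg
  have hKL : 0 ≤ K * L := mul_nonneg hK hL
  have key : ∀ {a b : A} {p q : ℝ}, ‖a‖ ≤ p → ‖b‖ ≤ q → 0 ≤ p → ‖a * b‖ ≤ p * q :=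
    fun ha hb hp => (norm_mul_le _ _).trans (mul_le_mul ha hb (norm_nonneg _) hp)
  refine ⟨fun s hs => (hv.hasDerivAt s hs).mul (hw.hasDerivAt s hs), fun s hs => ?_,
    fun s hs => ?_, fun s hs => ?_⟩
  · linarith [key (hv.norm_le s hs) (hw.norm_le s hs) hK]
  · refine (norm_add_le _ _).trans ?_
    linarith [key (hv.norm_deriv_le s hs) (hw.norm_le s hs) hK,
      key (hv.norm_le s hs) (hw.norm_deriv_le s hs) hK]
  · have h0 : |(0 : ℝ)| ≤ 1 := by simp
    have e : v' s * w s + v s * w' s - (v' 0 * w 0 + v 0 * w' 0) =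
        ((v' s - v' 0) * w s + v' 0 * (w s - w 0)) + ((v s - v 0) * w' s + v 0 * (w' s - w' 0)) := by
      noncomm_ring
    have hr := abs_le_rpow hα1 hs
    have hr0 : 0 ≤ |s| ^ α := Real.rpow_nonneg (abs_nonneg s) α
    have b1 := key (hv.holder s hs) (hw.norm_le s hs) (by positivity)
    have b2 := key (hv.norm_deriv_le 0 h0) (hw.norm_image_sub_le hs) hK
    have b3 := key (hv.norm_image_sub_le hs) (hw.norm_deriv_le s hs) (by positivity)
    have b4 := key (hv.norm_le 0 h0) (hw.holder s hs) hK
    have b5 := mul_le_mul_of_nonneg_left hr hKL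
    rw [e]
    refine (norm_add_le _ _).trans ((add_le_add (norm_add_le _ _) (norm_add_le _ _)).trans ?_)
    nlinarith

lemma abs_weighted_defect_le {w w' : ℝ → ℝ} (h : IsC1Alpha α K w w') (hα : 0 < α) {σ τ : ℝ}
    (hσ : 0 < σ) (hστ : σ ≤ τ) (hτ : τ ≤ 1) :
    |σ * w τ + τ * w (-σ) - (τ + σ) * w 0| ≤ 2 * K * (σ * τ ^ (1 + α)) := by
  have hτ0 : 0 < τ := hσ.trans_le hστ
  have a1 : |τ| = τ := abs_of_pos hτ0
  have a2 : |-σ| = σ := by rw [abs_neg, abs_of_pos hσ]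
  have h1 := h.norm_taylor_le hα (s := τ) (by rw [a1]; exact hτ)
  have h2 := h.norm_taylor_le hα (s := -σ) (by rw [a2]; exact hστ.trans hτ)
  rw [a1, Real.norm_eq_abs] at h1
  rw [a2, Real.norm_eq_abs] at h2
  have e : σ * w τ + τ * w (-σ) - (τ + σ) * w 0 =
      σ * (w τ - w 0 - τ • w' 0) + τ * (w (-σ) - w 0 - (-σ) • w' 0) := by
    simp only [smul_eq_mul]; ring
  have h3 : τ * σ ^ (1 + α) ≤ σ * τ ^ (1 + α) := by
    rw [Real.rpow_add hσ, Real.rpow_add hτ0, Real.rpow_one, Real.rpow_one]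
    have := Real.rpow_le_rpow hσ.le hστ hα.le
    nlinarith [mul_pos hσ hτ0]
  rw [e]
  refine (abs_add_le _ _).trans ?_
  rw [abs_mul, abs_mul, abs_of_pos hσ, abs_of_pos hτ0]
  have h4 := mul_le_mul_of_nonneg_left h1 hσ.le
  have h5 := mul_le_mul_of_nonneg_left h2 hτ0.le
  have h6 := mul_le_mul_of_nonneg_left h3 h.nonneg
  nlinarith

end IsC1Alpha

end CurveBounds

/-! ### Orbit curves of the automorphisms -/

section Orbits

variable {n : ℕ} {e z ξ : Cn n} {α K s : ℝ}

lemma norm_ballField_le (he : ‖e‖ = 1) (hz : ‖z‖ ≤ 1) : ‖ballField e z‖ ≤ 2 := by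
  refine (norm_sub_le _ _).trans ?_
  rw [he, norm_smul]
  nlinarith [norm_inner_le_of_unit he z, norm_nonneg z, norm_nonneg (inner ℂ e z)]

lemma norm_ballField_sub_le {x y : Cn n} (he : ‖e‖ = 1) (hx : ‖x‖ ≤ 1) (hy : ‖y‖ ≤ 1) :
    ‖ballField e x - ballField e y‖ ≤ 2 * ‖x - y‖ := by
  have h : ballField e x - ballField e y =
      -(inner ℂ e (x - y) • x + inner ℂ e y • (x - y)) := by
    rw [ballField, ballField, inner_sub_right]
    module
  rw [h, norm_neg]
  refine (norm_add_le _ _).trans ?_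
  rw [norm_smul, norm_smul]
  have h1 := norm_inner_le_of_unit he (x - y)
  have h2 := (norm_inner_le_of_unit he y).trans hy
  nlinarith [norm_nonneg (x - y), norm_nonneg x, norm_nonneg (inner ℂ e (x - y)),
    norm_nonneg (inner ℂ e y)]

lemma norm_ballAut_sub_le (he : ‖e‖ = 1) (hz : ‖z‖ ≤ 1) (hs : |s| ≤ 1) :
    ‖ballAut e s z - z‖ ≤ 2 * |s| := by
  have h := (convex_Icc (-1 : ℝ) 1).norm_image_sub_le_of_norm_hasDerivWithin_le
    (f := fun s => ballAut e s z) (f' := fun s => ballField e (ballAut e s z))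
    (fun x hx => (hasDerivAt_ballAut he (autDen_ne_zero he hz (abs_le.mpr hx))).hasDerivWithinAt)
    (fun x hx => norm_ballField_le he (norm_ballAut_le he hz (abs_le.mpr hx))) (x := 0) (y := s)
    ⟨by norm_num, by norm_num⟩ (abs_le.mp hs)
  simpa [ballAut_zero] using h

lemma isC1Alpha_ballAut (hα1 : α ≤ 1) (he : ‖e‖ = 1) (hz : ‖z‖ ≤ 1) :
    IsC1Alpha α 4 (fun s => ballAut e s z) (fun s => ballField e (ballAut e s z)) where
  hasDerivAt s hs := hasDerivAt_ballAut he (autDen_ne_zero he hz hs)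
  norm_le s hs := (norm_ballAut_le he hz hs).trans (by norm_num)
  norm_deriv_le s hs := (norm_ballField_le he (norm_ballAut_le he hz hs)).trans (by norm_num)
  holder s hs := by
    rw [ballAut_zero]
    have h1 := norm_ballField_sub_le he (norm_ballAut_le he hz hs) hz
    have h2 := norm_ballAut_sub_le he hz hs
    have h3 := IsC1Alpha.abs_le_rpow hα1 hs
    linarith

lemma norm_ballAutDeriv_le (he : ‖e‖ = 1) (hz : ‖z‖ ≤ 1) (hs : |s| ≤ 1) :
    ‖ballAutDeriv e s z ξ‖ ≤ 9 * ‖ξ‖ := by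
  have h1 := norm_inv_autDen_le he hz hs
  have h2 := norm_inner_le_of_unit he ξ
  have h3 := norm_ballAut_le he hz hs
  have hcosh := Real.one_le_cosh s
  have e1 : ‖(Real.cosh s : ℂ) - 1‖ = Real.cosh s - 1 := by
    rw [← Complex.ofReal_one, ← Complex.ofReal_sub, Complex.norm_real, Real.norm_eq_abs,
      abs_of_nonneg (by linarith)]
  have e2 : ‖(Real.sinh s : ℂ)‖ = |Real.sinh s| := by rw [Complex.norm_real, Real.norm_eq_abs]
  have e3 : Real.cosh s + |Real.sinh s| ≤ 3 := by
    have : Real.cosh s + |Real.sinh s| = Real.exp |s| := by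
      rw [← Real.cosh_add_sinh, Real.cosh_abs, Real.abs_sinh]
    rw [this]
    exact (Real.exp_le_exp.mpr hs).trans Real.exp_one_lt_three.le
  have h4 : ‖ξ + (((Real.cosh s : ℂ) - 1) * inner ℂ e ξ) • e -
      ((Real.sinh s : ℂ) * inner ℂ e ξ) • ballAut e s z‖ ≤ 3 * ‖ξ‖ := by
    refine (norm_sub_le _ _).trans ((add_le_add_left (norm_add_le _ _) _).trans ?_)
    rw [norm_smul, norm_smul, norm_mul, norm_mul, e1, e2, he, mul_one]
    have b1 := mul_le_mul_of_nonneg_left h2 (by linarith : 0 ≤ Real.cosh s - 1)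
    have b2 := mul_le_mul_of_nonneg_left h2 (abs_nonneg (Real.sinh s))
    have b3 := mul_le_of_le_one_right
      (mul_nonneg (abs_nonneg (Real.sinh s)) (norm_nonneg (inner ℂ e ξ))) h3
    have b4 := mul_le_mul_of_nonneg_right e3 (norm_nonneg ξ)
    linarith
  rw [ballAutDeriv, norm_smul]
  have := mul_le_mul h1 h4 (norm_nonneg _) (by norm_num)
  linarith

lemma isC1Alpha_ballAutDeriv (hα1 : α ≤ 1) (he : ‖e‖ = 1) (hz : ‖z‖ ≤ 1) (ξ : Cn n) :
    IsC1Alpha α (72 * ‖ξ‖) (fun s => ballAutDeriv e s z ξ)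
      (fun s => -(inner ℂ e (ballAutDeriv e s z ξ) • ballAut e s z +
        inner ℂ e (ballAut e s z) • ballAutDeriv e s z ξ)) := by
  have hξ := norm_nonneg ξ
  have hd : ∀ s, |s| ≤ 1 → ‖-(inner ℂ e (ballAutDeriv e s z ξ) • ballAut e s z +
      inner ℂ e (ballAut e s z) • ballAutDeriv e s z ξ)‖ ≤ 18 * ‖ξ‖ := fun s hs => by
    rw [norm_neg]
    refine (norm_add_le _ _).trans ?_
    rw [norm_smul, norm_smul]
    have a1 := norm_ballAutDeriv_le he hz hs (ξ := ξ)
    have a2 := norm_ballAut_le he hz hs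
    have a3 := mul_le_mul ((norm_inner_le_of_unit he (ballAutDeriv e s z ξ)).trans a1) a2
      (norm_nonneg _) (by positivity)
    have a4 := mul_le_mul ((norm_inner_le_of_unit he (ballAut e s z)).trans a2) a1
      (norm_nonneg _) (by positivity)
    linarith
  refine ⟨fun s hs => hasDerivAt_ballAutDeriv he (autDen_ne_zero he hz hs),
    fun s hs => (norm_ballAutDeriv_le he hz hs).trans (by linarith),
    fun s hs => (hd s hs).trans (by linarith), fun s hs => ?_⟩
  have hV : ‖ballAutDeriv e s z ξ - ξ‖ ≤ 18 * ‖ξ‖ * |s| := by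
    have h := (convex_Icc (-1 : ℝ) 1).norm_image_sub_le_of_norm_hasDerivWithin_le
      (f := fun s => ballAutDeriv e s z ξ)
      (fun x hx => (hasDerivAt_ballAutDeriv he
        (autDen_ne_zero he hz (abs_le.mpr hx))).hasDerivWithinAt)
      (fun x hx => hd x (abs_le.mpr hx)) (x := 0) (y := s)
      ⟨by norm_num, by norm_num⟩ (abs_le.mp hs)
    simpa [ballAutDeriv_zero] using h
  have hT := norm_ballAut_sub_le he hz hs
  have a1 := norm_ballAutDeriv_le he hz hs (ξ := ξ)
  have a2 := norm_ballAut_le he hz hs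
  rw [ballAutDeriv_zero, ballAut_zero]
  have e1 : -(inner ℂ e (ballAutDeriv e s z ξ) • ballAut e s z +
      inner ℂ e (ballAut e s z) • ballAutDeriv e s z ξ) -
      -(inner ℂ e ξ • z + inner ℂ e z • ξ) =
      -((inner ℂ e (ballAutDeriv e s z ξ - ξ) • ballAut e s z +
        inner ℂ e ξ • (ballAut e s z - z)) +
        (inner ℂ e (ballAut e s z - z) • ballAutDeriv e s z ξ +
          inner ℂ e z • (ballAutDeriv e s z ξ - ξ))) := by
    rw [inner_sub_right, inner_sub_right]
    module
  rw [e1, norm_neg]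
  refine (norm_add_le _ _).trans ((add_le_add (norm_add_le _ _) (norm_add_le _ _)).trans ?_)
  simp only [norm_smul]
  have hn : ∀ x : Cn n, ‖inner ℂ e x‖ ≤ ‖x‖ := norm_inner_le_of_unit he
  have b1 := mul_le_mul ((hn _).trans hV) a2 (norm_nonneg _) (by positivity)
  have b2 := mul_le_mul (hn ξ) hT (norm_nonneg _) (by positivity)
  have b3 := mul_le_mul ((hn _).trans hT) a1 (norm_nonneg _) (by positivity)
  have b4 := mul_le_mul ((hn z).trans hz) hV (norm_nonneg _) (by positivity)
  have b5 := mul_le_mul_of_nonneg_left (IsC1Alpha.abs_le_rpow hα1 hs) hξ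
  have b6 := mul_nonneg hξ (abs_nonneg s)
  nlinarith

/-- The Jacobian factor `|det (ballAut e τ)'(z)|^{2/n}`. -/
noncomputable def ballAutJac (e : Cn n) (z : Cn n) (τ : ℝ) : ℝ :=
  (‖autDen e τ z‖ ^ 2) ^ (-((n + 1) / n : ℝ))

lemma isC1Alpha_ballAutJac (hα1 : α ≤ 1) (hn : 0 < n) (he : ‖e‖ = 1) (hz : ‖z‖ ≤ 1) :
    IsC1Alpha α 1944 (ballAutJac e z)
      (fun s => -2 * ((n + 1) / n : ℝ) * (ballAutJac e z s * (inner ℂ e (ballAut e s z)).re)) := by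
  have hn' : (1 : ℝ) ≤ n := by exact_mod_cast hn
  have hp : ((n + 1) / n : ℝ) ≤ 2 := by rw [div_le_iff₀ (by linarith)]; linarith
  have hp0 : 0 ≤ ((n + 1) / n : ℝ) := by positivity
  have hj : ∀ s, |s| ≤ 1 → ballAutJac e z s ≤ 81 := fun s hs => by
    have h1 : (1 / 3 : ℝ) ^ 2 ≤ ‖autDen e s z‖ ^ 2 :=
      pow_le_pow_left₀ (by norm_num) (third_le_norm_autDen he hz hs) 2
    refine (Real.rpow_le_rpow_of_nonpos (by norm_num) h1 (by linarith)).trans ?_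
    have h2 : ((1 / 3 : ℝ) ^ 2) ^ (-((n + 1) / n : ℝ)) = 9 ^ ((n + 1) / n : ℝ) := by
      rw [Real.rpow_neg (by norm_num), ← Real.inv_rpow (by norm_num)]
      norm_num
    rw [h2]
    refine (Real.rpow_le_rpow_of_exponent_le (by norm_num) hp).trans ?_
    rw [show (2 : ℝ) = ((2 : ℕ) : ℝ) by norm_num, Real.rpow_natCast]
    norm_num
  have hj0 : ∀ s, 0 ≤ ballAutJac e z s := fun s => Real.rpow_nonneg (by positivity) _
  have hre : ∀ s, |s| ≤ 1 → |(inner ℂ e (ballAut e s z)).re| ≤ 1 := fun s hs =>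
    (Complex.abs_re_le_norm _).trans
      ((norm_inner_le_of_unit he _).trans (norm_ballAut_le he hz hs))
  have hder : ∀ s, |s| ≤ 1 → HasDerivAt (ballAutJac e z)
      (-2 * ((n + 1) / n : ℝ) * (ballAutJac e z s * (inner ℂ e (ballAut e s z)).re)) s := by
    intro s hs
    have hd := autDen_ne_zero he hz hs
    have hd' : ‖autDen e s z‖ ^ 2 ≠ 0 := by positivity
    have h1 := (hasDerivAt_autDen he hd).norm_sq.rpow_const (p := -((n + 1) / n : ℝ)) (Or.inl hd')
    refine h1.congr_deriv ?_
    rw [ballAutJac, Real.rpow_sub_one hd']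
    have h2 : inner ℝ (autDen e s z) (autDen e s z * inner ℂ e (ballAut e s z)) =
        ‖autDen e s z‖ ^ 2 * (inner ℂ e (ballAut e s z)).re := by
      rw [Complex.inner, ← Complex.normSq_eq_norm_sq, mul_right_comm,
        Complex.mul_conj, Complex.re_ofReal_mul]
    rw [h2]
    field_simp
  have hder' : ∀ s, |s| ≤ 1 → ‖-2 * ((n + 1) / n : ℝ) *
      (ballAutJac e z s * (inner ℂ e (ballAut e s z)).re)‖ ≤ 324 := by
    intro s hs
    rw [norm_mul, norm_mul, norm_mul, Real.norm_eq_abs, Real.norm_eq_abs, Real.norm_eq_abs,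
      Real.norm_eq_abs, abs_of_nonneg hp0, abs_of_nonneg (hj0 s)]
    norm_num
    have := mul_le_mul (hj s hs) (hre s hs) (abs_nonneg _) (by norm_num)
    have := mul_le_mul hp this (mul_nonneg (hj0 s) (abs_nonneg _)) (by norm_num)
    linarith
  refine ⟨hder, fun s hs => ?_, fun s hs => (hder' s hs).trans (by norm_num), fun s hs => ?_⟩
  · rw [Real.norm_eq_abs, abs_of_nonneg (hj0 s)]
    linarith [hj s hs]
  · have h := (convex_Icc (-1 : ℝ) 1).norm_image_sub_le_of_norm_hasDerivWithin_le
      (f := ballAutJac e z) (fun x hx => (hder x (abs_le.mpr hx)).hasDerivWithinAt)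
      (fun x hx => hder' x (abs_le.mpr hx)) (x := 0) (y := s)
      ⟨by norm_num, by norm_num⟩ (abs_le.mp hs)
    have hj1 : ballAutJac e z 0 = 1 := by simp [ballAutJac, autDen]
    have hT : |(inner ℂ e (ballAut e s z)).re - (inner ℂ e z).re| ≤ 2 * |s| := by
      rw [← Complex.sub_re, ← inner_sub_right]
      exact (Complex.abs_re_le_norm _).trans
        ((norm_inner_le_of_unit he _).trans (norm_ballAut_sub_le he hz hs))
    have h3 := IsC1Alpha.abs_le_rpow hα1 hs
    rw [sub_zero, hj1, Real.norm_eq_abs, Real.norm_eq_abs] at h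
    rw [ballAut_zero, hj1, one_mul, ← mul_sub, norm_mul, norm_mul, Real.norm_eq_abs,
      Real.norm_eq_abs, Real.norm_eq_abs, abs_of_nonneg hp0]
    have e1 : ballAutJac e z s * (inner ℂ e (ballAut e s z)).re - (inner ℂ e z).re =
        (ballAutJac e z s - 1) * (inner ℂ e (ballAut e s z)).re +
          ((inner ℂ e (ballAut e s z)).re - (inner ℂ e z).re) := by ring
    have h4 : |ballAutJac e z s * (inner ℂ e (ballAut e s z)).re - (inner ℂ e z).re| ≤
        326 * |s| := by
      rw [e1]
      refine (abs_add_le _ _).trans ?_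
      rw [abs_mul]
      have := mul_le_mul h (hre s hs) (abs_nonneg _) (by positivity)
      linarith
    have h5 := mul_le_mul hp h4 (abs_nonneg _) (by norm_num)
    norm_num
    linarith [abs_nonneg s]

/-- `F` and its differential are bounded by `K` in the unit ball, and the differential is
`α`-Hölder with constant `K`. -/
structure C1AlphaBound {A : Type*} [NormedAddCommGroup A] [NormedSpace ℝ A] (α K : ℝ)
    (F : Cn n → A) : Prop where
  differentiableOn : DifferentiableOn ℝ F (ball 0 1)
  norm_le : ∀ x ∈ ball (0 : Cn n) 1, ‖F x‖ ≤ K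
  norm_fderiv_le : ∀ x ∈ ball (0 : Cn n) 1, ‖fderiv ℝ F x‖ ≤ K
  holder : ∀ x ∈ ball (0 : Cn n) 1, ∀ y ∈ ball (0 : Cn n) 1,
    ‖fderiv ℝ F x - fderiv ℝ F y‖ ≤ K * ‖x - y‖ ^ α

lemma C1AlphaBound.comp_ballAut {A : Type*} [NormedAddCommGroup A] [NormedSpace ℝ A]
    {F : Cn n → A} (hF : C1AlphaBound α K F) (hα : 0 < α) (hα1 : α ≤ 1) (he : ‖e‖ = 1)
    (hz : ‖z‖ < 1) :
    IsC1Alpha α (10 * K) (fun s => F (ballAut e s z))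
      (fun s => fderiv ℝ F (ballAut e s z) (ballField e (ballAut e s z))) := by
  have hz' : z ∈ ball (0 : Cn n) 1 := by simpa using hz
  have hK : 0 ≤ K := (norm_nonneg _).trans (hF.norm_le z hz')
  have hT : ∀ s, |s| ≤ 1 → ballAut e s z ∈ ball (0 : Cn n) 1 := fun s hs => by
    simpa using norm_ballAut_lt he hz hs
  refine ⟨fun s hs => ?_, fun s hs => ?_, fun s hs => ?_, fun s hs => ?_⟩
  · exact (hF.differentiableOn.differentiableAt (isOpen_ball.mem_nhds (hT s hs))).hasFDerivAt
      |>.comp_hasDerivAt s (hasDerivAt_ballAut he (autDen_ne_zero he hz.le hs))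
  · linarith [hF.norm_le _ (hT s hs)]
  · refine (ContinuousLinearMap.le_opNorm _ _).trans ?_
    have := mul_le_mul (hF.norm_fderiv_le _ (hT s hs))
      (norm_ballField_le he (norm_ballAut_le he hz.le hs)) (norm_nonneg _) hK
    linarith
  · rw [ballAut_zero]
    have h1 := norm_ballAut_sub_le he hz.le hs
    have h2 := norm_ballField_sub_le he (norm_ballAut_le he hz.le hs) hz.le
    have h3 := IsC1Alpha.abs_le_rpow hα1 hs
    have h4 : ‖ballAut e s z - z‖ ^ α ≤ 2 * |s| ^ α := by
      refine (Real.rpow_le_rpow (norm_nonneg _) h1 hα.le).trans ?_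
      rw [Real.mul_rpow (by norm_num) (abs_nonneg s)]
      refine mul_le_mul_of_nonneg_right ?_ (Real.rpow_nonneg (abs_nonneg s) α)
      simpa using Real.rpow_le_rpow_of_exponent_le (by norm_num : (1 : ℝ) ≤ 2) hα1
    have e1 : fderiv ℝ F (ballAut e s z) (ballField e (ballAut e s z)) -
        fderiv ℝ F z (ballField e z) =
        (fderiv ℝ F (ballAut e s z) - fderiv ℝ F z) (ballField e (ballAut e s z)) +
          fderiv ℝ F z (ballField e (ballAut e s z) - ballField e z) := by
      simp
    rw [e1]
    refine (norm_add_le _ _).trans ((add_le_add (ContinuousLinearMap.le_opNorm _ _)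
      (ContinuousLinearMap.le_opNorm _ _)).trans ?_)
    have b1 := mul_le_mul ((hF.holder _ (hT s hs) z hz').trans
      (mul_le_mul_of_nonneg_left h4 hK)) (norm_ballField_le he (norm_ballAut_le he hz.le hs))
      (norm_nonneg _) (by positivity)
    have b2 := mul_le_mul (hF.norm_fderiv_le z hz') (h2.trans (mul_le_mul_of_nonneg_left h1
      (by norm_num))) (norm_nonneg _) hK
    have b3 := mul_le_mul_of_nonneg_left h3 hK
    have b4 : 0 ≤ K * |s| ^ α := by positivity
    linarith

lemma exists_isC1Alpha_levi_pullback {G : Cn n → Matrix (Fin n) (Fin n) ℂ}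
    (hG : ∀ i j, C1AlphaBound α K (fun z => G z i j)) (hα : 0 < α) (hα1 : α ≤ 1) (he : ‖e‖ = 1)
    (hz : ‖z‖ < 1) (ξ : Cn n) : ∃ w', IsC1Alpha α (10 ^ 6 * n ^ 2 * K * ‖ξ‖ ^ 2)
      (fun s => levi (G (ballAut e s z)) (ballAutDeriv e s z ξ)) w' := by
  have hV := isC1Alpha_ballAutDeriv (α := α) hα1 he hz.le ξ
  have hVi : ∀ i, ∃ v', IsC1Alpha α (72 * ‖ξ‖) (fun s => ballAutDeriv e s z ξ i) v' := fun i =>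
    ⟨_, hV.clm_comp ((EuclideanSpace.proj i : Cn n →L[ℂ] ℂ).restrictScalars ℝ)
      fun x => PiLp.norm_apply_le x i⟩
  have hVs : ∀ i, ∃ v', IsC1Alpha α (72 * ‖ξ‖) (fun s => star (ballAutDeriv e s z ξ i)) v' :=
    fun i => by
      obtain ⟨v', hv⟩ := hVi i
      exact ⟨_, hv.clm_comp (Complex.conjCLE : ℂ →L[ℝ] ℂ) fun x => by simp⟩
  choose v hv using hVi
  choose v' hv' using hVs
  have hterm := fun i j => ((hv i).mul hα1 ((hG i j).comp_ballAut hα hα1 he hz)).mul hα1 (hv' j)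
  have hsum := IsC1Alpha.sum (s := Finset.univ) fun i =>
    IsC1Alpha.sum (s := Finset.univ) fun j => hterm i j
  have hre := hsum.clm_comp Complex.reCLM fun x => Complex.abs_re_le_norm x
  have hK : 0 ≤ 10 * K ∨ n = 0 := by
    rcases Nat.eq_zero_or_pos n with h | h
    · exact Or.inr h
    · exact Or.inl ((hG ⟨0, h⟩ ⟨0, h⟩).comp_ballAut hα hα1 he hz).nonneg
  refine ⟨_, hre.mono ?_⟩
  simp only [Finset.card_univ, Fintype.card_fin]
  rcases hK with hK | rfl
  · have : 0 ≤ (n : ℝ) ^ 2 * K * ‖ξ‖ ^ 2 := by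
      have : 0 ≤ K := by linarith
      positivity
    nlinarith
  · simp

lemma exists_isC1Alpha_jac_mul {g : Cn n → ℝ} (hg : C1AlphaBound α K g) (hn : 0 < n) (hα : 0 < α)
    (hα1 : α ≤ 1) (he : ‖e‖ = 1) (hz : ‖z‖ < 1) : ∃ w', IsC1Alpha α (10 ^ 6 * n ^ 2 * K)
      (fun s => ballAutJac e z s * g (ballAut e s z)) w' := by
  have h := hg.comp_ballAut hα hα1 he hz
  have hK := h.nonneg
  have hn' : (1 : ℝ) ≤ n ^ 2 := one_le_pow₀ (by exact_mod_cast hn)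
  exact ⟨_, ((isC1Alpha_ballAutJac hα1 hn he hz.le).mul hα1 h).mono (by nlinarith)⟩

end Orbits

/-! ### Comparison of a solution with its pullbacks -/

section Comparison

variable {n : ℕ}

/-- `u` solves `det (G + u_{i j̄}) = gⁿ` in the unit ball, with `G + u_{i j̄}` positive
semidefinite. -/
structure IsMongeAmpereSolution (G : Cn n → Matrix (Fin n) (Fin n) ℂ) (g u : Cn n → ℝ) :
    Prop where
  contDiffOn : ContDiffOn ℝ 2 u (ball 0 1)
  continuousOn : ContinuousOn u (closedBall 0 1)
  posSemidef : ∀ z ∈ ball (0 : Cn n) 1, (G z + cxHessian n u z).PosSemidef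
  nonneg : ∀ z ∈ ball (0 : Cn n) 1, 0 ≤ g z
  det_eq : ∀ z ∈ ball (0 : Cn n) 1, (G z + cxHessian n u z).det = ((g z ^ n : ℝ) : ℂ)

lemma IsMongeAmpereSolution.contDiffAt {G : Cn n → Matrix (Fin n) (Fin n) ℂ} {g u : Cn n → ℝ}
    (h : IsMongeAmpereSolution G g u) {z : Cn n} (hz : ‖z‖ < 1) : ContDiffAt ℝ 2 u z :=
  h.contDiffOn.contDiffAt (isOpen_ball.mem_nhds (by simpa using hz))

lemma hasDerivAt_line (z ξ : Cn n) (ζ : ℂ) : HasDerivAt (fun ζ : ℂ => z + ζ • ξ) ξ ζ := by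
  simpa using ((hasDerivAt_id ζ).smul_const ξ).const_add z

lemma hasLaplacian_line {u : Cn n → ℝ} {z : Cn n} (hu : ContDiffAt ℝ 2 u z) (ξ : Cn n) :
    HasLaplacian (fun ζ => u (z + ζ • ξ)) (lineLaplacian u z ξ) := by
  have h := hasLaplacian_comp (u := u) (γ := fun ζ : ℂ => z + ζ • ξ) (γ' := fun _ => ξ) (b := 0)
    (by simpa using hu) (Eventually.of_forall fun ζ => hasDerivAt_line z ξ ζ)
    (hasDerivAt_const 0 ξ)
  simpa using h

lemma hasLaplacian_line_ballAut {u : Cn n → ℝ} {e z : Cn n} {τ : ℝ}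
    (hu : ContDiffAt ℝ 2 u (ballAut e τ z)) (hd : autDen e τ z ≠ 0) (ξ : Cn n) :
    HasLaplacian (fun ζ => u (ballAut e τ (z + ζ • ξ)))
      (lineLaplacian u (ballAut e τ z) (ballAutDeriv e τ z ξ)) := by
  obtain ⟨b, hb⟩ := exists_hasDerivAt_ballAutDeriv_line (ξ := ξ) hd
  have hc : Continuous (fun ζ : ℂ => autDen e τ (z + ζ • ξ)) := by unfold autDen; fun_prop
  have hev : ∀ᶠ ζ : ℂ in 𝓝 0, autDen e τ (z + ζ • ξ) ≠ 0 :=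
    hc.continuousAt.eventually_ne (by simpa using hd)
  have h := hasLaplacian_comp (u := u) (γ := fun ζ : ℂ => ballAut e τ (z + ζ • ξ))
    (γ' := fun ζ => ballAutDeriv e τ (z + ζ • ξ) ξ) (b := b)
    (by simpa using hu) (by
      filter_upwards [hev] with ζ hζ using hasDerivAt_ballAut_line hζ) hb
  simpa using h

lemma hasLaplacian_norm_sq_line (z ξ : Cn n) :
    HasLaplacian (fun ζ => ‖z + ζ • ξ‖ ^ 2) (4 * ‖ξ‖ ^ 2) := by
  have key : ∀ v : ℂ, ‖v‖ = 1 →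
      HasSecondDeriv (fun s : ℝ => ‖z + ((s : ℂ) * v) • ξ‖ ^ 2) (2 * ‖ξ‖ ^ 2) := by
    intro v hv
    have hl : ∀ s : ℝ, HasDerivAt (fun s : ℝ => z + ((s : ℂ) * v) • ξ) (v • ξ) s := fun s => by
      have h1 : HasDerivAt (fun s : ℝ => (s : ℂ) * v) v s := by
        simpa using (Complex.ofRealCLM.hasDerivAt (x := s)).mul_const v
      exact (h1.smul_const ξ).const_add z
    refine ⟨fun s => 2 * inner ℝ (z + ((s : ℂ) * v) • ξ) (v • ξ),
      Eventually.of_forall fun s => (hl s).norm_sq, ?_⟩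
    have h2 := ((hl 0).inner ℝ (hasDerivAt_const (0 : ℝ) (v • ξ))).const_mul 2
    refine h2.congr_deriv ?_
    rw [inner_zero_right, zero_add, real_inner_self_eq_norm_sq, norm_smul, hv, one_mul]
  exact ⟨_, _, key 1 (by simp), key Complex.I (by simp), by ring⟩

lemma IsMongeAmpereSolution.weighted_pullback_le {G : Cn n → Matrix (Fin n) (Fin n) ℂ}
    {g u : Cn n → ℝ} (hs : IsMongeAmpereSolution G g u) (hn : 0 < n) {e : Cn n} (he : ‖e‖ = 1)
    {τ₁ τ₂ μ₁ μ₂ D : ℝ} (hτ₁ : |τ₁| ≤ 1) (hτ₂ : |τ₂| ≤ 1) (hμ₁ : 0 ≤ μ₁) (hμ₂ : 0 ≤ μ₂)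
    (hD : 0 < D)
    (hG : ∀ z ∈ ball (0 : Cn n) 1, ∀ ξ, μ₁ * levi (G (ballAut e τ₁ z)) (ballAutDeriv e τ₁ z ξ) +
      μ₂ * levi (G (ballAut e τ₂ z)) (ballAutDeriv e τ₂ z ξ) - levi (G z) ξ ≤ D * ‖ξ‖ ^ 2)
    (hg : ∀ z ∈ ball (0 : Cn n) 1, g z - μ₁ * (ballAutJac e z τ₁ * g (ballAut e τ₁ z)) -
      μ₂ * (ballAutJac e z τ₂ * g (ballAut e τ₂ z)) ≤ D)
    (hb : ∀ z ∈ sphere (0 : Cn n) 1,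
      μ₁ * u (ballAut e τ₁ z) + μ₂ * u (ballAut e τ₂ z) - u z ≤ D) :
    ∀ z ∈ closedBall (0 : Cn n) 1,
      μ₁ * u (ballAut e τ₁ z) + μ₂ * u (ballAut e τ₂ z) - u z ≤ 4 * D := by
  set P : Cn n → ℝ := fun z =>
    μ₁ * u (ballAut e τ₁ z) + μ₂ * u (ballAut e τ₂ z) + (-1) * u z + 3 * D * ‖z‖ ^ 2 with hP
  have hcomp : ∀ τ, |τ| ≤ 1 → ContinuousOn (fun z => u (ballAut e τ z)) (closedBall 0 1) :=
    fun τ hτ => hs.continuousOn.comp (continuousOn_ballAut he hτ) fun z hz => by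
      simpa using norm_ballAut_le he (by simpa using hz) hτ
  have hPc : ContinuousOn P (closedBall 0 1) :=
    ((((hcomp τ₁ hτ₁).const_smul μ₁).add ((hcomp τ₂ hτ₂).const_smul μ₂)).add
      (hs.continuousOn.const_smul (-1 : ℝ))).add (by fun_prop)
  obtain ⟨z₀, hz₀, hmax⟩ := (isCompact_closedBall (0 : Cn n) 1).exists_isMaxOn
    ⟨0, by simp⟩ hPc
  have hz₀' : ‖z₀‖ ≤ 1 := by simpa using hz₀
  suffices hP0 : P z₀ ≤ 4 * D by
    intro z hz
    have h1 : P z ≤ P z₀ := hmax hz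
    have h2 : 0 ≤ 3 * D * ‖z‖ ^ 2 := by positivity
    simp only [hP] at h1 hP0
    linarith
  rcases hz₀'.lt_or_eq with hlt | heq
  · exfalso
    have hzb : z₀ ∈ ball (0 : Cn n) 1 := by simpa using hlt
    have hT : ∀ τ, |τ| ≤ 1 → ballAut e τ z₀ ∈ ball (0 : Cn n) 1 := fun τ hτ => by
      simpa using norm_ballAut_lt he hlt hτ
    have hd : ∀ τ, |τ| ≤ 1 → autDen e τ z₀ ≠ 0 := fun τ hτ => autDen_ne_zero he hlt.le hτ
    have hcd : ∀ τ, |τ| ≤ 1 → ContDiffAt ℝ 2 u (ballAut e τ z₀) := fun τ hτ =>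
      hs.contDiffAt (norm_ballAut_lt he hlt hτ)
    have hlevi : ∀ ξ : Cn n,
        μ₁ * levi (G (ballAut e τ₁ z₀) + cxHessian n u (ballAut e τ₁ z₀))
          (WithLp.toLp 2 (ballAutMatrix e τ₁ z₀ *ᵥ ξ)) +
        μ₂ * levi (G (ballAut e τ₂ z₀) + cxHessian n u (ballAut e τ₂ z₀))
          (WithLp.toLp 2 (ballAutMatrix e τ₂ z₀ *ᵥ ξ)) + 2 * D * ‖ξ‖ ^ 2 ≤
        levi (G z₀ + cxHessian n u z₀) ξ := by
      intro ξ
      rw [toLp_ballAutMatrix_mulVec, toLp_ballAutMatrix_mulVec, levi_add, levi_add, levi_add,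
        levi_cxHessian (hcd τ₁ hτ₁), levi_cxHessian (hcd τ₂ hτ₂),
        levi_cxHessian (hs.contDiffAt hlt)]
      have hlap := ((((hasLaplacian_line_ballAut (hcd τ₁ hτ₁) (hd τ₁ hτ₁) ξ).const_mul μ₁).add
        ((hasLaplacian_line_ballAut (hcd τ₂ hτ₂) (hd τ₂ hτ₂) ξ).const_mul μ₂)).add
        ((hasLaplacian_line (hs.contDiffAt hlt) ξ).const_mul (-1))).add
        ((hasLaplacian_norm_sq_line z₀ ξ).const_mul (3 * D))
      have hloc : IsLocalMax (fun ζ : ℂ => P (z₀ + ζ • ξ)) 0 := by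
        have hc : ContinuousAt (fun ζ : ℂ => z₀ + ζ • ξ) 0 := by fun_prop
        have hmem : ∀ᶠ ζ : ℂ in 𝓝 0, z₀ + ζ • ξ ∈ ball (0 : Cn n) 1 :=
          hc.eventually_mem (isOpen_ball.mem_nhds (by simpa using hlt))
        filter_upwards [hmem] with ζ hζ
        simpa using hmax (ball_subset_closedBall hζ)
      have h1 := hlap.nonpos_of_isLocalMax hloc
      have h2 := hG z₀ hzb ξ
      linarith
    have h := det_root_ge_of_levi_ge hn (hs.posSemidef _ hzb) (hs.posSemidef _ (hT τ₁ hτ₁))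
      (hs.posSemidef _ (hT τ₂ hτ₂)) (hs.nonneg _ hzb) (hs.nonneg _ (hT τ₁ hτ₁))
      (hs.nonneg _ (hT τ₂ hτ₂)) hμ₁ hμ₂ (by positivity) (hs.det_eq _ hzb)
      (hs.det_eq _ (hT τ₁ hτ₁)) (hs.det_eq _ (hT τ₂ hτ₂)) hlevi
    rw [norm_det_ballAutMatrix hn he (hd τ₁ hτ₁), norm_det_ballAutMatrix hn he (hd τ₂ hτ₂)] at h
    have h' := hg z₀ hzb
    simp only [ballAutJac] at h'
    linarith
  · have h1 := hb z₀ (by simpa using heq)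
    simp only [hP]
    rw [heq]
    linarith

end Comparison

/-! ### One-sided Taylor estimates for solutions -/

section UpperTaylor

variable {n : ℕ}

lemma exists_smul_ballField_eq {x h : Cn n} (hx : ‖x‖ < 1) (hh : h ≠ 0) :
    ∃ e : Cn n, ‖e‖ = 1 ∧ ∃ τ : ℝ, 0 < τ ∧ τ • ballField e x = h ∧ τ * (1 - ‖x‖ ^ 2) ≤ ‖h‖ := by
  have hx2 : 0 < 1 - ‖x‖ ^ 2 := by nlinarith [norm_nonneg x]
  have hx3 : (1 + ‖x‖ ^ 2) ≠ 0 := by positivity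
  set p : ℂ := inner ℂ h x with hp
  set m : ℂ := ⟨p.re / (1 - ‖x‖ ^ 2), p.im / (1 + ‖x‖ ^ 2)⟩ with hm
  set v : Cn n := h + m • x with hv
  have hxx : inner ℂ x x = ((‖x‖ ^ 2 : ℝ) : ℂ) := by
    rw [inner_self_eq_norm_sq_to_K]; push_cast; rfl
  have hvx : inner ℂ v x = m := by
    rw [hv, inner_add_left, inner_smul_left, ← hp, hxx]
    apply Complex.ext
    · rw [Complex.add_re, Complex.re_mul_ofReal, Complex.conj_re, hm]
      field_simp
      ring
    · rw [Complex.add_im, Complex.im_mul_ofReal, Complex.conj_im, hm]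
      field_simp
      ring
  have hvh : v - inner ℂ v x • x = h := by rw [hvx, hv]; abel
  have hv0 : v ≠ 0 := by
    intro h0
    rw [h0] at hvh
    simp at hvh
    exact hh hvh.symm
  have hvn : 0 < ‖v‖ := norm_pos_iff.mpr hv0
  refine ⟨(‖v‖⁻¹ : ℝ) • v, ?_, ‖v‖, hvn, ?_, ?_⟩
  · rw [norm_smul, norm_inv, norm_norm, inv_mul_cancel₀ hvn.ne']
  · rw [ballField, inner_smul_left_eq_smul, smul_assoc, ← smul_sub, hvh, smul_smul,
      mul_inv_cancel₀ hvn.ne', one_smul]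
  · have h1 : ‖v‖ - ‖inner ℂ v x • x‖ ≤ ‖h‖ := by
      rw [← hvh]; exact norm_sub_norm_le _ _
    rw [norm_smul] at h1
    nlinarith [norm_inner_le_norm (𝕜 := ℂ) v x, norm_nonneg x]

/-- The data of the Dirichlet problem in the unit ball, with all coefficients bounded by `K` in
`C^{1,α}`. -/
structure DirichletData (α K : ℝ) (G : Cn n → Matrix (Fin n) (Fin n) ℂ) (g Φ u : Cn n → ℝ) :
    Prop where
  pos_dim : 0 < n
  exponent_pos : 0 < α
  exponent_le_one : α ≤ 1
  bound_pos : 0 < K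
  solution : IsMongeAmpereSolution G g u
  metric_bound : ∀ i j, C1AlphaBound α K (fun z => G z i j)
  density_bound : C1AlphaBound α K g
  boundary_bound : C1AlphaBound α K Φ
  boundary_continuousOn : ContinuousOn Φ (closedBall 0 1)
  boundary_eq : ∀ z ∈ sphere (0 : Cn n) 1, u z = Φ z

namespace DirichletData

variable {α K : ℝ} {G : Cn n → Matrix (Fin n) (Fin n) ℂ} {g Φ u : Cn n → ℝ}

lemma one_le_const (h : DirichletData α K G g Φ u) : (1 : ℝ) ≤ n ^ 2 :=
  one_le_pow₀ (by exact_mod_cast h.pos_dim)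

lemma const_pos (h : DirichletData α K G g Φ u) : 0 < 10 ^ 6 * (n : ℝ) ^ 2 * K := by
  have := h.one_le_const
  have := h.bound_pos
  positivity

lemma weighted_pullback_le (h : DirichletData α K G g Φ u) {e : Cn n} (he : ‖e‖ = 1)
    {τ₁ τ₂ μ₁ μ₂ δ : ℝ} (hτ₁ : |τ₁| ≤ 1) (hτ₂ : |τ₂| ≤ 1) (hμ₁ : 0 ≤ μ₁) (hμ₂ : 0 ≤ μ₂)
    (hδ : 0 < δ) (hw : ∀ (L : ℝ) (w w' : ℝ → ℝ), IsC1Alpha α L w w' →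
      |μ₁ * w τ₁ + μ₂ * w τ₂ - w 0| ≤ L * δ) {z : Cn n} (hz : ‖z‖ ≤ 1) :
    μ₁ * u (ballAut e τ₁ z) + μ₂ * u (ballAut e τ₂ z) - u z ≤
      4 * (10 ^ 6 * n ^ 2 * K * δ) := by
  have hα := h.exponent_pos
  have hα1 := h.exponent_le_one
  have hn2 := h.one_le_const
  have hK := h.bound_pos
  refine h.solution.weighted_pullback_le h.pos_dim he hτ₁ hτ₂ hμ₁ hμ₂
    (mul_pos h.const_pos hδ) (fun z hz ξ => ?_) (fun z hz => ?_) (fun z hz => ?_) z (by simpa using hz)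
  · obtain ⟨w', hw'⟩ := exists_isC1Alpha_levi_pullback h.metric_bound hα hα1 he
      (by simpa using hz) ξ
    have h1 := hw _ _ _ hw'
    rw [ballAut_zero, ballAutDeriv_zero] at h1
    refine (le_abs_self _).trans (h1.trans (le_of_eq (by ring)))
  · obtain ⟨w', hw'⟩ := exists_isC1Alpha_jac_mul h.density_bound h.pos_dim hα hα1 he
      (by simpa using hz)
    have h1 := hw _ _ _ hw'
    have hj1 : ballAutJac e z 0 = 1 := by simp [ballAutJac, autDen]
    rw [ballAut_zero, hj1, one_mul] at h1
    have := (abs_le.mp h1).1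
    linarith
  · have hT : ∀ τ, |τ| ≤ 1 → u (ballAut e τ z) = Φ (ballAut e τ z) := fun τ hτ =>
      h.boundary_eq _ (by simpa using norm_ballAut_eq_one he (by simpa using hz) hτ)
    rw [hT τ₁ hτ₁, hT τ₂ hτ₂, h.boundary_eq z hz]
    have hcomp : ∀ τ, |τ| ≤ 1 → ContinuousOn (fun z => Φ (ballAut e τ z)) (closedBall 0 1) :=
      fun τ hτ => h.boundary_continuousOn.comp (continuousOn_ballAut he hτ) fun z hz => by
        simpa using norm_ballAut_le he (by simpa using hz) hτ
    have hc : ContinuousOn (fun z => μ₁ * Φ (ballAut e τ₁ z) + μ₂ * Φ (ballAut e τ₂ z) - Φ z)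
        (closedBall 0 1) :=
      (((hcomp τ₁ hτ₁).const_smul μ₁).add ((hcomp τ₂ hτ₂).const_smul μ₂)).sub
        h.boundary_continuousOn
    rw [← closure_ball (0 : Cn n) one_ne_zero] at hc
    refine le_on_closure (fun z hz => ?_) hc continuousOn_const
      (by rw [closure_ball (0 : Cn n) one_ne_zero]; exact sphere_subset_closedBall hz)
    have h1 := hw _ _ _ (h.boundary_bound.comp_ballAut hα hα1 he (by simpa using hz))
    rw [ballAut_zero] at h1
    refine (le_abs_self _).trans (h1.trans (mul_le_mul_of_nonneg_right ?_ hδ.le))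
    nlinarith

lemma pullback_sub_le (h : DirichletData α K G g Φ u) {e z : Cn n} (he : ‖e‖ = 1)
    (hz : ‖z‖ ≤ 1) {τ : ℝ} (hτ : 0 < τ) (hτ1 : τ ≤ 1) :
    u (ballAut e τ z) - u z ≤ 4 * (10 ^ 6 * n ^ 2 * K * τ) := by
  have hτ' : |τ| ≤ 1 := by rwa [abs_of_pos hτ]
  have h1 := h.weighted_pullback_le he hτ' (τ₂ := 0) (by simp) zero_le_one le_rfl hτ
    (fun L w w' hw => by
      have := hw.norm_image_sub_le hτ'
      rw [abs_of_pos hτ] at this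
      simpa using this) hz
  simpa using h1

lemma weighted_second_difference_le (h : DirichletData α K G g Φ u) {e z : Cn n} (he : ‖e‖ = 1)
    (hz : ‖z‖ ≤ 1) {σ τ : ℝ} (hσ : 0 < σ) (hστ : σ ≤ τ) (hτ1 : τ ≤ 1) :
    σ * (u (ballAut e τ z) - u z) + τ * (u (ballAut e (-σ) z) - u z) ≤
      8 * (10 ^ 6 * n ^ 2 * K) * (σ * τ ^ (1 + α)) := by
  have hτ : 0 < τ := hσ.trans_le hστ
  have hτσ : 0 < τ + σ := by positivity
  have hpow : 0 < τ ^ (1 + α) := Real.rpow_pos_of_pos hτ _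
  have h1 := h.weighted_pullback_le he (τ₁ := τ) (τ₂ := -σ) (μ₁ := σ / (τ + σ))
    (μ₂ := τ / (τ + σ)) (δ := 2 * (σ * τ ^ (1 + α)) / (τ + σ)) (by rwa [abs_of_pos hτ])
    (by rw [abs_neg, abs_of_pos hσ]; linarith) (by positivity) (by positivity) (by positivity)
    (fun L w w' hw => by
      have h2 := hw.abs_weighted_defect_le h.exponent_pos hσ hστ hτ1
      have e1 : σ / (τ + σ) * w τ + τ / (τ + σ) * w (-σ) - w 0 =
          (σ * w τ + τ * w (-σ) - (τ + σ) * w 0) / (τ + σ) := by field_simp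
      rw [e1, abs_div, abs_of_pos hτσ, ← mul_div_assoc]
      exact div_le_div_of_nonneg_right (h2.trans (le_of_eq (by ring))) hτσ.le) hz
  have h3 := mul_le_mul_of_nonneg_left h1 hτσ.le
  have e2 : (τ + σ) * (σ / (τ + σ) * u (ballAut e τ z) + τ / (τ + σ) * u (ballAut e (-σ) z) -
      u z) = σ * (u (ballAut e τ z) - u z) + τ * (u (ballAut e (-σ) z) - u z) := by
    field_simp; ring
  have e3 : (τ + σ) * (4 * (10 ^ 6 * n ^ 2 * K * (2 * (σ * τ ^ (1 + α)) / (τ + σ)))) =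
      8 * (10 ^ 6 * n ^ 2 * K) * (σ * τ ^ (1 + α)) := by
    field_simp; ring
  rwa [e2, e3] at h3

lemma hasDerivAt_pullback (h : DirichletData α K G g Φ u) {e z : Cn n} (he : ‖e‖ = 1)
    (hz : ‖z‖ < 1) :
    HasDerivAt (fun s => u (ballAut e s z)) (fderiv ℝ u z (ballField e z)) 0 := by
  have h1 := hasDerivAt_ballAut he (autDen_ne_zero he hz.le (τ := 0) (by simp))
  have h2 := ((h.solution.contDiffAt hz).differentiableAt (by norm_num)).hasFDerivAt
  rw [ballAut_zero] at h1
  refine HasFDerivAt.comp_hasDerivAt (0 : ℝ) ?_ h1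
  rwa [ballAut_zero]

lemma fderiv_ballField_le (h : DirichletData α K G g Φ u) {e z : Cn n} (he : ‖e‖ = 1)
    (hz : ‖z‖ < 1) : fderiv ℝ u z (ballField e z) ≤ 4 * (10 ^ 6 * n ^ 2 * K) := by
  have h1 := (h.hasDerivAt_pullback he hz).tendsto_slope_zero_right
  refine le_of_tendsto h1 ?_
  filter_upwards [Ioc_mem_nhdsGT (zero_lt_one' ℝ)] with τ hτ
  rw [zero_add, ballAut_zero, smul_eq_mul, inv_mul_le_iff₀ hτ.1]
  exact (h.pullback_sub_le he hz.le hτ.1 hτ.2).trans (le_of_eq (by ring))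

lemma pullback_taylor_le (h : DirichletData α K G g Φ u) {e z : Cn n} (he : ‖e‖ = 1)
    (hz : ‖z‖ < 1) {τ : ℝ} (hτ : 0 < τ) (hτ1 : τ ≤ 1) :
    u (ballAut e τ z) - u z - τ * fderiv ℝ u z (ballField e z) ≤
      8 * (10 ^ 6 * n ^ 2 * K) * τ ^ (1 + α) := by
  have h0 : HasDerivAt (fun s => u (ballAut e (-s) z)) (-fderiv ℝ u z (ballField e z)) 0 := by
    have h1 : HasDerivAt (fun s => u (ballAut e s z)) (fderiv ℝ u z (ballField e z)) (-0) := by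
      simpa using h.hasDerivAt_pullback he hz
    have h2 := h1.scomp (0 : ℝ) (hasDerivAt_neg (0 : ℝ))
    rw [neg_one_smul] at h2
    exact h2
  have h1 := (h0.tendsto_slope_zero_right.const_mul τ).const_add (u (ballAut e τ z) - u z)
  have h2 : u (ballAut e τ z) - u z + τ * -fderiv ℝ u z (ballField e z) ≤
      8 * (10 ^ 6 * n ^ 2 * K) * τ ^ (1 + α) := by
    refine le_of_tendsto h1 ?_
    filter_upwards [Ioc_mem_nhdsGT hτ] with σ hσ
    have h3 := h.weighted_second_difference_le he hz.le hσ.1 hσ.2 hτ1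
    rw [zero_add, neg_zero, ballAut_zero, smul_eq_mul]
    have h4 : σ * (u (ballAut e τ z) - u z + τ * (σ⁻¹ * (u (ballAut e (-σ) z) - u z))) ≤
        σ * (8 * (10 ^ 6 * n ^ 2 * K) * τ ^ (1 + α)) := by
      have hσ' : σ ≠ 0 := hσ.1.ne'
      refine le_of_eq_of_le ?_ (h3.trans (le_of_eq (by ring)))
      field_simp
    exact le_of_mul_le_mul_left h4 hσ.1
  linarith

lemma norm_fderiv_le (h : DirichletData α K G g Φ u) {s : ℝ} (hs : 0 < s) {x : Cn n}
    (hx : ‖x‖ ≤ 1 - s) : ‖fderiv ℝ u x‖ ≤ 4 * (10 ^ 6 * n ^ 2 * K) / s := by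
  have hx1 : ‖x‖ < 1 := by linarith
  have hc := h.const_pos
  have key : ∀ v : Cn n, v ≠ 0 → fderiv ℝ u x v ≤ 4 * (10 ^ 6 * n ^ 2 * K) / s * ‖v‖ := by
    intro v hv
    obtain ⟨e, he, τ, hτ, rfl, hle⟩ := exists_smul_ballField_eq hx1 hv
    have h1 := h.fderiv_ballField_le he hx1
    have h2 : s ≤ 1 - ‖x‖ ^ 2 := by nlinarith [norm_nonneg x]
    have h3 : τ * s ≤ ‖τ • ballField e x‖ := (mul_le_mul_of_nonneg_left h2 hτ.le).trans hle
    rw [map_smul, smul_eq_mul, div_mul_eq_mul_div, le_div_iff₀ hs]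
    nlinarith [mul_le_mul_of_nonneg_left h1 (mul_pos hτ hs).le]
  refine ContinuousLinearMap.opNorm_le_bound _ (by positivity) fun v => ?_
  rcases eq_or_ne v 0 with rfl | hv
  · simp
  · rw [Real.norm_eq_abs, abs_le']
    refine ⟨key v hv, ?_⟩
    have := key (-v) (neg_ne_zero.mpr hv)
    rwa [map_neg, norm_neg] at this

lemma abs_sub_le (h : DirichletData α K G g Φ u) {s : ℝ} (hs : 0 < s) {x y : Cn n}
    (hx : ‖x‖ ≤ 1 - s) (hy : ‖y‖ ≤ 1 - s) :
    |u y - u x| ≤ 4 * (10 ^ 6 * n ^ 2 * K) / s * ‖y - x‖ := by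
  have hc : Convex ℝ (closedBall (0 : Cn n) (1 - s)) := convex_closedBall _ _
  exact hc.norm_image_sub_le_of_norm_fderiv_le (𝕜 := ℝ) (f := u)
    (fun z hz => (h.solution.contDiffAt (by
      have : ‖z‖ ≤ 1 - s := by simpa using hz
      linarith)).differentiableAt (by norm_num))
    (fun z hz => h.norm_fderiv_le hs (by simpa using hz)) (by simpa using hx) (by simpa using hy)

lemma taylor_le (h : DirichletData α K G g Φ u) {s : ℝ} (hs : 0 < s) (hs1 : s ≤ 1) {x v : Cn n}
    (hx : ‖x‖ ≤ 1 - s) (hv : ‖v‖ ≤ s ^ 2 / 4) :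
    u (x + v) - u x - fderiv ℝ u x v ≤
      40 * (10 ^ 6 * n ^ 2 * K) / s ^ 3 * ‖v‖ ^ (1 + α) := by
  have hα := h.exponent_pos
  have hα1 := h.exponent_le_one
  have hc := h.const_pos
  rcases eq_or_ne v 0 with rfl | hv0
  · simp [Real.zero_rpow (by linarith : (1 + α) ≠ 0)]
  have hx1 : ‖x‖ < 1 := by linarith
  have hvpos : 0 < ‖v‖ := norm_pos_iff.mpr hv0
  obtain ⟨e, he, τ, hτ, hτv, hle⟩ := exists_smul_ballField_eq hx1 hv0
  have h2 : s ≤ 1 - ‖x‖ ^ 2 := by nlinarith [norm_nonneg x]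
  have h3 : τ ≤ ‖v‖ / s := by
    rw [le_div_iff₀ hs]
    exact (mul_le_mul_of_nonneg_left h2 hτ.le).trans hle
  have hvs : ‖v‖ / s ≤ s / 4 := by
    rw [div_le_iff₀ hs]
    linarith [sq s]
  have hτ1 : τ ≤ 1 := by linarith
  have hdist : ‖ballAut e τ x - (x + v)‖ ≤ 4 * (‖v‖ / s) ^ 2 := by
    have h4 := (isC1Alpha_ballAut (α := 1) le_rfl he hx1.le).norm_taylor_le one_pos (s := τ)
      (by rwa [abs_of_pos hτ])
    rw [ballAut_zero, hτv, abs_of_pos hτ] at h4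
    norm_num at h4
    rw [sub_add_eq_sub_sub]
    exact h4.trans (mul_le_mul_of_nonneg_left (pow_le_pow_left₀ hτ.le h3 2) (by norm_num))
  have hxv : ‖x + v‖ ≤ 1 - s / 2 := by
    refine (norm_add_le _ _).trans ?_
    nlinarith
  have hTx : ‖ballAut e τ x‖ ≤ 1 - s / 2 := by
    have h5 : ‖ballAut e τ x‖ ≤ ‖ballAut e τ x - (x + v)‖ + (‖x‖ + ‖v‖) := by
      refine le_trans ?_ (add_le_add_right (norm_add_le x v) _)
      simpa using norm_add_le (ballAut e τ x - (x + v)) (x + v)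
    have h6 : 4 * (‖v‖ / s) ^ 2 ≤ s / 4 := by
      have : 0 ≤ ‖v‖ / s := by positivity
      nlinarith
    nlinarith
  have h7 := (abs_le.mp (h.abs_sub_le (half_pos hs) hxv hTx)).1
  have h8 := h.pullback_taylor_le he hx1 hτ hτ1
  have h9 : τ * fderiv ℝ u x (ballField e x) = fderiv ℝ u x v := by
    rw [← hτv, map_smul, smul_eq_mul]
  have hv1 : ‖v‖ ≤ 1 := by nlinarith
  have b1 : τ ^ (1 + α) ≤ ‖v‖ ^ (1 + α) / s ^ 3 := by
    refine (Real.rpow_le_rpow hτ.le h3 (by linarith)).trans ?_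
    rw [Real.div_rpow hvpos.le hs.le]
    refine div_le_div_of_nonneg_left (Real.rpow_nonneg hvpos.le _) (by positivity) ?_
    rw [← Real.rpow_natCast]
    exact Real.rpow_le_rpow_of_exponent_ge hs hs1 (by push_cast; linarith)
  have b2 : ‖v‖ ^ 2 ≤ ‖v‖ ^ (1 + α) := by
    rw [← Real.rpow_natCast]
    exact Real.rpow_le_rpow_of_exponent_ge hvpos hv1 (by push_cast; linarith)
  have b3 : 4 * (10 ^ 6 * n ^ 2 * K) / (s / 2) * ‖ballAut e τ x - (x + v)‖ ≤
      32 * (10 ^ 6 * n ^ 2 * K) / s ^ 3 * ‖v‖ ^ (1 + α) := by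
    refine (mul_le_mul_of_nonneg_left hdist (by positivity)).trans ?_
    refine le_trans (le_of_eq ?_) (mul_le_mul_of_nonneg_left b2 (by positivity))
    field_simp
    ring
  have b4 := mul_le_mul_of_nonneg_left b1 (by positivity : 0 ≤ 8 * (10 ^ 6 * n ^ 2 * K))
  have e1 : 40 * (10 ^ 6 * n ^ 2 * K) / s ^ 3 * ‖v‖ ^ (1 + α) =
      32 * (10 ^ 6 * n ^ 2 * K) / s ^ 3 * ‖v‖ ^ (1 + α) +
        8 * (10 ^ 6 * n ^ 2 * K) * (‖v‖ ^ (1 + α) / s ^ 3) := by ring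
  rw [e1]
  linarith

end DirichletData

end UpperTaylor

/-! ### A barrier argument in one complex variable -/

section Barrier

lemma hasSecondDeriv_inv_quadratic {N : ℝ} (hN : N ≠ 0) (b : ℝ) :
    HasSecondDeriv (fun s => (N + 2 * b * s + s ^ 2)⁻¹) (-2 / N ^ 2 + 8 * b ^ 2 / N ^ 3) := by
  have hq : ∀ s : ℝ, HasDerivAt (fun s => N + 2 * b * s + s ^ 2) (2 * b + 2 * s) s := fun s =>
    ((((hasDerivAt_id s).const_mul (2 * b)).const_add N).add ((hasDerivAt_id s).pow 2)).congr_deriv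
      (by simp)
  have hev : ∀ᶠ s : ℝ in 𝓝 0, N + 2 * b * s + s ^ 2 ≠ 0 :=
    (hq 0).continuousAt.eventually_ne (by simpa using hN)
  refine ⟨fun s => -(2 * b + 2 * s) / (N + 2 * b * s + s ^ 2) ^ 2, ?_, ?_⟩
  · filter_upwards [hev] with s hs using (hq s).inv hs
  · have h1 : HasDerivAt (fun s : ℝ => -(2 * b + 2 * s)) (-2) 0 :=
      (((hasDerivAt_id (0 : ℝ)).const_mul 2).const_add (2 * b)).neg.congr_deriv (by simp)
    have h2 := h1.div ((hq 0).pow 2) (by simpa using hN)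
    refine h2.congr_deriv ?_
    simp only [mul_zero, add_zero, Pi.pow_apply]
    norm_num
    field_simp
    ring

lemma hasLaplacian_inv_norm_sq {p : ℂ} (hp : p ≠ 0) :
    HasLaplacian (fun ζ => (‖p + ζ‖ ^ 2)⁻¹) (4 / ‖p‖ ^ 4) := by
  have hnorm : ∀ w : ℂ, ‖w‖ ^ 2 = w.re ^ 2 + w.im ^ 2 := fun w => by
    rw [← Complex.sq_norm_sub_sq_re]; ring
  have hN : p.re ^ 2 + p.im ^ 2 ≠ 0 := by
    rw [← hnorm]
    simpa using hp
  set N := p.re ^ 2 + p.im ^ 2 with hNdef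
  refine ⟨-2 / N ^ 2 + 8 * p.re ^ 2 / N ^ 3, -2 / N ^ 2 + 8 * p.im ^ 2 / N ^ 3, ?_, ?_, ?_⟩
  · convert hasSecondDeriv_inv_quadratic hN p.re using 2 with s
    simp only [hnorm, hNdef]
    simp
    ring
  · convert hasSecondDeriv_inv_quadratic hN p.im using 2 with s
    simp only [hnorm, hNdef]
    simp
    ring
  · rw [show ‖p‖ ^ 4 = (‖p‖ ^ 2) ^ 2 by ring, hnorm, ← hNdef]
    field_simp
    rw [hNdef]
    ring

lemma exists_disc_nonpos (ℓ : ℂ →L[ℝ] ℝ) :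
    ∃ k₀ : ℂ, ‖k₀‖ = 1 / 2 ∧ ∀ k, ‖k - k₀‖ ≤ 1 / 2 → ℓ k ≤ 0 := by
  set a := (InnerProductSpace.toDual ℝ ℂ).symm ℓ with ha
  have hℓ : ∀ k, ℓ k = inner ℝ a k := fun k => by rw [ha, InnerProductSpace.toDual_symm_apply]
  rcases eq_or_ne a 0 with h0 | h0
  · exact ⟨1 / 2, by norm_num, fun k _ => by rw [hℓ, h0, inner_zero_left]⟩
  · have hpos : 0 < ‖a‖ := norm_pos_iff.mpr h0
    refine ⟨(-(1 / 2) * ‖a‖⁻¹ : ℝ) • a, ?_, fun k hk => ?_⟩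
    · rw [norm_smul, Real.norm_eq_abs, abs_mul, abs_neg, abs_of_pos (inv_pos.mpr hpos), mul_assoc,
        inv_mul_cancel₀ hpos.ne']
      norm_num
    · have h1 : ℓ k = inner ℝ a (k - (-(1 / 2) * ‖a‖⁻¹ : ℝ) • a) - 1 / 2 * ‖a‖ := by
        rw [hℓ, inner_sub_right, inner_smul_right, real_inner_self_eq_norm_sq]
        field_simp
        ring
      have h2 := real_inner_le_norm a (k - (-(1 / 2) * ‖a‖⁻¹ : ℝ) • a)
      nlinarith

/-- A function on a disc whose Laplacian is bounded below, which is bounded above, vanishes at the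
centre and admits a one-sided linear bound near `1`, is bounded below at `1`. -/
lemma neg_mul_le_of_laplacian_ge {W : ℂ → ℝ} {m : ℝ} (hm : 0 < m)
    (hc : ContinuousOn W (closedBall 0 4))
    (hlap : ∀ ζ₀ ∈ ball (0 : ℂ) 4, ∃ L, -m ≤ L ∧ HasLaplacian (fun ζ => W (ζ₀ + ζ)) L)
    (hle : ∀ ζ ∈ closedBall (0 : ℂ) 4, W ζ ≤ m) (h0 : W 0 = 0) (ℓ : ℂ →L[ℝ] ℝ)
    (hℓ : ∀ k, ‖k‖ ≤ 1 → W (1 + k) ≤ W 1 + ℓ k + m) : -(23 * m) ≤ W 1 := by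
  by_contra! hW
  obtain ⟨k₀, hk₀, hdisc⟩ := exists_disc_nonpos ℓ
  set z₁ : ℂ := 1 + k₀ with hz₁
  have hz₁l : 1 / 2 ≤ ‖z₁‖ := by
    have := norm_sub_norm_le (1 : ℂ) (-k₀)
    rw [norm_neg, sub_neg_eq_add, norm_one, hk₀] at this
    linarith
  have hz₁u : ‖z₁‖ ≤ 3 / 2 := by
    refine (norm_add_le _ _).trans ?_
    rw [norm_one, hk₀]; norm_num
  set A : Set ℂ := {ζ | 1 / 2 ≤ ‖ζ - z₁‖} ∩ {ζ | ‖ζ - z₁‖ ≤ 2}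
  have hA1 : ∀ ζ ∈ A, 1 / 2 ≤ ‖ζ - z₁‖ := fun ζ hζ => hζ.1
  have hA2 : ∀ ζ ∈ A, ‖ζ - z₁‖ ≤ 2 := fun ζ hζ => hζ.2
  have hA4 : ∀ ζ ∈ A, ‖ζ‖ ≤ 7 / 2 := fun ζ hζ => by
    have : ‖ζ‖ ≤ ‖ζ - z₁‖ + ‖z₁‖ := by simpa using norm_add_le (ζ - z₁) z₁
    linarith [hA2 ζ hζ]
  have hAs : A ⊆ closedBall 0 4 := fun ζ hζ => by
    have := hA4 ζ hζ
    simp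
    linarith
  have hAclosed : IsClosed A :=
    (isClosed_le continuous_const (by fun_prop)).inter (isClosed_le (by fun_prop) continuous_const)
  have hAcomp : IsCompact A := (isCompact_closedBall (0 : ℂ) 4).of_isClosed_subset hAclosed hAs
  have h0A : (0 : ℂ) ∈ A := by
    have h1 : 1 / 2 ≤ ‖0 - z₁‖ := by rwa [zero_sub, norm_neg]
    have h2 : ‖0 - z₁‖ ≤ 2 := by rw [zero_sub, norm_neg]; linarith
    exact ⟨h1, h2⟩
  set Q : ℂ → ℝ := fun ζ => W ζ + 6 * m * ((‖ζ - z₁‖ ^ 2)⁻¹ + -(1 / 4)) with hQ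
  have hQc : ContinuousOn Q A := by
    refine (hc.mono hAs).add (continuousOn_const.mul (ContinuousOn.add
      (ContinuousOn.inv₀ (by fun_prop) fun ζ hζ => ?_) continuousOn_const))
    have : 0 < ‖ζ - z₁‖ := by linarith [hA1 ζ hζ]
    positivity
  obtain ⟨ζ₀, hζ₀, hmax⟩ := hAcomp.exists_isMaxOn ⟨0, h0A⟩ hQc
  have hQ0 : 7 / 6 * m ≤ Q ζ₀ := by
    refine le_trans ?_ (hmax h0A)
    simp only [hQ, h0, zero_sub, norm_neg, zero_add]
    have : (4 : ℝ) / 9 ≤ (‖z₁‖ ^ 2)⁻¹ := by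
      rw [show (4 : ℝ) / 9 = ((3 / 2 : ℝ) ^ 2)⁻¹ by norm_num]
      exact inv_anti₀ (by positivity) (pow_le_pow_left₀ (norm_nonneg _) hz₁u 2)
    nlinarith
  rcases (hA1 ζ₀ hζ₀).eq_or_lt with hin | hin
  · have hk : ‖(ζ₀ - 1) - k₀‖ ≤ 1 / 2 := by
      rw [hin, hz₁]
      exact le_of_eq (by congr 1; ring)
    have hk1 : ‖ζ₀ - 1‖ ≤ 1 := by
      have : ‖ζ₀ - 1‖ ≤ ‖(ζ₀ - 1) - k₀‖ + ‖k₀‖ := by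
        simpa using norm_add_le ((ζ₀ - 1) - k₀) k₀
      linarith
    have h1 := hℓ (ζ₀ - 1) hk1
    have h2 := hdisc _ hk
    rw [add_sub_cancel] at h1
    simp only [hQ, ← hin] at hQ0
    norm_num at hQ0
    linarith
  · rcases (hA2 ζ₀ hζ₀).eq_or_lt with hout | hout
    · have h1 := hle ζ₀ (hAs hζ₀)
      simp only [hQ, hout] at hQ0
      norm_num at hQ0
      linarith
    · obtain ⟨L, hL, hLap⟩ := hlap ζ₀ (by
        have := hA4 ζ₀ hζ₀
        simp
        linarith)
      have hp : ζ₀ - z₁ ≠ 0 := by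
        rw [← norm_pos_iff]; linarith
      have hconst : HasLaplacian (fun _ : ℂ => -(1 / 4 : ℝ)) 0 :=
        ⟨0, 0, ⟨fun _ => 0, Eventually.of_forall fun s => hasDerivAt_const s _,
          hasDerivAt_const 0 0⟩, ⟨fun _ => 0, Eventually.of_forall fun s => hasDerivAt_const s _,
          hasDerivAt_const 0 0⟩, by simp⟩
      have hlapQ := hLap.add (((hasLaplacian_inv_norm_sq hp).add hconst).const_mul (6 * m))
      have hloc : IsLocalMax (fun ζ => W (ζ₀ + ζ) +
          6 * m * ((‖ζ₀ - z₁ + ζ‖ ^ 2)⁻¹ + -(1 / 4))) 0 := by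
        have hcn : ContinuousAt (fun ζ : ℂ => ‖ζ₀ + ζ - z₁‖) 0 := by fun_prop
        have hmem : ∀ᶠ ζ : ℂ in 𝓝 0, ‖ζ₀ + ζ - z₁‖ ∈ Ioo (1 / 2 : ℝ) 2 :=
          hcn.eventually_mem (isOpen_Ioo.mem_nhds (by simpa only [add_zero] using ⟨hin, hout⟩))
        filter_upwards [hmem] with ζ hζ
        have := hmax (show ζ₀ + ζ ∈ A from ⟨hζ.1.le, hζ.2.le⟩)
        simpa [hQ, add_sub_right_comm] using this
      have h1 := hlapQ.nonpos_of_isLocalMax hloc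
      have h2 : 4 / (2 : ℝ) ^ 4 ≤ 4 / ‖ζ₀ - z₁‖ ^ 4 :=
        div_le_div_of_nonneg_left (by norm_num) (by positivity)
          (pow_le_pow_left₀ (norm_nonneg _) hout.le 4)
      nlinarith

end Barrier

/-! ### Two-sided Taylor estimates and the interior gradient bound -/

section LowerTaylor

variable {n : ℕ} {α K : ℝ} {G : Cn n → Matrix (Fin n) (Fin n) ℂ} {g Φ u : Cn n → ℝ}

lemma levi_le_of_norm_le {A : Matrix (Fin n) (Fin n) ℂ} (hA : ∀ i j, ‖A i j‖ ≤ K) (ξ : Cn n) :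
    levi A ξ ≤ n ^ 2 * K * ‖ξ‖ ^ 2 := by
  have key : ∀ i j, ‖ξ i * A i j * star (ξ j)‖ ≤ K * ‖ξ‖ ^ 2 := fun i j => by
    rw [norm_mul, norm_mul, norm_star]
    have hi := PiLp.norm_apply_le ξ i
    have hj := PiLp.norm_apply_le ξ j
    calc ‖ξ i‖ * ‖A i j‖ * ‖ξ j‖ = ‖A i j‖ * (‖ξ i‖ * ‖ξ j‖) := by ring
      _ ≤ K * (‖ξ‖ * ‖ξ‖) := mul_le_mul (hA i j)
          (mul_le_mul hi hj (norm_nonneg _) (norm_nonneg _)) (by positivity)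
          ((norm_nonneg _).trans (hA i j))
      _ = K * ‖ξ‖ ^ 2 := by ring
  refine (Complex.re_le_norm _).trans ?_
  refine (norm_sum_le _ _).trans ((Finset.sum_le_sum fun i _ =>
    (norm_sum_le _ _).trans (Finset.sum_le_sum fun j _ => key i j)).trans (le_of_eq ?_))
  simp
  ring

lemma hasLaplacian_clm_add (L : ℂ →L[ℝ] ℝ) (ζ₀ : ℂ) (c : ℝ) :
    HasLaplacian (fun ζ => c + L (ζ₀ + ζ)) 0 := by
  have key : ∀ v : ℂ, HasSecondDeriv (fun s : ℝ => c + L (ζ₀ + s * v)) 0 := fun v => by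
    refine ⟨fun _ => L v, Eventually.of_forall fun s => ?_, hasDerivAt_const 0 _⟩
    have hl : HasDerivAt (fun s : ℝ => ζ₀ + (s : ℂ) * v) v s := by
      simpa using ((Complex.ofRealCLM.hasDerivAt (x := s)).mul_const v).const_add ζ₀
    exact (L.hasFDerivAt.comp_hasDerivAt s hl).const_add c
  exact ⟨0, 0, key 1, key Complex.I, by simp⟩

namespace DirichletData

lemma abs_taylor_le (h : DirichletData α K G g Φ u) {s : ℝ} (hs : 0 < s) (hs1 : s ≤ 1)
    {x v : Cn n} (hx : ‖x‖ ≤ 1 - s) (hv : ‖v‖ ≤ s ^ 2 / 64) :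
    |u (x + v) - u x - fderiv ℝ u x v| ≤
      15000 * (10 ^ 6 * n ^ 2 * K) / s ^ 3 * ‖v‖ ^ (1 + α) := by
  have hα := h.exponent_pos
  have hα1 := h.exponent_le_one
  have hc := h.const_pos
  rcases eq_or_ne v 0 with rfl | hv0
  · simp [Real.zero_rpow (by linarith : (1 + α) ≠ 0)]
  have hvpos : 0 < ‖v‖ := norm_pos_iff.mpr hv0
  have hs2 : s ^ 2 ≤ s := by nlinarith
  have hv1 : ‖v‖ ≤ 1 := by linarith
  set X := ‖v‖ ^ (1 + α) with hX
  have hXpos : 0 < X := Real.rpow_pos_of_pos hvpos _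
  have hvX : ‖v‖ ^ 2 ≤ X := by
    rw [← Real.rpow_natCast]
    exact Real.rpow_le_rpow_of_exponent_ge hvpos hv1 (by push_cast; linarith)
  set P : ℝ := 10 ^ 6 * n ^ 2 * K with hP
  set m := 640 * P / s ^ 3 * X with hm
  have hmpos : 0 < m := by positivity
  have hmX : 640 * P * X ≤ m := by
    rw [hm, div_mul_eq_mul_div, le_div_iff₀ (by positivity)]
    have : s ^ 3 ≤ 1 := pow_le_one₀ hs.le hs1
    exact mul_le_of_le_one_right (by positivity) this
  have hsmul : ∀ ζ : ℂ, ‖ζ‖ ≤ 4 → ‖ζ • v‖ ≤ 4 * ‖v‖ := fun ζ hζ => by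
    rw [norm_smul]; exact mul_le_mul_of_nonneg_right hζ hvpos.le
  have hline : ∀ ζ : ℂ, ‖ζ‖ ≤ 4 → ‖x + ζ • v‖ ≤ 1 - s / 2 := fun ζ hζ => by
    have := hsmul ζ hζ
    refine (norm_add_le _ _).trans ?_
    linarith
  set ℓ : Cn n → ℂ →L[ℝ] ℝ := fun y =>
    (fderiv ℝ u y).comp ((ContinuousLinearMap.toSpanSingleton ℂ v).restrictScalars ℝ) with hℓ
  have hℓa : ∀ y (ζ : ℂ), ℓ y ζ = fderiv ℝ u y (ζ • v) := fun y ζ => by simp [hℓ]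
  have hupper := h.taylor_le hs hs1 (v := v) hx (by linarith [sq_nonneg s])
  rw [← hP, ← hX] at hupper
  have hlower := neg_mul_le_of_laplacian_ge (W := fun ζ => u (x + ζ • v) + (-u x + (-ℓ x) ζ))
    hmpos ?_ ?_ ?_ (by simp) (ℓ (x + v) - ℓ x) ?_
  · simp only [one_smul, _root_.neg_apply, hℓa] at hlower
    have e1 : 15000 * P / s ^ 3 * X = 23 * m + 280 * P / s ^ 3 * X := by rw [hm]; ring
    have e2 : 15000 * P / s ^ 3 * X = 40 * P / s ^ 3 * X + 14960 * P / s ^ 3 * X := by ring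
    have p1 : 0 ≤ 280 * P / s ^ 3 * X := by positivity
    have p2 : 0 ≤ 14960 * P / s ^ 3 * X := by positivity
    rw [abs_le]
    constructor
    · linarith
    · linarith
  · refine ContinuousOn.add (fun ζ hζ => ?_) (by fun_prop)
    have h1 : ‖x + ζ • v‖ < 1 := by linarith [hline ζ (by simpa using hζ)]
    have h2 : ContinuousAt u (x + ζ • v) := (h.solution.contDiffAt h1).continuousAt
    exact (ContinuousAt.comp (f := fun ζ : ℂ => x + ζ • v) h2 (by fun_prop)).continuousWithinAt
  · intro ζ₀ hζ₀
    have h1 : ‖x + ζ₀ • v‖ < 1 := by linarith [hline ζ₀ (by simpa using (mem_ball.mp hζ₀).le)]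
    have hmem : x + ζ₀ • v ∈ ball (0 : Cn n) 1 := by simpa using h1
    have hcd := h.solution.contDiffAt h1
    refine ⟨lineLaplacian u (x + ζ₀ • v) v, ?_, ?_⟩
    · have h2 := levi_nonneg (h.solution.posSemidef _ hmem) v
      rw [levi_add, levi_cxHessian hcd] at h2
      have h3 := levi_le_of_norm_le (A := G (x + ζ₀ • v)) (fun i j =>
        (h.metric_bound i j).norm_le _ hmem) v
      have h4 : (n : ℝ) ^ 2 * K * ‖v‖ ^ 2 ≤ P * X := by
        rw [hP]
        have : 0 ≤ (n : ℝ) ^ 2 * K := by have := h.bound_pos; positivity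
        nlinarith [mul_le_mul_of_nonneg_left hvX this]
      nlinarith
    · have h2 := (hasLaplacian_line hcd v).add (hasLaplacian_clm_add (-ℓ x) ζ₀ (-u x))
      simpa only [add_smul, add_assoc, add_zero] using h2
  · intro ζ hζ
    have hζ' : ‖ζ‖ ≤ 4 := by simpa using hζ
    have h1 := h.taylor_le hs hs1 (v := ζ • v) hx (by linarith [hsmul ζ hζ'])
    rw [← hP] at h1
    have h2 : ‖ζ • v‖ ^ (1 + α) ≤ 16 * X := by
      refine (Real.rpow_le_rpow (norm_nonneg _) (hsmul ζ hζ') (by linarith)).trans ?_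
      rw [Real.mul_rpow (by norm_num) hvpos.le]
      refine mul_le_mul_of_nonneg_right ?_ hXpos.le
      rw [show (16 : ℝ) = 4 ^ (2 : ℝ) by norm_num]
      exact Real.rpow_le_rpow_of_exponent_le (by norm_num) (by linarith)
    have h3 := mul_le_mul_of_nonneg_left h2 (by positivity : 0 ≤ 40 * P / s ^ 3)
    have e1 : 40 * P / s ^ 3 * (16 * X) = m := by rw [hm]; ring
    simp only [_root_.neg_apply, hℓa]
    linarith
  · intro k hk
    have hkv : ‖k • v‖ ≤ ‖v‖ := by
      rw [norm_smul]; exact mul_le_of_le_one_left hvpos.le hk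
    have h1 := h.taylor_le (half_pos hs) (by linarith) (x := x + v) (v := k • v)
      (by simpa using hline 1 (by norm_num)) (by linarith)
    rw [← hP] at h1
    have h2 : ‖k • v‖ ^ (1 + α) ≤ X := Real.rpow_le_rpow (norm_nonneg _) hkv (by linarith)
    have h3 := mul_le_mul_of_nonneg_left h2 (by positivity : 0 ≤ 40 * P / (s / 2) ^ 3)
    have e1 : 40 * P / (s / 2) ^ 3 * X = m - 320 * P / s ^ 3 * X := by
      rw [hm]; field_simp; ring
    have p1 : 0 ≤ 320 * P / s ^ 3 * X := by positivity
    simp only [_root_.sub_apply, _root_.neg_apply, hℓa, add_smul, one_smul, map_add, ← add_assoc]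
    linarith

/-- The interior Hölder bound for the gradient at nearby points. -/
lemma norm_fderiv_sub_le_of_near (h : DirichletData α K G g Φ u) {s : ℝ} (hs : 0 < s)
    (hs1 : s ≤ 1) {x y : Cn n} (hx : ‖x‖ ≤ 1 - s) (hy : ‖y‖ ≤ 1 - s)
    (hxy : ‖y - x‖ ≤ s ^ 2 / 128) :
    ‖fderiv ℝ u y - fderiv ℝ u x‖ ≤
      90000 * (10 ^ 6 * n ^ 2 * K) / s ^ 3 * ‖y - x‖ ^ α := by
  have hα := h.exponent_pos
  have hα1 := h.exponent_le_one
  have hc := h.const_pos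
  rcases eq_or_ne y x with rfl | hne
  · simp [Real.zero_rpow hα.ne']
  have hd : 0 < ‖y - x‖ := norm_pos_iff.mpr (sub_ne_zero.mpr hne)
  set d := ‖y - x‖ with hdd
  set P : ℝ := 10 ^ 6 * n ^ 2 * K with hP
  set X := d ^ (1 + α) with hX
  have hXpos : 0 < X := Real.rpow_pos_of_pos hd _
  have hXd : X = d ^ α * d := by rw [hX, add_comm, Real.rpow_add_one hd.ne']
  have key : ∀ k : Cn n, ‖k‖ = d →
      |(fderiv ℝ u y - fderiv ℝ u x) k| ≤ 90000 * P / s ^ 3 * X := by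
    intro k hk
    have h1 := h.abs_taylor_le hs hs1 (v := y - x) hx (by linarith [sq_nonneg s])
    have hyk : ‖y - x + k‖ ≤ 2 * d := (norm_add_le _ _).trans (by rw [hk]; linarith)
    have h2 := h.abs_taylor_le hs hs1 (v := y - x + k) hx (by linarith)
    have h3 := h.abs_taylor_le hs hs1 (v := k) hy (by rw [hk]; linarith [sq_nonneg s])
    have h4 : ‖y - x + k‖ ^ (1 + α) ≤ 4 * X := by
      refine (Real.rpow_le_rpow (norm_nonneg _) hyk (by linarith)).trans ?_
      rw [Real.mul_rpow (by norm_num) hd.le]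
      refine mul_le_mul_of_nonneg_right ?_ hXpos.le
      rw [show (4 : ℝ) = 2 ^ (2 : ℝ) by norm_num]
      exact Real.rpow_le_rpow_of_exponent_le (by norm_num) (by linarith)
    have h5 := mul_le_mul_of_nonneg_left h4 (by positivity : 0 ≤ 15000 * P / s ^ 3)
    rw [add_sub_cancel, ← hdd, ← hP, ← hX] at h1
    rw [← add_assoc, add_sub_cancel, map_add, ← hP] at h2
    rw [hk, ← hP, ← hX] at h3
    have e1 : 90000 * P / s ^ 3 * X = 15000 * P / s ^ 3 * X + 15000 * P / s ^ 3 * (4 * X) +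
      15000 * P / s ^ 3 * X := by ring
    rw [e1, _root_.sub_apply]
    rw [abs_le] at *
    constructor <;> linarith [h1.1, h1.2, h2.1, h2.2, h3.1, h3.2]
  refine ContinuousLinearMap.opNorm_le_bound _ (by positivity) fun k => ?_
  rcases eq_or_ne k 0 with rfl | hk0
  · simp
  have hkp : 0 < ‖k‖ := norm_pos_iff.mpr hk0
  have h1 := key ((d / ‖k‖) • k) (by
    rw [norm_smul, Real.norm_of_nonneg (by positivity)]; field_simp)
  rw [map_smul, smul_eq_mul, abs_mul, abs_of_pos (by positivity), hXd, div_mul_eq_mul_div,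
    div_le_iff₀ hkp] at h1
  rw [Real.norm_eq_abs]
  refine le_of_mul_le_mul_left (h1.trans (le_of_eq ?_)) hd
  ring

/-- The interior Hölder bound for the gradient of a solution in the unit ball. -/
lemma norm_fderiv_sub_le (h : DirichletData α K G g Φ u) {s : ℝ} (hs : 0 < s)
    (hs1 : s ≤ 1) {x y : Cn n} (hx : ‖x‖ ≤ 1 - s) (hy : ‖y‖ ≤ 1 - s) :
    ‖fderiv ℝ u x - fderiv ℝ u y‖ ≤ 90000 * (10 ^ 6 * n ^ 2 * K) / s ^ 3 * ‖x - y‖ ^ α := by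
  have hα := h.exponent_pos
  have hα1 := h.exponent_le_one
  have hc := h.const_pos
  set P : ℝ := 10 ^ 6 * n ^ 2 * K with hP
  rcases le_or_gt ‖x - y‖ (s ^ 2 / 128) with hle | hlt
  · exact h.norm_fderiv_sub_le_of_near hs hs1 hy hx hle
  · have h1 := (norm_sub_le (fderiv ℝ u x) (fderiv ℝ u y)).trans
      (add_le_add (h.norm_fderiv_le hs hx) (h.norm_fderiv_le hs hy))
    have h2 : s ^ 2 / 128 ≤ ‖x - y‖ ^ α := by
      have h3 : s ^ 2 / 128 ≤ 1 := by nlinarith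
      refine le_trans ?_ (Real.rpow_le_rpow (by positivity) hlt.le hα.le)
      simpa using Real.rpow_le_rpow_of_exponent_ge (by positivity) h3 hα1
    refine h1.trans (le_trans ?_ (mul_le_mul_of_nonneg_left h2 (by positivity)))
    rw [← hP]
    field_simp
    norm_num

end DirichletData

end LowerTaylor

/-! ### Rescaling to the unit ball -/

section Rescaling

variable {n : ℕ}

lemma fderiv_smul_comp_smul {A : Type*} [NormedAddCommGroup A] [NormedSpace ℝ A] (F : Cn n → A)
    (c r : ℝ) (x : Cn n) :
    fderiv ℝ (fun z => c • F (r • z)) x = c • r • fderiv ℝ F (r • x) := by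
  rw [show (fun z => c • F (r • z)) = c • fun z => F (r • z) from rfl, fderiv_const_smul_field,
    Pi.smul_apply, fderiv_comp_smul]

lemma cxHessian_comp_smul {u : Cn n → ℝ} {r : ℝ} {z : Cn n} :
    cxHessian n (fun w => u (r • w)) z = r ^ 2 • cxHessian n u (r • z) := by
  have key : ∀ v x : Cn n, fderiv ℝ (fun w => fderiv ℝ (fun w => u (r • w)) w v) z x =
      r ^ 2 * fderiv ℝ (fun w => fderiv ℝ u w v) (r • z) x := fun v x => by
    have h1 : (fun w => fderiv ℝ (fun w => u (r • w)) w v) =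
        fun w => r • (fun w => fderiv ℝ u w v) (r • w) := by
      funext w
      rw [fderiv_comp_smul]
      rfl
    rw [h1, fderiv_smul_comp_smul (fun w => fderiv ℝ u w v)]
    simp only [_root_.smul_apply, smul_eq_mul]
    ring
  ext i j
  simp only [cxHessian, of_apply, Matrix.smul_apply, key, Complex.real_smul]
  push_cast
  ring

lemma fderiv_sub_clm_add_const {u : Cn n → ℝ} {z : Cn n} (hu : DifferentiableAt ℝ u z)
    (L : Cn n →L[ℝ] ℝ) (c : ℝ) :
    fderiv ℝ (fun w => u w - (L w + c)) z = fderiv ℝ u z - L := by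
  rw [fderiv_fun_sub hu (by fun_prop), fderiv_add_const, L.fderiv]

lemma cxHessian_sub_clm_add_const {u : Cn n → ℝ} {z : Cn n} (hu : ContDiffAt ℝ 2 u z)
    (L : Cn n →L[ℝ] ℝ) (c : ℝ) :
    cxHessian n (fun w => u w - (L w + c)) z = cxHessian n u z := by
  have key : ∀ v : Cn n, fderiv ℝ (fun w => fderiv ℝ (fun w => u w - (L w + c)) w v) z =
      fderiv ℝ (fun w => fderiv ℝ u w v) z := fun v => by
    have h1 : (fun w => fderiv ℝ (fun w => u w - (L w + c)) w v) =ᶠ[𝓝 z]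
        fun w => fderiv ℝ u w v - L v := by
      filter_upwards [hu.eventually (by simp)] with w hw
      rw [fderiv_sub_clm_add_const (hw.differentiableAt (by simp))]
      rfl
    rw [h1.fderiv_eq, fderiv_sub_const]
  ext i j
  simp only [cxHessian, of_apply, key]

lemma C1AlphaBound.of_rescale {A : Type*} [NormedAddCommGroup A] [NormedSpace ℝ A]
    {α K K₀ K₁ K₂ r c : ℝ} {F : Cn n → A} (hr : 0 < r) (hc : 0 ≤ c)
    (hF : DifferentiableOn ℝ F (ball 0 r)) (h0 : ∀ x ∈ ball (0 : Cn n) r, ‖F x‖ ≤ K₀)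
    (h1 : ∀ x ∈ ball (0 : Cn n) r, ‖fderiv ℝ F x‖ ≤ K₁)
    (h2 : ∀ x ∈ ball (0 : Cn n) r, ∀ y ∈ ball (0 : Cn n) r,
      ‖fderiv ℝ F x - fderiv ℝ F y‖ ≤ K₂ * ‖x - y‖ ^ α)
    (e0 : c * K₀ ≤ K) (e1 : c * (r * K₁) ≤ K) (e2 : c * (r ^ (1 + α) * K₂) ≤ K) :
    C1AlphaBound α K (fun z => c • F (r • z)) := by
  have hmem : ∀ x ∈ ball (0 : Cn n) 1, r • x ∈ ball (0 : Cn n) r := fun x hx => by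
    rw [mem_ball_zero_iff] at *
    rw [norm_smul, Real.norm_of_nonneg hr.le]
    nlinarith
  have hfd := fderiv_smul_comp_smul F c r
  refine ⟨?_, fun x hx => ?_, fun x hx => ?_, fun x hx y hy => ?_⟩
  · exact (hF.comp (by fun_prop) hmem).const_smul c
  · rw [norm_smul, Real.norm_of_nonneg hc]
    exact (mul_le_mul_of_nonneg_left (h0 _ (hmem x hx)) hc).trans e0
  · rw [hfd, norm_smul, norm_smul, Real.norm_of_nonneg hc, Real.norm_of_nonneg hr.le]
    exact (mul_le_mul_of_nonneg_left (mul_le_mul_of_nonneg_left (h1 _ (hmem x hx)) hr.le)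
      hc).trans e1
  · rw [hfd, hfd, ← smul_sub, ← smul_sub, norm_smul, norm_smul, Real.norm_of_nonneg hc,
      Real.norm_of_nonneg hr.le]
    have h3 := h2 _ (hmem x hx) _ (hmem y hy)
    rw [← smul_sub, norm_smul, Real.norm_of_nonneg hr.le, Real.mul_rpow hr.le (norm_nonneg _)]
      at h3
    have h4 := mul_le_mul_of_nonneg_left (mul_le_mul_of_nonneg_left h3 hr.le) hc
    refine h4.trans (le_trans (le_of_eq ?_) (mul_le_mul_of_nonneg_right e2
      (Real.rpow_nonneg (norm_nonneg (x - y)) α)))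
    rw [Real.rpow_add hr, Real.rpow_one]
    ring

lemma nonneg_of_holder_bound {A : Type*} [SeminormedAddCommGroup A] (hn : 0 < n) {α K r : ℝ}
    (hr : 0 < r) {F : Cn n → A} (h : ∀ x ∈ ball (0 : Cn n) r, ∀ y ∈ ball (0 : Cn n) r,
      ‖F x - F y‖ ≤ K * ‖x - y‖ ^ α) : 0 ≤ K := by
  set e : Cn n := (r / 2) • EuclideanSpace.single ⟨0, hn⟩ (1 : ℂ) with he
  have hen : ‖e‖ = r / 2 := by
    rw [he, norm_smul, Real.norm_of_nonneg (by positivity), PiLp.norm_single, norm_one, mul_one]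
  have h1 := (norm_nonneg _).trans (h e (by rw [mem_ball_zero_iff, hen]; linarith) 0
    (mem_ball_self hr))
  rw [sub_zero, hen] at h1
  exact nonneg_of_mul_nonneg_left h1 (Real.rpow_pos_of_pos (by positivity) _)

end Rescaling

section GeneralRadius

variable {n : ℕ} {α r : ℝ} {u f g Φ : Cn n → ℝ} {G : Cn n → Matrix (Fin n) (Fin n) ℂ}

lemma IsMongeAmpereSolution.of_rescale (hn : 0 < n) (hr : 0 < r)
    (hu : ContDiffOn ℝ 2 u (ball 0 r)) (huc : ContinuousOn u (closedBall 0 r))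
    (hpsd : ∀ z ∈ ball (0 : Cn n) r, (G z + cxHessian n u z).PosSemidef)
    (hdet : ∀ z ∈ ball (0 : Cn n) r, (G z + cxHessian n u z).det = (f z : ℂ))
    (hf : ∀ z ∈ closedBall (0 : Cn n) r, 0 ≤ f z)
    (hg : ∀ z ∈ closedBall (0 : Cn n) r, g z = f z ^ ((n : ℝ)⁻¹)) (L : Cn n →L[ℝ] ℝ) (c : ℝ) :
    IsMongeAmpereSolution (fun z => r ^ 2 • G (r • z)) (fun z => r ^ 2 • g (r • z))
      (fun z => u (r • z) - (L (r • z) + c)) := by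
  have hmem : ∀ x ∈ ball (0 : Cn n) 1, r • x ∈ ball (0 : Cn n) r := fun x hx => by
    rw [mem_ball_zero_iff] at *
    rw [norm_smul, Real.norm_of_nonneg hr.le]
    nlinarith
  have hmemc : ∀ x ∈ closedBall (0 : Cn n) 1, r • x ∈ closedBall (0 : Cn n) r := fun x hx => by
    rw [mem_closedBall_zero_iff] at *
    rw [norm_smul, Real.norm_of_nonneg hr.le]
    nlinarith
  have hsum : ∀ z ∈ ball (0 : Cn n) 1,
      r ^ 2 • G (r • z) + cxHessian n (fun z => u (r • z) - (L (r • z) + c)) z =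
        r ^ 2 • (G (r • z) + cxHessian n u (r • z)) := fun z hz => by
    rw [cxHessian_comp_smul (u := fun w => u w - (L w + c)), cxHessian_sub_clm_add_const
      (hu.contDiffAt (isOpen_ball.mem_nhds (hmem z hz))), smul_add]
  refine ⟨?_, ?_, fun z hz => ?_, fun z hz => ?_, fun z hz => ?_⟩
  · exact (hu.comp (by fun_prop) hmem).sub (by fun_prop)
  · exact (huc.comp (by fun_prop) hmemc).sub (by fun_prop)
  · rw [hsum z hz]
    exact (hpsd _ (hmem z hz)).smul (by positivity)
  · rw [hg _ (ball_subset_closedBall (hmem z hz))]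
    have := hf _ (ball_subset_closedBall (hmem z hz))
    exact smul_nonneg (by positivity) (Real.rpow_nonneg this _)
  · have hz' := ball_subset_closedBall (hmem z hz)
    rw [hsum z hz, ← Complex.coe_smul, det_smul, hdet _ (hmem z hz), smul_eq_mul, mul_pow, hg _ hz',
      Real.rpow_inv_natCast_pow (hf _ hz') hn.ne']
    simp

/-- The first order Taylor polynomial at the centre can be removed from the boundary datum. -/
lemma norm_sub_clm_add_const_le {KΦ : ℝ} (hα : 0 < α) (hr : 0 < r) (hK : 0 ≤ KΦ)
    (hΦ : DifferentiableOn ℝ Φ (ball 0 r))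
    (h : ∀ x ∈ ball (0 : Cn n) r, ∀ y ∈ ball (0 : Cn n) r,
      ‖fderiv ℝ Φ x - fderiv ℝ Φ y‖ ≤ KΦ * ‖x - y‖ ^ α) :
    (∀ x ∈ ball (0 : Cn n) r,
      ‖fderiv ℝ (fun w => Φ w - (fderiv ℝ Φ 0 w + Φ 0)) x‖ ≤ KΦ * r ^ α) ∧
    ∀ x ∈ ball (0 : Cn n) r, ‖Φ x - (fderiv ℝ Φ 0 x + Φ 0)‖ ≤ KΦ * r ^ α * r := by
  have h0 : (0 : Cn n) ∈ ball (0 : Cn n) r := mem_ball_self hr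
  have hd : ∀ x ∈ ball (0 : Cn n) r, DifferentiableAt ℝ Φ x := fun x hx =>
    hΦ.differentiableAt (isOpen_ball.mem_nhds hx)
  have h1 : ∀ x ∈ ball (0 : Cn n) r,
      ‖fderiv ℝ (fun w => Φ w - (fderiv ℝ Φ 0 w + Φ 0)) x‖ ≤ KΦ * r ^ α := fun x hx => by
    rw [fderiv_sub_clm_add_const (hd x hx)]
    refine (h x hx 0 h0).trans (mul_le_mul_of_nonneg_left ?_ hK)
    rw [sub_zero]
    exact Real.rpow_le_rpow (norm_nonneg _) (mem_ball_zero_iff.mp hx).le hα.le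
  refine ⟨h1, fun x hx => ?_⟩
  have h2 := (convex_ball (0 : Cn n) r).norm_image_sub_le_of_norm_fderiv_le (𝕜 := ℝ)
    (f := fun w => Φ w - (fderiv ℝ Φ 0 w + Φ 0)) (fun y hy => (hd y hy).sub (by fun_prop)) h1 h0 hx
  simp only [map_zero, zero_add, sub_self, sub_zero] at h2
  refine h2.trans (mul_le_mul_of_nonneg_left (mem_ball_zero_iff.mp hx).le ?_)
  exact mul_nonneg hK (Real.rpow_nonneg hr.le _)

end GeneralRadius

/-- **Interior `C^{1,α}` estimate for the complex Monge–Ampère equation with a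
Hermitian background form** (Theorem 5.1, case i = 1). Let
`ω = i ∑ g_{i j̄} dz_i ∧ dz̄_j` be a Hermitian form on `B̄_r(0) ⊂ ℂⁿ` (so
`G z = (g_{i j̄}(z))` is positive definite Hermitian) with entries in
`C^{1,α}(B̄_r(0))`. If `u ∈ PSH(B_r(0), ω) ∩ C(B̄_r(0))` solves
`det(g_{i j̄} + u_{i j̄}) = f` in `B_r(0)`, `u = φ` on `∂B_r(0)`, with
`φ ∈ C^{1,α}(∂B_r(0))`, `f ≥ 0`, `f^{1/n} ∈ C^{1,α}(B̄_r(0))`, `α ∈ (0,1]`, then for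
every `t ∈ (0,1)`:
`[u]_{1,α;B_{(1-t)r}} ≤ C(n,t)([φ]_{1,α;∂B_r} + r^{1-α}|f^{1/n}|'_{1,α;B_r} + r^{1-α}|g|'_{1,α;B_r})`.
The boundary seminorm (an infimum over extensions) is expressed by quantifying over
all extensions `Φ ∈ C^{1,α}(B̄_r)` with Hölder gradient constant `KΦ`; the sup-type
norms of `f^{1/n}` and of the entries of `g` are expressed through arbitrary upper
bounds `K₀, K₁, K₂` and `Kg₀, Kg₁, Kg₂`. -/
theorem interior_C1alpha_estimate_hermitian (n : ℕ) (hn : 0 < n)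
    (t : ℝ) (ht0 : 0 < t) (ht1 : t < 1) :
    ∃ C : ℝ, ∀ (α : ℝ), 0 < α → α ≤ 1 → ∀ (r : ℝ), 0 < r →
      ∀ u f g Φ : EuclideanSpace ℂ (Fin n) → ℝ,
      ∀ G : EuclideanSpace ℂ (Fin n) → Matrix (Fin n) (Fin n) ℂ,
      -- G is positive definite Hermitian on B̄_r with entries in C^{1,α}(B̄_r)
      (∀ z ∈ closedBall (0 : EuclideanSpace ℂ (Fin n)) r, (G z).PosDef) →
      (∀ i j : Fin n, ContinuousOn (fun z => G z i j) (closedBall 0 r)) →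
      (∀ i j : Fin n, DifferentiableOn ℝ (fun z => G z i j) (ball 0 r)) →
      -- u ∈ C²(B_r) ∩ C(B̄_r)
      ContDiffOn ℝ 2 u (ball 0 r) →
      ContinuousOn u (closedBall 0 r) →
      -- (g_{i j̄} + u_{i j̄}) is positive semidefinite on B_r
      (∀ z ∈ ball (0 : EuclideanSpace ℂ (Fin n)) r, (G z + cxHessian n u z).PosSemidef) →
      -- the equation det(g_{i j̄} + u_{i j̄}) = f in B_r
      (∀ z ∈ ball (0 : EuclideanSpace ℂ (Fin n)) r, (G z + cxHessian n u z).det = (f z : ℂ)) →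
      -- f ≥ 0 and g = f^{1/n} ∈ C^{1,α}(B̄_r)
      (∀ z ∈ closedBall (0 : EuclideanSpace ℂ (Fin n)) r, 0 ≤ f z) →
      (∀ z ∈ closedBall (0 : EuclideanSpace ℂ (Fin n)) r, g z = f z ^ ((n : ℝ)⁻¹)) →
      ContinuousOn g (closedBall 0 r) →
      DifferentiableOn ℝ g (ball 0 r) →
      -- Φ ∈ C^{1,α}(B̄_r) is an extension of the boundary datum φ, and u = φ on ∂B_r
      ContinuousOn Φ (closedBall 0 r) →
      DifferentiableOn ℝ Φ (ball 0 r) →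
      (∀ z ∈ sphere (0 : EuclideanSpace ℂ (Fin n)) r, u z = Φ z) →
      ∀ KΦ K₀ K₁ K₂ Kg₀ Kg₁ Kg₂ : ℝ,
      (∀ x ∈ ball (0 : EuclideanSpace ℂ (Fin n)) r,
        ∀ y ∈ ball (0 : EuclideanSpace ℂ (Fin n)) r,
          ‖fderiv ℝ Φ x - fderiv ℝ Φ y‖ ≤ KΦ * ‖x - y‖ ^ α) →
      (∀ x ∈ ball (0 : EuclideanSpace ℂ (Fin n)) r, |g x| ≤ K₀) →
      (∀ x ∈ ball (0 : EuclideanSpace ℂ (Fin n)) r, ‖fderiv ℝ g x‖ ≤ K₁) →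
      (∀ x ∈ ball (0 : EuclideanSpace ℂ (Fin n)) r,
        ∀ y ∈ ball (0 : EuclideanSpace ℂ (Fin n)) r,
          ‖fderiv ℝ g x - fderiv ℝ g y‖ ≤ K₂ * ‖x - y‖ ^ α) →
      (∀ i j : Fin n, ∀ x ∈ ball (0 : EuclideanSpace ℂ (Fin n)) r, ‖G x i j‖ ≤ Kg₀) →
      (∀ i j : Fin n, ∀ x ∈ ball (0 : EuclideanSpace ℂ (Fin n)) r,
        ‖fderiv ℝ (fun z => G z i j) x‖ ≤ Kg₁) →
      (∀ i j : Fin n, ∀ x ∈ ball (0 : EuclideanSpace ℂ (Fin n)) r,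
        ∀ y ∈ ball (0 : EuclideanSpace ℂ (Fin n)) r,
          ‖fderiv ℝ (fun z => G z i j) x - fderiv ℝ (fun z => G z i j) y‖ ≤
            Kg₂ * ‖x - y‖ ^ α) →
      -- conclusion
      ∀ x ∈ ball (0 : EuclideanSpace ℂ (Fin n)) ((1 - t) * r),
      ∀ y ∈ ball (0 : EuclideanSpace ℂ (Fin n)) ((1 - t) * r),
        ‖fderiv ℝ u x - fderiv ℝ u y‖ ≤
          C * (KΦ + r ^ (1 - α) * (K₀ + r * K₁ + r ^ (1 + α) * K₂)
              + r ^ (1 - α) * (Kg₀ + r * Kg₁ + r ^ (1 + α) * Kg₂)) * ‖x - y‖ ^ α := by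
  refine ⟨90000 * (10 ^ 6 * n ^ 2) / t ^ 3, ?_⟩
  intro α hα hα1 r hr u f g Φ G hpos hGc hGd hu huc hpsd hdet hf hg hgc hgd hΦc hΦd hbd
    KΦ K₀ K₁ K₂ Kg₀ Kg₁ Kg₂ hKΦ hK₀ hK₁ hK₂ hKg₀ hKg₁ hKg₂ x hx y hy
  have h0 : (0 : Cn n) ∈ ball (0 : Cn n) r := mem_ball_self hr
  have pΦ : 0 ≤ KΦ := nonneg_of_holder_bound hn hr hKΦ
  have p0 : 0 ≤ K₀ := (abs_nonneg _).trans (hK₀ 0 h0)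
  have p1 : 0 ≤ K₁ := (norm_nonneg _).trans (hK₁ 0 h0)
  have p2 : 0 ≤ K₂ := nonneg_of_holder_bound hn hr hK₂
  have pg0 : 0 ≤ Kg₀ := (norm_nonneg _).trans (hKg₀ ⟨0, hn⟩ ⟨0, hn⟩ 0 h0)
  have pg1 : 0 ≤ Kg₁ := (norm_nonneg _).trans (hKg₁ ⟨0, hn⟩ ⟨0, hn⟩ 0 h0)
  have pg2 : 0 ≤ Kg₂ := nonneg_of_holder_bound hn hr (hKg₂ ⟨0, hn⟩ ⟨0, hn⟩)
  set M := KΦ + r ^ (1 - α) * (K₀ + r * K₁ + r ^ (1 + α) * K₂)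
              + r ^ (1 - α) * (Kg₀ + r * Kg₁ + r ^ (1 + α) * Kg₂) with hM
  set R := r ^ (1 + α) with hR
  have hRpos : 0 < R := Real.rpow_pos_of_pos hr _
  have hRr : R = r ^ α * r := by rw [hR, add_comm, Real.rpow_add_one hr.ne']
  have hR2 : R * r ^ (1 - α) = r ^ 2 := by
    rw [hR, ← Real.rpow_add hr, ← Real.rpow_natCast]
    congr 1
    push_cast
    ring
  have hRM : R * M = R * KΦ + r ^ 2 * (K₀ + r * K₁ + R * K₂) +
      r ^ 2 * (Kg₀ + r * Kg₁ + R * Kg₂) := by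
    rw [← hR2, hM]; ring
  have a0 : 0 ≤ R * KΦ := by positivity
  have a1 : 0 ≤ r ^ 2 * K₀ := by positivity
  have a2 : 0 ≤ r ^ 2 * (r * K₁) := by positivity
  have a3 : 0 ≤ r ^ 2 * (R * K₂) := by positivity
  have a4 : 0 ≤ r ^ 2 * Kg₀ := by positivity
  have a5 : 0 ≤ r ^ 2 * (r * Kg₁) := by positivity
  have a6 : 0 ≤ r ^ 2 * (R * Kg₂) := by positivity
  obtain ⟨hΦ1, hΦ0⟩ := norm_sub_clm_add_const_le hα hr pΦ hΦd hKΦ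
  have hΦdiff : ∀ z ∈ ball (0 : Cn n) r, DifferentiableAt ℝ Φ z := fun z hz =>
    hΦd.differentiableAt (isOpen_ball.mem_nhds hz)
  have hdata : ∀ ε > 0, DirichletData α (R * M + ε) (fun z => r ^ 2 • G (r • z))
      (fun z => r ^ 2 • g (r • z)) (fun z => (1 : ℝ) • (Φ (r • z) - (fderiv ℝ Φ 0 (r • z) + Φ 0)))
      (fun z => u (r • z) - (fderiv ℝ Φ 0 (r • z) + Φ 0)) := by
    intro ε hε
    refine ⟨hn, hα, hα1, by rw [hRM]; linarith,
      IsMongeAmpereSolution.of_rescale hn hr hu huc hpsd hdet hf hg _ _,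
      fun i j => ?_, ?_, ?_, ?_, ?_⟩
    · exact C1AlphaBound.of_rescale (c := r ^ 2) hr (sq_nonneg r) (hGd i j) (hKg₀ i j) (hKg₁ i j)
        (hKg₂ i j) (by rw [hRM]; linarith) (by rw [hRM]; linarith) (by rw [← hR, hRM]; linarith)
    · exact C1AlphaBound.of_rescale (c := r ^ 2) hr (sq_nonneg r) hgd hK₀ hK₁ hK₂
        (by rw [hRM]; linarith) (by rw [hRM]; linarith) (by rw [← hR, hRM]; linarith)
    · refine C1AlphaBound.of_rescale (F := fun w => Φ w - (fderiv ℝ Φ 0 w + Φ 0)) (K₂ := KΦ) hr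
        zero_le_one (hΦd.sub (by fun_prop)) hΦ0 hΦ1 (fun z hz w hw => ?_) ?_ ?_ ?_
      · rw [fderiv_sub_clm_add_const (hΦdiff z hz), fderiv_sub_clm_add_const (hΦdiff w hw),
          sub_sub_sub_cancel_right]
        exact hKΦ z hz w hw
      · rw [hRM, one_mul, mul_assoc, ← hRr]; linarith
      · rw [hRM, one_mul, mul_left_comm, mul_comm r, ← hRr]; linarith
      · rw [hRM, one_mul, ← hR]; linarith
    · have hmaps : MapsTo (fun z : Cn n => r • z) (closedBall 0 1) (closedBall 0 r) := fun z hz => by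
        rw [mem_closedBall_zero_iff] at *
        rw [norm_smul, Real.norm_of_nonneg hr.le]
        nlinarith
      exact ((hΦc.comp (by fun_prop) hmaps).sub (by fun_prop)).const_smul (1 : ℝ)
    · intro z hz
      rw [mem_sphere_zero_iff_norm] at hz
      rw [one_smul, hbd (r • z) (by
        rw [mem_sphere_zero_iff_norm, norm_smul, hz, Real.norm_of_nonneg hr.le, mul_one])]
  have hscale : ∀ z ∈ ball (0 : Cn n) ((1 - t) * r), ‖r⁻¹ • z‖ ≤ 1 - t ∧
      fderiv ℝ (fun z => u (r • z) - (fderiv ℝ Φ 0 (r • z) + Φ 0)) (r⁻¹ • z) =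
        r • (fderiv ℝ u z - fderiv ℝ Φ 0) := by
    intro z hz
    rw [mem_ball_zero_iff] at hz
    constructor
    · rw [norm_smul, norm_inv, Real.norm_of_nonneg hr.le, inv_mul_le_iff₀ hr, mul_comm r]
      exact hz.le
    · have hz1 : z ∈ ball (0 : Cn n) r := by
        rw [mem_ball_zero_iff]; nlinarith
      have h1 := fderiv_smul_comp_smul (fun w => u w - (fderiv ℝ Φ 0 w + Φ 0)) 1 r (r⁻¹ • z)
      simp only [one_smul] at h1
      rw [h1, smul_inv_smul₀ hr.ne', fderiv_sub_clm_add_const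
        ((hu.contDiffAt (isOpen_ball.mem_nhds hz1)).differentiableAt (by simp))]
  obtain ⟨hx1, hx2⟩ := hscale x hx
  obtain ⟨hy1, hy2⟩ := hscale y hy
  have hrα : 0 < r ^ α := Real.rpow_pos_of_pos hr _
  have hest : ∀ ε > 0, R * ‖fderiv ℝ u x - fderiv ℝ u y‖ ≤
      90000 * (10 ^ 6 * n ^ 2) / t ^ 3 * ‖x - y‖ ^ α * (R * M + ε) := by
    intro ε hε
    have h1 := (hdata ε hε).norm_fderiv_sub_le ht0 ht1.le hx1 hy1
    rw [hx2, hy2, ← smul_sub, ← smul_sub, sub_sub_sub_cancel_right, norm_smul, norm_smul, norm_inv,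
      Real.norm_of_nonneg hr.le, Real.mul_rpow (inv_nonneg.mpr hr.le) (norm_nonneg _),
      Real.inv_rpow hr.le] at h1
    have h2 := mul_le_mul_of_nonneg_left h1 hrα.le
    rw [← mul_assoc, ← hRr] at h2
    refine h2.trans (le_of_eq ?_)
    field_simp
  have hlim : R * ‖fderiv ℝ u x - fderiv ℝ u y‖ ≤
      90000 * (10 ^ 6 * n ^ 2) / t ^ 3 * ‖x - y‖ ^ α * (R * M) := by
    have h1 : Tendsto (fun ε : ℝ => 90000 * (10 ^ 6 * n ^ 2) / t ^ 3 * ‖x - y‖ ^ α * (R * M + ε))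
        (𝓝[>] 0) (𝓝 (90000 * (10 ^ 6 * n ^ 2) / t ^ 3 * ‖x - y‖ ^ α * (R * M + 0))) :=
      Tendsto.mono_left (Continuous.tendsto (by fun_prop) 0) nhdsWithin_le_nhds
    rw [add_zero] at h1
    exact ge_of_tendsto h1 (by filter_upwards [self_mem_nhdsWithin] with ε hε using hest ε hε)
  refine le_of_mul_le_mul_left (hlim.trans (le_of_eq ?_)) hRpos
  ring
end

section
/- Let $B_r$ be a ball of radius $r>0$ in $\mathbb{R}^n$ and $\alpha\in(0,1]$. If $\varphi:\partial B_r\to\mathbb{R}$ admits at least one extension in $C^{1,\alpha}(\overline{B_r})$, then there exists $\Phi_\infty\in C^{1,\alpha}(\overline{B_r})$ with $\Phi_\infty|_{\partial B_r}=\varphi$ and $[\Phi_\infty]_{1,\alpha;B_r}=[\varphi]_{1,\alpha;\partial B_r}$; that is, the infimum defining $[\varphi]_{1,\alpha;\partial B_r}$ is attained. -/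
open Metric Set

/-- The Hölder seminorm `[Φ]_{1,α;S} = sup_{x ≠ y ∈ S} ‖∇Φ(x) - ∇Φ(y)‖ / |x-y|^α`
of the (real) gradient of `Φ`, as a supremum of real numbers (`sSup`). -/
noncomputable def gradHolderSeminorm (n : ℕ) (α : ℝ) (S : Set (EuclideanSpace ℝ (Fin n)))
    (Φ : EuclideanSpace ℝ (Fin n) → ℝ) : ℝ :=
  sSup {c : ℝ | ∃ x ∈ S, ∃ y ∈ S, x ≠ y ∧ c = ‖fderiv ℝ Φ x - fderiv ℝ Φ y‖ / ‖x - y‖ ^ α}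

/-- `Φ ∈ C^{1,α}(B̄_r)`: `Φ` is continuous on the closed ball, differentiable on the
open ball, and its gradient is `α`-Hölder on the open ball. -/
def MemC1alphaClosedBall (n : ℕ) (α r : ℝ) (Φ : EuclideanSpace ℝ (Fin n) → ℝ) : Prop :=
  ContinuousOn Φ (closedBall 0 r) ∧ DifferentiableOn ℝ Φ (ball 0 r) ∧
    ∃ M : ℝ, ∀ x ∈ ball (0 : EuclideanSpace ℝ (Fin n)) r,
      ∀ y ∈ ball (0 : EuclideanSpace ℝ (Fin n)) r,
        ‖fderiv ℝ Φ x - fderiv ℝ Φ y‖ ≤ M * ‖x - y‖ ^ α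

/-- The boundary seminorm
`[φ]_{1,α;∂B_r} = inf {[Φ]_{1,α;B_r} : Φ ∈ C^{1,α}(B̄_r), Φ|_{∂B_r} = φ}`. -/
noncomputable def bdryHolderSeminorm (n : ℕ) (α r : ℝ)
    (φ : EuclideanSpace ℝ (Fin n) → ℝ) : ℝ :=
  sInf {c : ℝ | ∃ Φ : EuclideanSpace ℝ (Fin n) → ℝ, MemC1alphaClosedBall n α r Φ ∧
    (∀ z ∈ sphere (0 : EuclideanSpace ℝ (Fin n)) r, Φ z = φ z) ∧
    c = gradHolderSeminorm n α (ball 0 r) Φ}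

open Filter Topology

section LimitsOfGradients

variable {E : Type*} [NormedAddCommGroup E] [NormedSpace ℝ E] {F : E → ℝ} {s : Set E}
  {C α r : ℝ}

/-- A bounded family in a proper space converges along every ultrafilter. -/
lemma exists_tendsto_ultrafilter_of_norm_le {ι X : Type*} [SeminormedAddCommGroup X]
    [ProperSpace X] (U : Ultrafilter ι) {u : ι → X} {R : ℝ} (hu : ∀ i, ‖u i‖ ≤ R) :
    ∃ a, Tendsto u U (𝓝 a) := by
  obtain ⟨a, -, ha⟩ := (isCompact_closedBall (0 : X) R).ultrafilter_le_nhds' (U.map u)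
    (Ultrafilter.mem_map.2 (Filter.univ_mem' fun i ↦ by simpa using hu i))
  exact ⟨a, ha⟩

/-- First-order Taylor estimate for a function with `α`-Hölder derivative on a convex open set. -/
lemma abs_sub_sub_fderiv_le_of_holder (hs : Convex ℝ s) (hso : IsOpen s) (hα : 0 ≤ α)
    (hC : 0 ≤ C) (hF : DifferentiableOn ℝ F s)
    (hH : ∀ x ∈ s, ∀ y ∈ s, ‖fderiv ℝ F x - fderiv ℝ F y‖ ≤ C * ‖x - y‖ ^ α)
    {x y : E} (hx : x ∈ s) (hy : y ∈ s) :
    |F y - F x - fderiv ℝ F x (y - x)| ≤ C * ‖y - x‖ ^ α * ‖y - x‖ := by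
  have hsub : segment ℝ x y ⊆ s := hs.segment_subset hx hy
  refine (convex_segment x y).norm_image_sub_le_of_norm_hasFDerivWithin_le'
    (fun z hz ↦ ((hF.differentiableAt (hso.mem_nhds (hsub hz))).hasFDerivAt).hasFDerivWithinAt)
    (fun z hz ↦ (hH z (hsub hz) x hx).trans ?_) (left_mem_segment ℝ x y)
    (right_mem_segment ℝ x y)
  have := norm_sub_le_of_mem_segment hz
  gcongr

/-- Pointwise limits of functions whose gradients are uniformly Hölder and converge pointwise are
differentiable, with the limit gradient. -/
lemma hasFDerivAt_of_tendsto_of_holder {ι : Type*} {l : Filter ι} [l.NeBot] {F : ι → E → ℝ}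
    {Φ : E → ℝ} {g : E →L[ℝ] ℝ} (hs : Convex ℝ s) (hso : IsOpen s) (hα : 0 < α) (hC : 0 ≤ C)
    (hF : ∀ i, DifferentiableOn ℝ (F i) s)
    (hH : ∀ i, ∀ x ∈ s, ∀ y ∈ s, ‖fderiv ℝ (F i) x - fderiv ℝ (F i) y‖ ≤ C * ‖x - y‖ ^ α)
    (hΦ : ∀ x ∈ s, Tendsto (fun i ↦ F i x) l (𝓝 (Φ x))) {x : E} (hx : x ∈ s)
    (hg : Tendsto (fun i ↦ fderiv ℝ (F i) x) l (𝓝 g)) : HasFDerivAt Φ g x := by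
  have taylor : ∀ y ∈ s, |Φ y - Φ x - g (y - x)| ≤ C * ‖y - x‖ ^ α * ‖y - x‖ := fun y hy ↦
    le_of_tendsto (((hΦ y hy).sub (hΦ x hx)).sub
        (((continuous_eval_const (y - x)).tendsto g).comp hg)).abs
      (Eventually.of_forall fun i ↦
        abs_sub_sub_fderiv_le_of_holder hs hso hα.le hC (hF i) (hH i) hx hy)
  refine HasFDerivAt.of_isLittleO (Asymptotics.isLittleO_iff.2 fun ε hε ↦ ?_)
  have hlim : Tendsto (fun y ↦ C * ‖y - x‖ ^ α) (𝓝 x) (𝓝 0) := by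
    have hc : Continuous fun y : E ↦ C * ‖y - x‖ ^ α :=
      continuous_const.mul ((continuous_id.sub continuous_const).norm.rpow_const
        fun _ ↦ Or.inr hα.le)
    simpa [Real.zero_rpow hα.ne'] using hc.tendsto x
  filter_upwards [hlim.eventually_le_const hε, hso.mem_nhds hx] with y hy hys
  exact (taylor y hys).trans (by gcongr)

/-- A function vanishing on the sphere has gradient at the centre controlled by the Hölder constant
of its gradient. -/
lemma norm_fderiv_zero_le_of_eq_zero_on_sphere (hr : 0 < r) (hα : 0 ≤ α) (hC : 0 ≤ C)
    (hFc : ContinuousOn F (closedBall 0 r)) (hF : DifferentiableOn ℝ F (ball 0 r))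
    (hH : ∀ x ∈ ball (0 : E) r, ∀ y ∈ ball (0 : E) r,
      ‖fderiv ℝ F x - fderiv ℝ F y‖ ≤ C * ‖x - y‖ ^ α)
    (h0 : ∀ z ∈ sphere (0 : E) r, F z = 0) : ‖fderiv ℝ F 0‖ ≤ C * r ^ α := by
  refine ContinuousLinearMap.opNorm_le_of_unit_norm (by positivity) fun e he ↦ ?_
  have hnorm : ∀ t : ℝ, ‖t • e‖ = |t| := fun t ↦ by simp [norm_smul, he]
  obtain ⟨t, ht, hdt⟩ := exists_deriv_eq_zero (f := fun t : ℝ ↦ F (t • e))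
    (show -r < r by linarith)
    (hFc.comp (by fun_prop) fun t ht ↦ by
      simpa only [mem_closedBall_zero_iff, hnorm] using abs_le.2 ht)
    (by rw [h0 _ (by simp [norm_smul, he, abs_of_pos hr]),
      h0 _ (by simp [norm_smul, he, abs_of_pos hr])])
  have htr : |t| < r := abs_lt.2 ht
  have htb : t • e ∈ ball (0 : E) r := by rwa [mem_ball_zero_iff, hnorm]
  have hline : HasDerivAt (fun t : ℝ ↦ t • e) e t := by
    simpa using (hasDerivAt_id t).smul_const e
  have hd := (hF.differentiableAt (isOpen_ball.mem_nhds htb)).hasFDerivAt.comp_hasDerivAt t hline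
  have hzero : fderiv ℝ F (t • e) e = 0 := hd.deriv.symm.trans hdt
  calc ‖fderiv ℝ F 0 e‖ = ‖(fderiv ℝ F 0 - fderiv ℝ F (t • e)) e‖ := by simp [hzero]
    _ ≤ ‖fderiv ℝ F 0 - fderiv ℝ F (t • e)‖ := by
      simpa [he] using (fderiv ℝ F 0 - fderiv ℝ F (t • e)).le_opNorm e
    _ ≤ C * ‖0 - t • e‖ ^ α := hH _ (mem_ball_self hr) _ htb
    _ ≤ C * r ^ α := by
      rw [zero_sub, norm_neg, hnorm]
      gcongr

/-- The gradient of a function on the ball is controlled by the Hölder constant of its gradient and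
by any other function with the same boundary values. -/
lemma norm_fderiv_le_of_eq_on_sphere {G : E → ℝ} {C' : ℝ} (hr : 0 < r) (hα : 0 ≤ α)
    (hC : 0 ≤ C) (hC' : 0 ≤ C')
    (hFc : ContinuousOn F (closedBall 0 r)) (hF : DifferentiableOn ℝ F (ball 0 r))
    (hFH : ∀ x ∈ ball (0 : E) r, ∀ y ∈ ball (0 : E) r,
      ‖fderiv ℝ F x - fderiv ℝ F y‖ ≤ C * ‖x - y‖ ^ α)
    (hGc : ContinuousOn G (closedBall 0 r)) (hG : DifferentiableOn ℝ G (ball 0 r))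
    (hGH : ∀ x ∈ ball (0 : E) r, ∀ y ∈ ball (0 : E) r,
      ‖fderiv ℝ G x - fderiv ℝ G y‖ ≤ C' * ‖x - y‖ ^ α)
    (hFG : ∀ z ∈ sphere (0 : E) r, F z = G z) {x : E} (hx : x ∈ ball (0 : E) r) :
    ‖fderiv ℝ F x‖ ≤ C * r ^ α + ((C + C') * r ^ α + ‖fderiv ℝ G 0‖) := by
  have hsub : ∀ x ∈ ball (0 : E) r,
      fderiv ℝ (fun z ↦ F z - G z) x = fderiv ℝ F x - fderiv ℝ G x := fun x hx ↦
    fderiv_fun_sub (hF.differentiableAt (isOpen_ball.mem_nhds hx))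
      (hG.differentiableAt (isOpen_ball.mem_nhds hx))
  have hcentre := norm_fderiv_zero_le_of_eq_zero_on_sphere (F := fun z ↦ F z - G z)
    hr hα (add_nonneg hC hC') (hFc.sub hGc) (hF.sub hG)
    (fun x hx y hy ↦ by
      rw [hsub x hx, hsub y hy, sub_sub_sub_comm, add_mul]
      exact (norm_sub_le _ _).trans (add_le_add (hFH x hx y hy) (hGH x hx y hy)))
    (fun z hz ↦ sub_eq_zero.2 (hFG z hz))
  rw [hsub 0 (mem_ball_self hr)] at hcentre
  have hx0 : ‖fderiv ℝ F x - fderiv ℝ F 0‖ ≤ C * r ^ α := by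
    refine (hFH x hx 0 (mem_ball_self hr)).trans ?_
    have : ‖x‖ ≤ r := (mem_ball_zero_iff.1 hx).le
    rw [sub_zero]
    gcongr
  have h1 := norm_le_norm_sub_add (fderiv ℝ F x) (fderiv ℝ F 0)
  have h2 := norm_le_norm_sub_add (fderiv ℝ F 0) (fderiv ℝ G 0)
  linarith

/-- A gradient bound on the open ball gives a Lipschitz bound on the closed ball. -/
lemma lipschitzOnWith_closedBall_of_norm_fderiv_le (hr : 0 < r)
    (hFc : ContinuousOn F (closedBall 0 r)) (hF : DifferentiableOn ℝ F (ball 0 r))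
    {L : NNReal} (hL : ∀ x ∈ ball (0 : E) r, ‖fderiv ℝ F x‖ ≤ L) :
    LipschitzOnWith L F (closedBall 0 r) := by
  have hopen : LipschitzOnWith L F (ball 0 r) :=
    (convex_ball (0 : E) r).lipschitzOnWith_of_nnnorm_fderiv_le
      (fun x hx ↦ hF.differentiableAt (isOpen_ball.mem_nhds hx)) (fun x hx ↦ hL x hx)
  rw [← closure_ball (0 : E) hr.ne'] at hFc ⊢
  exact hopen.closure hFc

end LimitsOfGradients

section Seminorm

variable {n : ℕ} {α r : ℝ}

lemma gradHolderSeminorm_nonneg (S : Set (EuclideanSpace ℝ (Fin n)))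
    (Φ : EuclideanSpace ℝ (Fin n) → ℝ) : 0 ≤ gradHolderSeminorm n α S Φ :=
  Real.sSup_nonneg fun c ⟨_, _, _, _, _, hc⟩ ↦ hc ▸ by positivity

lemma gradHolderSeminorm_le {S : Set (EuclideanSpace ℝ (Fin n))}
    {Φ : EuclideanSpace ℝ (Fin n) → ℝ} {C : ℝ} (hC : 0 ≤ C)
    (h : ∀ x ∈ S, ∀ y ∈ S, ‖fderiv ℝ Φ x - fderiv ℝ Φ y‖ ≤ C * ‖x - y‖ ^ α) :
    gradHolderSeminorm n α S Φ ≤ C := by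
  refine Real.sSup_le ?_ hC
  rintro c ⟨x, hx, y, hy, hxy, rfl⟩
  have : 0 < ‖x - y‖ := norm_pos_iff.2 (sub_ne_zero.2 hxy)
  exact (div_le_iff₀ (by positivity)).2 (h x hx y hy)

lemma MemC1alphaClosedBall.norm_fderiv_sub_le {Φ : EuclideanSpace ℝ (Fin n) → ℝ}
    (hα : α ≠ 0) (h : MemC1alphaClosedBall n α r Φ) :
    ∀ x ∈ ball (0 : EuclideanSpace ℝ (Fin n)) r, ∀ y ∈ ball (0 : EuclideanSpace ℝ (Fin n)) r,
      ‖fderiv ℝ Φ x - fderiv ℝ Φ y‖ ≤ gradHolderSeminorm n α (ball 0 r) Φ * ‖x - y‖ ^ α := by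
  intro x hx y hy
  obtain rfl | hxy := eq_or_ne x y
  · simp [Real.zero_rpow hα]
  obtain ⟨-, -, M, hM⟩ := h
  have hpos : ∀ {x y : EuclideanSpace ℝ (Fin n)}, x ≠ y → 0 < ‖x - y‖ ^ α := fun hxy ↦
    Real.rpow_pos_of_pos (norm_pos_iff.2 (sub_ne_zero.2 hxy)) α
  refine (div_le_iff₀ (hpos hxy)).1 (le_csSup ⟨M, ?_⟩ ⟨x, hx, y, hy, hxy, rfl⟩)
  rintro c ⟨x, hx, y, hy, hxy, rfl⟩
  exact (div_le_iff₀ (hpos hxy)).2 (hM x hx y hy)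

/-- If extensions `F k` of `φ` have seminorms converging to `c`, some extension of `φ` has seminorm
at most `c`. -/
lemma exists_gradHolderSeminorm_le_of_tendsto [Nontrivial (EuclideanSpace ℝ (Fin n))]
    (hα : 0 < α) (hr : 0 < r) {φ : EuclideanSpace ℝ (Fin n) → ℝ} {c : ℝ}
    {F : ℕ → EuclideanSpace ℝ (Fin n) → ℝ} (hF : ∀ k, MemC1alphaClosedBall n α r (F k))
    (hφ : ∀ k, ∀ z ∈ sphere (0 : EuclideanSpace ℝ (Fin n)) r, F k z = φ z)
    (hc : Tendsto (fun k ↦ gradHolderSeminorm n α (ball 0 r) (F k)) atTop (𝓝 c)) :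
    ∃ Φ, MemC1alphaClosedBall n α r Φ ∧
      (∀ z ∈ sphere (0 : EuclideanSpace ℝ (Fin n)) r, Φ z = φ z) ∧
      gradHolderSeminorm n α (ball 0 r) Φ ≤ c := by
  have hH := fun k ↦ (hF k).norm_fderiv_sub_le hα.ne'
  have hnn := fun k ↦ gradHolderSeminorm_nonneg (α := α) (ball 0 r) (F k)
  obtain ⟨C, hC⟩ := hc.bddAbove_range
  replace hC : ∀ k, gradHolderSeminorm n α (ball 0 r) (F k) ≤ C := fun k ↦ hC ⟨k, rfl⟩
  have hC0 : 0 ≤ C := (hnn 0).trans (hC 0)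
  have hHC : ∀ k, ∀ x ∈ ball (0 : EuclideanSpace ℝ (Fin n)) r, ∀ y ∈ ball 0 r,
      ‖fderiv ℝ (F k) x - fderiv ℝ (F k) y‖ ≤ C * ‖x - y‖ ^ α := fun k x hx y hy ↦
    (hH k x hx y hy).trans (by gcongr; exact hC k)
  obtain ⟨L, hL⟩ : ∃ L : NNReal, ∀ k, ∀ x ∈ ball (0 : EuclideanSpace ℝ (Fin n)) r,
      ‖fderiv ℝ (F k) x‖ ≤ L :=
    ⟨⟨C * r ^ α + ((C + C) * r ^ α + ‖fderiv ℝ (F 0) 0‖), by positivity⟩, fun k x hx ↦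
      norm_fderiv_le_of_eq_on_sphere hr hα.le hC0 hC0 (hF k).1 (hF k).2.1 (hHC k) (hF 0).1
        (hF 0).2.1 (hHC 0) (fun z hz ↦ (hφ k z hz).trans (hφ 0 z hz).symm) hx⟩
  have hLip := fun k ↦ lipschitzOnWith_closedBall_of_norm_fderiv_le hr (hF k).1 (hF k).2.1 (hL k)
  obtain ⟨z₀, hz₀⟩ := NormedSpace.sphere_nonempty (x := (0 : EuclideanSpace ℝ (Fin n))).2 hr.le
  let U : Ultrafilter ℕ := hyperfilter ℕ
  have hU : (U : Filter ℕ) ≤ atTop := by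
    simpa [U, Nat.cofinite_eq_atTop] using hyperfilter_le_cofinite (α := ℕ)
  have hval : ∀ x, ∃ a, x ∈ closedBall (0 : EuclideanSpace ℝ (Fin n)) r →
      Tendsto (fun k ↦ F k x) U (𝓝 a) := fun x ↦ by
    by_cases hx : x ∈ closedBall (0 : EuclideanSpace ℝ (Fin n)) r
    · obtain ⟨a, ha⟩ := exists_tendsto_ultrafilter_of_norm_le U (u := fun k ↦ F k x)
        (R := L * ‖x - z₀‖ + ‖φ z₀‖) fun k ↦ by
          have := (hLip k).norm_sub_le hx (sphere_subset_closedBall hz₀)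
          rw [hφ k z₀ hz₀] at this
          linarith [norm_le_norm_sub_add (F k x) (φ z₀)]
      exact ⟨a, fun _ ↦ ha⟩
    · exact ⟨0, fun h ↦ absurd h hx⟩
  choose Φ hΦ using hval
  have hgrad : ∀ x ∈ ball (0 : EuclideanSpace ℝ (Fin n)) r,
      Tendsto (fun k ↦ fderiv ℝ (F k) x) U (𝓝 (fderiv ℝ Φ x)) ∧ DifferentiableAt ℝ Φ x :=
    fun x hx ↦ by
      obtain ⟨g, hg⟩ := exists_tendsto_ultrafilter_of_norm_le U fun k ↦ hL k x hx
      have hd : HasFDerivAt Φ g x := hasFDerivAt_of_tendsto_of_holder (convex_ball 0 r) isOpen_ball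
        hα hC0 (fun k ↦ (hF k).2.1) hHC (fun y hy ↦ hΦ y (ball_subset_closedBall hy)) hx hg
      exact ⟨hd.fderiv ▸ hg, hd.differentiableAt⟩
  have hHolder : ∀ x ∈ ball (0 : EuclideanSpace ℝ (Fin n)) r, ∀ y ∈ ball 0 r,
      ‖fderiv ℝ Φ x - fderiv ℝ Φ y‖ ≤ c * ‖x - y‖ ^ α := fun x hx y hy ↦
    le_of_tendsto_of_tendsto' ((hgrad x hx).1.sub (hgrad y hy).1).norm
      ((hc.mono_left hU).mul_const _) fun k ↦ hH k x hx y hy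
  have hLipΦ : LipschitzOnWith L Φ (closedBall 0 r) :=
    LipschitzOnWith.of_dist_le_mul fun x hx y hy ↦
      le_of_tendsto ((hΦ x hx).dist (hΦ y hy))
        (Eventually.of_forall fun k ↦ (hLip k).dist_le_mul x hx y hy)
  refine ⟨Φ, ⟨hLipΦ.continuousOn, fun x hx ↦ (hgrad x hx).2.differentiableWithinAt, c, hHolder⟩,
    fun z hz ↦ ?_, gradHolderSeminorm_le (ge_of_tendsto' hc hnn) hHolder⟩
  exact tendsto_nhds_unique (hΦ z (sphere_subset_closedBall hz))
    (tendsto_const_nhds.congr fun k ↦ (hφ k z hz).symm)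

end Seminorm

/-- **The infimum defining the boundary seminorm `[φ]_{1,α;∂B_r}` is attained**
(Section 2.1). If `φ : ∂B_r → ℝ` admits at least one extension in `C^{1,α}(B̄_r)`,
then there is an extension `Φ∞ ∈ C^{1,α}(B̄_r)` of `φ` with
`[Φ∞]_{1,α;B_r} = [φ]_{1,α;∂B_r}`. -/
theorem bdryHolderSeminorm_attained (n : ℕ) (α r : ℝ) (hα0 : 0 < α) (hα1 : α ≤ 1)
    (hr : 0 < r) (φ : EuclideanSpace ℝ (Fin n) → ℝ)
    (hext : ∃ Φ : EuclideanSpace ℝ (Fin n) → ℝ, MemC1alphaClosedBall n α r Φ ∧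
      ∀ z ∈ sphere (0 : EuclideanSpace ℝ (Fin n)) r, Φ z = φ z) :
    ∃ Φinf : EuclideanSpace ℝ (Fin n) → ℝ, MemC1alphaClosedBall n α r Φinf ∧
      (∀ z ∈ sphere (0 : EuclideanSpace ℝ (Fin n)) r, Φinf z = φ z) ∧
      gradHolderSeminorm n α (ball 0 r) Φinf = bdryHolderSeminorm n α r φ := by
  set T : Set ℝ := {c : ℝ | ∃ Φ : EuclideanSpace ℝ (Fin n) → ℝ, MemC1alphaClosedBall n α r Φ ∧
    (∀ z ∈ sphere (0 : EuclideanSpace ℝ (Fin n)) r, Φ z = φ z) ∧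
    c = gradHolderSeminorm n α (ball 0 r) Φ}
  have hTne : T.Nonempty := let ⟨Φ, h, hφ⟩ := hext; ⟨_, Φ, h, hφ, rfl⟩
  have hTbdd : BddBelow T := ⟨0, fun c ⟨Φ, _, _, hc⟩ ↦ hc ▸ gradHolderSeminorm_nonneg _ Φ⟩
  have hsemi : bdryHolderSeminorm n α r φ = sInf T := rfl
  suffices ∃ Φ, MemC1alphaClosedBall n α r Φ ∧
      (∀ z ∈ sphere (0 : EuclideanSpace ℝ (Fin n)) r, Φ z = φ z) ∧
      gradHolderSeminorm n α (ball 0 r) Φ ≤ sInf T by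
    obtain ⟨Φ, h, hφ, hle⟩ := this
    exact ⟨Φ, h, hφ, hsemi ▸ hle.antisymm (csInf_le hTbdd ⟨Φ, h, hφ, rfl⟩)⟩
  obtain _ | _ := subsingleton_or_nontrivial (EuclideanSpace ℝ (Fin n))
  · obtain ⟨Φ, h, hφ⟩ := hext
    refine ⟨Φ, h, hφ, le_csInf hTne ?_⟩
    rintro c ⟨Ψ, -, -, rfl⟩
    refine gradHolderSeminorm_le (gradHolderSeminorm_nonneg _ Ψ) fun x _ y _ ↦ ?_
    simp [Subsingleton.elim x y, Real.zero_rpow hα0.ne']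
  · obtain ⟨u, -, hu, huT⟩ := exists_seq_tendsto_sInf hTne hTbdd
    choose F hF hφ hFu using huT
    exact exists_gradHolderSeminorm_le_of_tendsto hα0 hr hF hφ (by simpa only [← hFu] using hu)
end

section
/- Let $B$ be the open unit ball in $\mathbb{C}^n$. Suppose $u\in C^2(B)\cap C(\bar B)$ is plurisubharmonic on $B$, satisfies $\det(u_{i\bar j})=f$ in $B$ for a continuous $f\geq 0$ on $\bar B$, and $u=\varphi$ on $\partial B$ for a continuous $\varphi$. Then $\sup_{B}|u|\leq \sup_{\partial B}|\varphi|+\sup_{B}f^{1/n}$. -/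
open Metric Set
open scoped ComplexOrder

open Filter Topology

/-- The second-order necessary condition at a local minimum of a function of one variable. -/
lemma IsLocalMin.deriv_deriv_nonneg {g : ℝ → ℝ} {a : ℝ} (h : IsLocalMin g a)
    (hc : ContinuousAt g a) : 0 ≤ deriv (deriv g) a := by
  by_contra! hneg
  have hmax := isLocalMax_of_deriv_deriv_neg hneg h.deriv_eq_zero hc
  have hconst : g =ᶠ[𝓝 a] fun _ => g a := by
    filter_upwards [h, hmax] with x h₁ h₂ using le_antisymm h₂ h₁
  have h0 : deriv (deriv g) a = 0 := by
    rw [hconst.deriv.deriv_eq]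
    simp
  exact hneg.ne h0

/-- At a local minimum of `u - c‖·‖²`, the real Hessian of `u` is bounded below by `2c`. -/
lemma two_mul_norm_sq_le_of_isLocalMin {E : Type*} [NormedAddCommGroup E] [InnerProductSpace ℝ E]
    {u : E → ℝ} {z : E} {c : ℝ} (hu : ContDiffAt ℝ 2 u z)
    (h : IsLocalMin (fun w => u w - c * ‖w‖ ^ 2) z) (v : E) :
    2 * c * ‖v‖ ^ 2 ≤ fderiv ℝ (fderiv ℝ u) z v v := by
  have hline : ∀ t : ℝ, HasDerivAt (fun t : ℝ => z + t • v) v t := fun t => by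
    simpa using ((hasDerivAt_id t).smul_const v).const_add z
  have hz : z + (0 : ℝ) • v = z := by simp
  have htend : Tendsto (fun t : ℝ => z + t • v) (𝓝 0) (𝓝 z) := by
    simpa only [hz] using (hline 0).continuousAt.tendsto
  have hquad : ∀ t : ℝ, HasDerivAt (fun t : ℝ => c * ‖z + t • v‖ ^ 2)
      (c * (2 * inner ℝ (z + t • v) v)) t := fun t => (hline t).norm_sq.const_mul c
  set g : ℝ → ℝ := fun t => u (z + t • v) - c * ‖z + t • v‖ ^ 2 with hg
  have hg1 : ∀ᶠ t in 𝓝 (0 : ℝ), HasDerivAt g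
      (fderiv ℝ u (z + t • v) v - c * (2 * inner ℝ (z + t • v) v)) t := by
    have hd : ∀ᶠ w in 𝓝 z, DifferentiableAt ℝ u w :=
      (hu.eventually (by simp)).mono fun w hw => hw.differentiableAt (by simp)
    filter_upwards [htend.eventually hd] with t ht
    exact (ht.hasFDerivAt.comp_hasDerivAt t (hline t)).sub (hquad t)
  have hF : HasFDerivAt (fderiv ℝ u) (fderiv ℝ (fderiv ℝ u) z) (z + (0 : ℝ) • v) := by
    rw [hz]
    exact ((hu.fderiv_right (m := 1) (by norm_num)).differentiableAt (by simp)).hasFDerivAt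
  have hg2 : HasDerivAt (fun t : ℝ => fderiv ℝ u (z + t • v) v
      - c * (2 * inner ℝ (z + t • v) v))
      (fderiv ℝ (fderiv ℝ u) z v v - c * (2 * inner ℝ v v)) 0 := by
    have h0 : HasDerivAt (fun t : ℝ => fderiv ℝ u (z + t • v)) (fderiv ℝ (fderiv ℝ u) z v) 0 :=
      hF.comp_hasDerivAt (0 : ℝ) (hline 0)
    have h1 : HasDerivAt (fun t : ℝ => fderiv ℝ u (z + t • v) v)
        (fderiv ℝ (fderiv ℝ u) z v v) 0 := by
      simpa using h0.clm_apply (hasDerivAt_const (0 : ℝ) v)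
    have h2 : HasDerivAt (fun t : ℝ => inner ℝ (z + t • v) v) (inner ℝ v v) 0 := by
      simpa using (hline 0).inner ℝ (hasDerivAt_const (0 : ℝ) v)
    exact h1.sub ((h2.const_mul 2).const_mul c)
  have hdd : deriv (deriv g) 0 = fderiv ℝ (fderiv ℝ u) z v v - c * (2 * inner ℝ v v) := by
    have he : deriv g =ᶠ[𝓝 0] fun t : ℝ => fderiv ℝ u (z + t • v) v
        - c * (2 * inner ℝ (z + t • v) v) := hg1.mono fun t ht => ht.deriv
    rw [he.deriv_eq, hg2.deriv]
  have hmin : IsLocalMin g 0 := by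
    have := htend.eventually h
    filter_upwards [this] with t ht
    simpa [hg] using ht
  have := hmin.deriv_deriv_nonneg hg1.self_of_nhds.continuousAt
  rw [hdd, real_inner_self_eq_norm_sq] at this
  linarith

section LeviForm

variable {E : Type*} [NormedAddCommGroup E] [NormedSpace ℂ E]

/-- Four times the Levi form of a real bilinear form on a complex vector space. -/
noncomputable def leviForm (B : E →L[ℝ] E →L[ℝ] ℝ) (v w : E) : ℂ :=
  Complex.ofReal (B v w + B (Complex.I • v) (Complex.I • w))
    + Complex.I * Complex.ofReal (B v (Complex.I • w) - B (Complex.I • v) w)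

lemma smul_eq_re_add_im (c : ℂ) (v : E) : c • v = c.re • v + c.im • (Complex.I • v) := by
  conv_lhs => rw [← Complex.re_add_im c]
  rw [add_smul, mul_smul]
  simp

lemma I_smul_eq_re_sub_im (c : ℂ) (v : E) :
    Complex.I • c • v = c.re • (Complex.I • v) - c.im • v := by
  rw [smul_eq_re_add_im c v, smul_add, smul_comm _ c.re, smul_comm _ c.im, smul_smul Complex.I]
  simp [sub_eq_add_neg]

lemma leviForm_smul_left (B : E →L[ℝ] E →L[ℝ] ℝ) (c : ℂ) (v w : E) :
    leviForm B (c • v) w = c * leviForm B v w := by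
  unfold leviForm
  rw [I_smul_eq_re_sub_im c v, smul_eq_re_add_im c v]
  apply Complex.ext <;> simp <;> ring

lemma leviForm_smul_right (B : E →L[ℝ] E →L[ℝ] ℝ) (c : ℂ) (v w : E) :
    leviForm B v (c • w) = star c * leviForm B v w := by
  unfold leviForm
  rw [I_smul_eq_re_sub_im c w, smul_eq_re_add_im c w]
  apply Complex.ext <;> simp <;> ring

lemma leviForm_sum_left (B : E →L[ℝ] E →L[ℝ] ℝ) {ι : Type*} (s : Finset ι) (v : ι → E) (w : E) :
    leviForm B (∑ i ∈ s, v i) w = ∑ i ∈ s, leviForm B (v i) w := by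
  simp [leviForm, Finset.smul_sum, Finset.sum_add_distrib, Finset.mul_sum, mul_sub]

lemma leviForm_sum_right (B : E →L[ℝ] E →L[ℝ] ℝ) {ι : Type*} (s : Finset ι) (v : E) (w : ι → E) :
    leviForm B v (∑ i ∈ s, w i) = ∑ i ∈ s, leviForm B v (w i) := by
  simp [leviForm, Finset.smul_sum, Finset.sum_add_distrib, Finset.mul_sum, mul_sub]

lemma leviForm_self_re (B : E →L[ℝ] E →L[ℝ] ℝ) (v : E) :
    (leviForm B v v).re = B v v + B (Complex.I • v) (Complex.I • v) := by
  simp [leviForm]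

end LeviForm

lemma cxHessian_apply {n : ℕ} {u : EuclideanSpace ℂ (Fin n) → ℝ} {z : EuclideanSpace ℂ (Fin n)}
    (hu : ContDiffAt ℝ 2 u z) (i j : Fin n) :
    cxHessian n u z i j = (1 / 4 : ℂ) * leviForm (fderiv ℝ (fderiv ℝ u) z)
      (EuclideanSpace.single i 1) (EuclideanSpace.single j 1) := by
  have hd : DifferentiableAt ℝ (fderiv ℝ u) z :=
    (hu.fderiv_right (m := 1) (by norm_num)).differentiableAt (by simp)
  have key : ∀ a b, fderiv ℝ (fun w => fderiv ℝ u w a) z b = fderiv ℝ (fderiv ℝ u) z b a := by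
    intro a b
    rw [fderiv_clm_apply hd (differentiableAt_const a)]
    simp
  have hI : ∀ k : Fin n, Complex.I • EuclideanSpace.single k (1 : ℂ)
      = EuclideanSpace.single k Complex.I := fun k => by
    ext l
    simp
  simp only [cxHessian, Matrix.of_apply, key, leviForm, hI]

/-- The Hermitian form of the complex Hessian in terms of the real Hessian. -/
lemma re_dotProduct_cxHessian_mulVec {n : ℕ} {u : EuclideanSpace ℂ (Fin n) → ℝ}
    {z : EuclideanSpace ℂ (Fin n)} (hu : ContDiffAt ℝ 2 u z) (x : Fin n → ℂ) :
    (star x ⬝ᵥ (cxHessian n u z).mulVec x).re =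
      (1 / 4) * (fderiv ℝ (fderiv ℝ u) z (WithLp.toLp 2 (star x)) (WithLp.toLp 2 (star x))
        + fderiv ℝ (fderiv ℝ u) z (Complex.I • WithLp.toLp 2 (star x))
          (Complex.I • WithLp.toLp 2 (star x))) := by
  set B := fderiv ℝ (fderiv ℝ u) z with hB
  have hy : (WithLp.toLp 2 (star x) : EuclideanSpace ℂ (Fin n))
      = ∑ i, star (x i) • EuclideanSpace.single i (1 : ℂ) := by
    ext k
    simp [Pi.single_apply]
  have : star x ⬝ᵥ (cxHessian n u z).mulVec x
      = (1 / 4 : ℂ) * leviForm B (WithLp.toLp 2 (star x)) (WithLp.toLp 2 (star x)) := by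
    rw [hy, leviForm_sum_left]
    simp only [leviForm_sum_right, leviForm_smul_left, leviForm_smul_right, dotProduct,
      Matrix.mulVec, cxHessian_apply hu, Finset.mul_sum, star_star, Pi.star_apply, ← hB]
    refine Finset.sum_congr rfl fun i _ => Finset.sum_congr rfl fun j _ => ?_
    ring
  rw [this, ← leviForm_self_re]
  simp [Complex.mul_re]

/-- At an interior local minimum of `u - c‖·‖²`, the Hermitian form of the complex Hessian of `u`
is bounded below by `c`. -/
lemma mul_norm_sq_le_re_dotProduct_cxHessian_mulVec {n : ℕ} {u : EuclideanSpace ℂ (Fin n) → ℝ}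
    {z : EuclideanSpace ℂ (Fin n)} {c : ℝ} (hu : ContDiffAt ℝ 2 u z)
    (h : IsLocalMin (fun w => u w - c * ‖w‖ ^ 2) z) (x : EuclideanSpace ℂ (Fin n)) :
    c * ‖x‖ ^ 2 ≤ (star (x : Fin n → ℂ) ⬝ᵥ (cxHessian n u z).mulVec x).re := by
  let _ : InnerProductSpace ℝ (EuclideanSpace ℂ (Fin n)) :=
    InnerProductSpace.rclikeToReal ℂ (EuclideanSpace ℂ (Fin n))
  rw [re_dotProduct_cxHessian_mulVec hu]
  have hn : ‖(WithLp.toLp 2 (star (x : Fin n → ℂ)) : EuclideanSpace ℂ (Fin n))‖ = ‖x‖ := by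
    simp [EuclideanSpace.norm_eq]
  have h1 := two_mul_norm_sq_le_of_isLocalMin hu h (WithLp.toLp 2 (star (x : Fin n → ℂ)))
  have h2 := two_mul_norm_sq_le_of_isLocalMin hu h
    (Complex.I • WithLp.toLp 2 (star (x : Fin n → ℂ)))
  rw [norm_smul, Complex.norm_I, one_mul, hn] at h2
  rw [hn] at h1
  linarith

lemma Matrix.IsHermitian.pow_le_of_det_eq {n : ℕ} {A : Matrix (Fin n) (Fin n) ℂ}
    (hA : A.IsHermitian) {c d : ℝ} (hc : 0 ≤ c)
    (h : ∀ x : EuclideanSpace ℂ (Fin n), c * ‖x‖ ^ 2 ≤ (star (x : Fin n → ℂ) ⬝ᵥ A.mulVec x).re)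
    (hd : A.det = (d : ℂ)) : c ^ n ≤ d := by
  have hev : ∀ i, c ≤ hA.eigenvalues i := fun i => by
    have := h (hA.eigenvectorBasis i)
    rw [hA.eigenvectorBasis.norm_eq_one] at this
    rw [hA.eigenvalues_eq]
    simpa using this
  have hdet : d = ∏ i, hA.eigenvalues i := by
    rw [hA.det_eq_prod_eigenvalues] at hd
    have := hd.symm
    rw [← Complex.ofReal_inj, this]
    simp
  rw [hdet]
  calc c ^ n = ∏ _i : Fin n, c := by simp
    _ ≤ _ := Finset.prod_le_prod (fun _ _ => hc) fun i _ => hev i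

/-- If `v - c‖·‖²` has no local minimum in the unit ball, a lower bound for `v` on the sphere
gives a lower bound inside. -/
lemma le_of_forall_not_isLocalMin {E : Type*} [NormedAddCommGroup E] [ProperSpace E]
    {v : E → ℝ} {c m : ℝ} (hc : 0 ≤ c) (hv : ContinuousOn v (closedBall 0 1))
    (hm : ∀ z ∈ sphere (0 : E) 1, m ≤ v z)
    (h : ∀ z ∈ ball (0 : E) 1, ¬ IsLocalMin (fun w => v w - c * ‖w‖ ^ 2) z)
    {x : E} (hx : x ∈ ball (0 : E) 1) : m - c ≤ v x := by
  obtain ⟨z, hz, hmin⟩ := (isCompact_closedBall (0 : E) 1).exists_isMinOn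
    ⟨x, ball_subset_closedBall hx⟩ (f := fun w => v w - c * ‖w‖ ^ 2)
    (hv.sub (by fun_prop))
  have hzs : z ∈ sphere (0 : E) 1 := by
    by_contra hns
    have hzb : z ∈ ball (0 : E) 1 := by
      rw [← closedBall_sdiff_sphere]; exact ⟨hz, hns⟩
    exact h z hzb (hmin.isLocalMin (mem_of_superset (isOpen_ball.mem_nhds hzb)
      ball_subset_closedBall))
  have h1 : v z - c * ‖z‖ ^ 2 ≤ v x - c * ‖x‖ ^ 2 := hmin (ball_subset_closedBall hx)
  have h2 := hm z hzs
  rw [mem_sphere_zero_iff_norm.mp hzs] at h1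
  nlinarith [mul_nonneg hc (sq_nonneg ‖x‖)]

/-- **Sup estimate via the comparison principle** (inequality (3.46)).
If `u ∈ PSH(B) ∩ C(B̄)` solves `det(u_{i j̄}) = f` in the unit ball `B ⊂ ℂⁿ`
with `f ≥ 0` continuous on `B̄` and `u = φ` on `∂B` for a continuous `φ`, then
`sup_B |u| ≤ sup_{∂B} |φ| + sup_B f^{1/n}`.
The conclusion is stated pointwise, with the sups on the right expressed through
arbitrary upper bounds `K₀ ≥ sup_{∂B}|φ|` and `K₁ ≥ sup_B f^{1/n}`. -/
theorem sup_estimate_monge_ampere (n : ℕ) (hn : 0 < n)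
    (u f φ : EuclideanSpace ℂ (Fin n) → ℝ)
    -- u ∈ C²(B) ∩ C(B̄)
    (hu2 : ContDiffOn ℝ 2 u (ball 0 1))
    (huc : ContinuousOn u (closedBall 0 1))
    -- u is plurisubharmonic on B
    (hpsh : ∀ z ∈ ball (0 : EuclideanSpace ℂ (Fin n)) 1, (cxHessian n u z).PosSemidef)
    -- the complex Monge-Ampère equation det(u_{i j̄}) = f in B
    (heq : ∀ z ∈ ball (0 : EuclideanSpace ℂ (Fin n)) 1, (cxHessian n u z).det = (f z : ℂ))
    -- f ≥ 0 is continuous on B̄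
    (hfc : ContinuousOn f (closedBall 0 1))
    (hf0 : ∀ z ∈ closedBall (0 : EuclideanSpace ℂ (Fin n)) 1, 0 ≤ f z)
    -- φ is continuous and u = φ on ∂B
    (hφc : ContinuousOn φ (sphere 0 1))
    (hbd : ∀ z ∈ sphere (0 : EuclideanSpace ℂ (Fin n)) 1, u z = φ z)
    (K₀ K₁ : ℝ)
    (hK₀ : ∀ z ∈ sphere (0 : EuclideanSpace ℂ (Fin n)) 1, |φ z| ≤ K₀)
    (hK₁ : ∀ z ∈ ball (0 : EuclideanSpace ℂ (Fin n)) 1, f z ^ ((n : ℝ)⁻¹) ≤ K₁) :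
    ∀ x ∈ ball (0 : EuclideanSpace ℂ (Fin n)) 1, |u x| ≤ K₀ + K₁ := by
  intro x hx
  have hu : ∀ z ∈ ball (0 : EuclideanSpace ℂ (Fin n)) 1, ContDiffAt ℝ 2 u z := fun z hz =>
    hu2.contDiffAt (isOpen_ball.mem_nhds hz)
  have hK₁0 : 0 ≤ K₁ := (Real.rpow_nonneg (hf0 x (ball_subset_closedBall hx)) _).trans (hK₁ x hx)
  refine le_of_forall_pos_le_add fun ε hε => ?_
  have hlow : -K₀ - (K₁ + ε) ≤ u x := by
    refine le_of_forall_not_isLocalMin (by positivity) huc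
      (fun z hz => hbd z hz ▸ (abs_le.mp (hK₀ z hz)).1) (fun z hz hmin => ?_) hx
    have hpow := (hpsh z hz).isHermitian.pow_le_of_det_eq (by positivity)
      (mul_norm_sq_le_re_dotProduct_cxHessian_mulVec (hu z hz) hmin) (heq z hz)
    have hroot := Real.rpow_le_rpow (by positivity) hpow (inv_nonneg.mpr n.cast_nonneg)
    rw [Real.pow_rpow_inv_natCast (by positivity) hn.ne'] at hroot
    linarith [hK₁ z hz]
  have hup : -K₀ - ε ≤ -u x := by
    refine le_of_forall_not_isLocalMin (v := fun w => -u w) hε.le huc.neg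
      (fun z hz => neg_le_neg (hbd z hz ▸ (abs_le.mp (hK₀ z hz)).2)) (fun z hz hmin => ?_) hx
    set e : EuclideanSpace ℂ (Fin n) := EuclideanSpace.single ⟨0, hn⟩ 1 with he
    have h1 := mul_norm_sq_le_re_dotProduct_cxHessian_mulVec (hu z hz).neg hmin e
    have hpos := (Complex.nonneg_iff.mp
      ((hpsh z hz).dotProduct_mulVec_nonneg (e : Fin n → ℂ))).1
    have hneg : fderiv ℝ (fderiv ℝ fun w => -u w) z = -fderiv ℝ (fderiv ℝ u) z := by
      have : (fderiv ℝ fun w => -u w) = fun w => -fderiv ℝ u w := funext fun w => fderiv_fun_neg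
      rw [this, fderiv_fun_neg]
    rw [re_dotProduct_cxHessian_mulVec (hu z hz)] at hpos
    rw [re_dotProduct_cxHessian_mulVec (hu z hz).neg] at h1
    have hnorm : ‖e‖ = 1 := by simp [he]
    simp only [hnorm, hneg, neg_apply] at h1
    linarith
  exact abs_le.mpr ⟨by linarith, by linarith⟩
end
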